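/- The set C_{Ω,P}, equipped with the edge decomposition E and positive integer edge weights m_e = m_e^{Ω,P} arising as the density of the weak-* limit of the deviation measures φ'_N, is an Ω-tropical curve. -/

import Mathlib

open Filter
open scoped Pointwise Topology

/-! ## The abelian sandpile model on a finite subset `Γ` of `ℤ²` -/

/-- Lattice sites. -/
abbrev V : Type := ℤ × ℤ

/-- The four lattice neighbours of `v`. -/
def nbrs (v : V) : Finset V :=
  {(v.1 + 1, v.2), (v.1 - 1, v.2), (v.1, v.2 + 1), (v.1, v.2 - 1)}

/-- A sandpile state on `Γ`: a nonnegative integer valued function, regarded as a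
function on all of `ℤ²` vanishing outside `Γ`. -/
def IsState (Γ : Set V) (φ : V → ℤ) : Prop :=
  (∀ v, 0 ≤ φ v) ∧ ∀ v ∉ Γ, φ v = 0

open Classical in
/-- The toppling operator at `v ∈ Γ`: `T_v φ = φ - 4δ_v + ∑_{w ∈ n(v) ∩ Γ} δ_w`. -/
noncomputable def toppleAt (Γ : Set V) (v : V) (φ : V → ℤ) : V → ℤ :=
  fun w => φ w - (if w = v then 4 else 0) + (if w ∈ nbrs v ∧ w ∈ Γ then 1 else 0)

/-- A state is stable if it is at most `3` everywhere on `Γ`. -/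
def StableState (Γ : Set V) (φ : V → ℤ) : Prop := ∀ v ∈ Γ, φ v ≤ 3

/-- One legal toppling step: topple some `v ∈ Γ` with `φ v ≥ 4`. -/
def LegalStep (Γ : Set V) (φ ψ : V → ℤ) : Prop :=
  ∃ v ∈ Γ, 4 ≤ φ v ∧ ψ = toppleAt Γ v φ

/-- `ρ 0, ρ 1, …, ρ m` is a relaxation of `φ`: a sequence of legal topplings
ending in a stable state. -/
def IsRelaxation (Γ : Set V) (φ : V → ℤ) (m : ℕ) (ρ : ℕ → V → ℤ) : Prop :=
  ρ 0 = φ ∧ (∀ i < m, LegalStep Γ (ρ i) (ρ (i + 1))) ∧ StableState Γ (ρ m)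

/-- `ψ` is the result of some relaxation of `φ`. -/
def Relaxes (Γ : Set V) (φ ψ : V → ℤ) : Prop :=
  ∃ m ρ, IsRelaxation Γ φ m ρ ∧ ρ m = ψ

/-! ## Geometry: lattice polygons, scaled lattice sets, deviation sets -/

/-- The embedding of the lattice `ℤ²` into the plane `ℝ²`. -/
def toR (v : ℤ × ℤ) : ℝ × ℝ := ((v.1 : ℝ), (v.2 : ℝ))

/-- `Ω` is a non-degenerate convex lattice polygon: the convex hull of a finite set of
lattice points, with nonempty interior. -/
def IsLatticePolygon (Ω : Set (ℝ × ℝ)) : Prop :=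
  (∃ S : Finset (ℤ × ℤ), Ω = convexHull ℝ (toR '' ↑S)) ∧ (interior Ω).Nonempty

/-- `Γ_N = (NΩ) ∩ ℤ²`. -/
def latGrid (Ω : Set (ℝ × ℝ)) (N : ℕ) : Set V := {v : V | toR v ∈ (N : ℝ) • Ω}

/-- Coordinate-wise floor `[Np] ∈ ℤ²` of the rescaled point `Np`, `p ∈ ℝ²`. -/
noncomputable def flr (N : ℕ) (p : ℝ × ℝ) : V := (⌊(N : ℝ) * p.1⌋, ⌊(N : ℝ) * p.2⌋)

open Classical in
/-- The perturbed maximal state `3 + ∑_{p ∈ P} δ_{[Np]}` on `Γ_N` (as a function on `ℤ²`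
vanishing outside `Γ_N`). -/
noncomputable def stateN (Ω : Set (ℝ × ℝ)) (P : Finset (ℝ × ℝ)) (N : ℕ) : V → ℤ :=
  fun v => if v ∈ latGrid Ω N then 3 + ∑ p ∈ P, (if v = flr N p then 1 else 0) else 0

/-- The scaled deviation set `C_N = (1/N)·{v ∈ Γ_N : ψ v < 3}` of a state `ψ` on `Γ_N`. -/
def devSet (Ω : Set (ℝ × ℝ)) (N : ℕ) (ψ : V → ℤ) : Set (ℝ × ℝ) :=
  {x | ∃ v ∈ latGrid Ω N, ψ v < 3 ∧ x = ((v.1 : ℝ) / N, (v.2 : ℝ) / N)}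

/-- `l ∈ ℤ²` is the primitive integer vector of the direction `d ∈ ℝ²`:
its coordinates are coprime and `d` is a positive multiple of `l`. -/
def PrimOut (d : ℝ × ℝ) (l : ℤ × ℤ) : Prop :=
  Int.gcd l.1 l.2 = 1 ∧ ∃ t : ℝ, 0 < t ∧ d = t • toR l

/-- `d ∈ ℝ²` has rational slope (it is a positive multiple of an integer vector). -/
def RatDir (d : ℝ × ℝ) : Prop := ∃ l, PrimOut d l

open Classical in
/-- The primitive integer vector of a direction `d` with rational slope
(junk value `0` otherwise). -/
noncomputable def prim (d : ℝ × ℝ) : ℤ × ℤ :=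
  if h : ∃ l, PrimOut d l then h.choose else 0

/-- An edge (straight closed segment) recorded by its two endpoints. -/
abbrev Seg : Type := (ℝ × ℝ) × (ℝ × ℝ)

/-- The closed segment of an edge. -/
def seg (e : Seg) : Set (ℝ × ℝ) := segment ℝ e.1 e.2

/-! ## The deviation densities and their weak-* limit -/

open Classical in
/-- The rescaled deviation density `φ'_N(x) = N(3 - ψ([Nx]))` for `[Nx] ∈ Γ_N`, else `0`. -/
noncomputable def devDens (Ω : Set (ℝ × ℝ)) (N : ℕ) (ψ : V → ℤ) : ℝ × ℝ → ℝ :=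
  fun x => if flr N x ∈ latGrid Ω N then (N : ℝ) * (3 - (ψ (flr N x) : ℝ)) else 0

/-- The Euclidean norm on `ℝ²`. -/
noncomputable def enorm2 (v : ℝ × ℝ) : ℝ := Real.sqrt (v.1 ^ 2 + v.2 ^ 2)

/-- The integral `∫_e ψ dH¹` of `ψ` over the segment `e` with respect to arclength. -/
noncomputable def segInt (e : Seg) (ψ : ℝ × ℝ → ℝ) : ℝ :=
  enorm2 (e.2 - e.1) * ∫ t in (0:ℝ)..1, ψ (e.1 + t • (e.2 - e.1))

/-- A test function: smooth and supported in the interior of `Ω`. -/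
def TestFun (Ω : Set (ℝ × ℝ)) (ψ : ℝ × ℝ → ℝ) : Prop :=
  ContDiff ℝ (⊤ : ℕ∞) ψ ∧ tsupport ψ ⊆ interior Ω

/-- The pairing `∑_{e ∈ E} ‖l_e‖ · m_e · ∫_e ψ dH¹` of a weighted graph with a test
function. -/
noncomputable def tropPairing (E : Finset Seg) (m : Seg → ℕ) (ψ : ℝ × ℝ → ℝ) : ℝ :=
  ∑ e ∈ E, enorm2 (toR (prim (e.2 - e.1))) * (m e : ℝ) * segInt e ψ

/-- The deviation densities of the states `φ N` converge weakly-* to the weighted graph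
`(E, m)`:  `lim_N ∫ φ'_N ψ = ∑_{e ∈ E} ‖l_e‖ m_e ∫_e ψ` for all test functions `ψ`. -/
def WeakLimit (Ω : Set (ℝ × ℝ)) (φ : ℕ → V → ℤ) (E : Finset Seg) (m : Seg → ℕ) : Prop :=
  ∀ ψ : ℝ × ℝ → ℝ, TestFun Ω ψ →
    Filter.Tendsto (fun N => ∫ x : ℝ × ℝ, devDens Ω N (φ N) x * ψ x)
      Filter.atTop (nhds (tropPairing E m ψ))

/-! ## Ω-tropical curves -/

/-- A valid edge set: no degenerate edges and each edge recorded in one orientation only. -/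
def EdgeSet (E : Finset Seg) : Prop := ∀ e ∈ E, e.1 ≠ e.2 ∧ (e.2, e.1) ∉ E

/-- Edges meet only at common endpoints. -/
def Planar (E : Finset Seg) : Prop :=
  ∀ e ∈ E, ∀ e' ∈ E, e ≠ e' →
    seg e ∩ seg e' ⊆ ({e.1, e.2} : Set (ℝ × ℝ)) ∩ {e'.1, e'.2}

/-- The support of the graph: the union of its closed edges. -/
def gsupp (E : Finset Seg) : Set (ℝ × ℝ) := ⋃ e ∈ E, seg e

/-- `v` is a vertex of the graph `E`. -/
def IsVert (E : Finset Seg) (v : ℝ × ℝ) : Prop := ∃ e ∈ E, e.1 = v ∨ e.2 = v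

/-- The primitive integer vector of the edge `e`, oriented out of its endpoint `v`. -/
noncomputable def outDir (v : ℝ × ℝ) (e : Seg) : ℤ × ℤ :=
  if e.1 = v then prim (e.2 - e.1) else prim (e.1 - e.2)

open Classical in
/-- The balancing sum `∑_{e ∈ E_v} m_e l_e` at `v`, over edges incident to `v`, with
`l_e` oriented out of `v`. -/
noncomputable def balSum (E : Finset Seg) (m : Seg → ℕ) (v : ℝ × ℝ) : ℤ × ℤ :=
  ∑ e ∈ E.filter (fun e => e.1 = v ∨ e.2 = v), (m e : ℤ) • outDir v e

/-- The segment `[a, b]` is a side of the polygon `Ω`: its endpoints are distinct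
vertices (extreme points) of `Ω` and it lies in the boundary of `Ω`. -/
def IsSide (Ω : Set (ℝ × ℝ)) (a b : ℝ × ℝ) : Prop :=
  a ≠ b ∧ a ∈ Set.extremePoints ℝ Ω ∧ b ∈ Set.extremePoints ℝ Ω ∧
    segment ℝ a b ⊆ frontier Ω

/-- A labeling of the sides of `Ω` by positive integers (independent of orientation). -/
def SideLabel (Ω : Set (ℝ × ℝ)) (d : Seg → ℤ) : Prop :=
  ∀ a b : ℝ × ℝ, IsSide Ω a b → 0 < d (a, b) ∧ d (a, b) = d (b, a)

/-- The outer balancing equations: at every vertex `v` of `Ω` with incident sides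
`s₁ = [v,a]`, `s₂ = [v,b]`, one has `∑_{e ∈ E_v} m_e l_e = d_{s₁} l_{s₁} + d_{s₂} l_{s₂}`. -/
def OuterBalEq (Ω : Set (ℝ × ℝ)) (E : Finset Seg) (m : Seg → ℕ) (d : Seg → ℤ) : Prop :=
  ∀ v ∈ Set.extremePoints ℝ Ω, ∀ a b : ℝ × ℝ, a ≠ b →
    IsSide Ω v a → IsSide Ω v b →
      balSum E m v = d (v, a) • prim (a - v) + d (v, b) • prim (b - v)

/-- `(E, m)` is an `Ω`-tropical curve: a finite weighted planar graph contained in `Ω`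
whose edges have rational slopes and positive integer weights, meeting `∂Ω` exactly in
the vertices of `Ω`, balanced at every vertex interior to `Ω`, and satisfying the outer
balancing condition at the vertices of `Ω` for a unique positive labeling of the sides. -/
def OmegaTropCurve (Ω : Set (ℝ × ℝ)) (E : Finset Seg) (m : Seg → ℕ) : Prop :=
  EdgeSet E ∧ Planar E ∧ (∀ e ∈ E, 0 < m e) ∧ (∀ e ∈ E, RatDir (e.2 - e.1)) ∧
  gsupp E ⊆ Ω ∧
  gsupp E ∩ frontier Ω = Set.extremePoints ℝ Ω ∧
  (∀ v : ℝ × ℝ, IsVert E v → v ∈ interior Ω → balSum E m v = 0) ∧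
  ∃ d : Seg → ℤ, SideLabel Ω d ∧ OuterBalEq Ω E m d ∧
    ∀ d' : Seg → ℤ, SideLabel Ω d' → OuterBalEq Ω E m d' →
      ∀ a b : ℝ × ℝ, IsSide Ω a b → d' (a, b) = d (a, b)

open MeasureTheory

/-! ### Discrete Laplacian, odometer, least action -/

def lapZ (H : V → ℤ) (v : V) : ℤ :=
  H (v.1 + 1, v.2) + H (v.1 - 1, v.2) + H (v.1, v.2 + 1) + H (v.1, v.2 - 1) - 4 * H v

open Classical in
theorem lapZ_add_single (H : V → ℤ) (v w : V) :
    lapZ (fun x => H x + if x = v then 1 else 0) w =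
      lapZ H w - (if w = v then 4 else 0) + (if w ∈ nbrs v then 1 else 0) := by
  obtain ⟨a, b⟩ := v
  obtain ⟨c, d⟩ := w
  simp only [lapZ, nbrs, Finset.mem_insert, Finset.mem_singleton, Prod.mk.injEq]
  split_ifs <;> omega

theorem odometer (Γ : Set V) (s φ : V → ℤ) (h : Relaxes Γ s φ) :
    ∃ H : V → ℤ, (∀ v, 0 ≤ H v) ∧ (∀ v ∉ Γ, H v = 0) ∧ (∀ v ∈ Γ, φ v = s v + lapZ H v) ∧
      (∀ v ∈ Γ, φ v ≤ 3) ∧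
      (∀ G : V → ℤ, (∀ v, 0 ≤ G v) → (∀ v ∈ Γ, s v + lapZ G v ≤ 3) → ∀ v, H v ≤ G v) := by
  classical
  obtain ⟨m, ρ, ⟨h0, hstep, hst⟩, rfl⟩ := h
  have key : ∀ i ≤ m, ∃ H : V → ℤ, (∀ v, 0 ≤ H v) ∧ (∀ v ∉ Γ, H v = 0) ∧
      (∀ v ∈ Γ, ρ i v = s v + lapZ H v) ∧
      (∀ G : V → ℤ, (∀ v, 0 ≤ G v) → (∀ v ∈ Γ, s v + lapZ G v ≤ 3) → ∀ v, H v ≤ G v) := by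
    intro i
    induction i with
    | zero =>
      intro _
      refine ⟨fun _ => 0, by simp, by simp, ?_, ?_⟩
      · intro v _; simp [lapZ, h0]
      · intro G hG _ v; exact hG v
    | succ i ih =>
      intro hi
      obtain ⟨H, H0, Hout, Heq, Hmin⟩ := ih (by omega)
      obtain ⟨v, hv, h4, hρ⟩ := hstep i (by omega)
      refine ⟨fun x => H x + if x = v then 1 else 0, ?_, ?_, ?_, ?_⟩
      · intro x; have := H0 x; dsimp only; split_ifs <;> omega
      · intro x hx
        have : x ≠ v := fun h => hx (h ▸ hv)
        simp [this, Hout x hx]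
      · intro w hw
        rw [lapZ_add_single, hρ, toppleAt, Heq w hw]
        simp only [hw, and_true]
        ring
      · intro G hG hGs x
        have h1 := Hmin G hG hGs
        dsimp only
        split_ifs with hx
        · subst hx
          by_contra hcon
          have heq : H x = G x := le_antisymm (h1 x) (by omega)
          have h2 := Heq x hv
          have h3 := hGs x hv
          simp only [lapZ] at h2 h3
          have := h1 (x.1 + 1, x.2)
          have := h1 (x.1 - 1, x.2)
          have := h1 (x.1, x.2 + 1)
          have := h1 (x.1, x.2 - 1)
          omega
        · have := h1 x; omega
  obtain ⟨H, a, b, c, d⟩ := key m le_rfl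
  exact ⟨H, a, b, c, hst, d⟩

/-! ### Gradient estimate for discrete harmonic functions -/

def lapR (f : V → ℝ) (v : V) : ℝ :=
  f (v.1 + 1, v.2) + f (v.1 - 1, v.2) + f (v.1, v.2 + 1) + f (v.1, v.2 - 1) - 4 * f v

theorem max_principle (D : Finset V) (f : V → ℝ) (hsub : ∀ v ∈ D, 0 < f v → 0 ≤ lapR f v)
    (hout : ∀ v ∉ D, f v ≤ 0) : ∀ v, f v ≤ 0 := by
  by_contra! hcon
  obtain ⟨v, hv⟩ := hcon
  have hvD : v ∈ D := by
    by_contra h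
    exact absurd (hout v h) (by linarith)
  obtain ⟨x, hxD, hx⟩ := D.exists_max_image f ⟨v, hvD⟩
  have hM : 0 < f x := lt_of_lt_of_le hv (hx v hvD)
  have hle : ∀ y, f y ≤ f x := fun y => by
    by_cases h : y ∈ D
    · exact hx y h
    · exact (hout y h).trans hM.le
  obtain ⟨z, hz, hzm⟩ := (D.filter (fun y => f y = f x)).exists_max_image (fun y => y.1)
    ⟨x, by simp [hxD]⟩
  rw [Finset.mem_filter] at hz
  have h1 := hsub z hz.1 (hz.2 ▸ hM)
  have h2 : f (z.1 + 1, z.2) < f x := by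
    refine lt_of_le_of_ne (hle _) fun heq => ?_
    by_cases h : (z.1 + 1, z.2) ∈ D
    · have := hzm (z.1 + 1, z.2) (by simp [h, heq])
      simp at this
    · have := hout _ h
      linarith
  have := hle (z.1 - 1, z.2)
  have := hle (z.1, z.2 + 1)
  have := hle (z.1, z.2 - 1)
  simp only [lapR, hz.2] at h1
  linarith

theorem grad_est0 (u : V → ℝ) (K : ℤ) (hK : 1 ≤ K) (M : ℝ)
    (hb : ∀ x y : ℤ, |x| ≤ K → |y| ≤ K → |u (x, y)| ≤ M)
    (hh : ∀ x y : ℤ, |x| < K → |y| < K → lapR u (x, y) = 0) :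
    u (1, 0) - u (0, 0) ≤ 4 * M / K := by
  classical
  have hM : 0 ≤ M := (abs_nonneg _).trans (hb 0 0 (by simp; omega) (by simp; omega))
  have hKr : (1 : ℝ) ≤ K := by exact_mod_cast hK
  rcases eq_or_lt_of_le hK with hK1 | hK2
  · subst hK1
    have h1 := abs_le.1 (hb 1 0 (by simp) (by simp))
    have h2 := abs_le.1 (hb 0 0 (by simp) (by simp))
    simp only [Int.cast_one, div_one]
    linarith [h1.2, h2.1]
  set B : V → ℝ := fun v => ((v.1 : ℝ) * (2 * K - v.1) + (v.2 : ℝ) ^ 2) / (K : ℝ) ^ 2 with hB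
  set g : V → ℝ := fun v => u v - u (1 - v.1, v.2) - 2 * M * B v with hg
  let D : Finset V := (Finset.Icc 1 (K - 1)) ×ˢ (Finset.Icc (1 - K) (K - 1))
  have hlapB : ∀ v, lapR B v = 0 := by
    intro v
    simp only [lapR, hB]
    push_cast
    field_simp
    ring
  have hBnn : ∀ x y : ℤ, 0 ≤ x → x ≤ K → 0 ≤ B (x, y) := by
    intro x y h1 h2
    have h1' : (0 : ℝ) ≤ x := by exact_mod_cast h1
    have h2' : (x : ℝ) ≤ K := by exact_mod_cast h2
    simp only [hB]
    have : 0 ≤ (x : ℝ) * (2 * K - x) := mul_nonneg h1' (by linarith)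
    positivity
  have hB1 : ∀ x y : ℤ, 0 ≤ x → x ≤ K → (x = K ∨ |y| = K) → 1 ≤ B (x, y) := by
    intro x y h1 h2 h3
    have h1' : (0 : ℝ) ≤ x := by exact_mod_cast h1
    have h2' : (x : ℝ) ≤ K := by exact_mod_cast h2
    simp only [hB]
    rw [le_div_iff₀ (by positivity)]
    rcases h3 with h3 | h3
    · subst h3; nlinarith [sq_nonneg (y : ℝ)]
    · have : (y : ℝ) ^ 2 = (K : ℝ) ^ 2 := by
        rw [← sq_abs (y : ℝ)]; congr 1; exact_mod_cast h3
      nlinarith [mul_nonneg h1' (by linarith : (0 : ℝ) ≤ 2 * K - x)]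
  have hgbd : ∀ x y : ℤ, 0 ≤ x → x ≤ K → |y| ≤ K → (x = K ∨ |y| = K) → g (x, y) ≤ 0 := by
    intro x y h1 h2 h3 h4
    have a1 := abs_le.1 (hb x y (by rw [abs_le]; omega) h3)
    have a2 := abs_le.1 (hb (1 - x) y (by rw [abs_le]; omega) h3)
    have := hB1 x y h1 h2 h4
    simp only [hg]
    nlinarith [a1.2, a2.1]
  have hlapg : ∀ x y : ℤ, 1 ≤ x → x ≤ K - 1 → |y| < K → lapR g (x, y) = 0 := by
    intro x y h1 h2 h3
    have e1 := hh x y (by rw [abs_lt]; omega) h3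
    have e2 := hh (1 - x) y (by rw [abs_lt]; omega) h3
    have e3 := hlapB (x, y)
    simp only [lapR, hg] at *
    rw [show (1 : ℤ) - (x + 1) = 1 - x - 1 by ring, show (1 : ℤ) - (x - 1) = 1 - x + 1 by ring]
    linear_combination e1 - e2 - 2 * M * e3
  have main := max_principle D (fun v => if v ∈ D then g v else 0) ?_ ?_ (1, 0)
  · have hD : ((1 : ℤ), (0 : ℤ)) ∈ D := by simp [D]; omega
    simp only [hD, if_true, hg, sub_self, hB] at main
    norm_num at main
    have : 2 * M * ((2 * K - 1) / (K : ℝ) ^ 2) ≤ 4 * M / K := by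
      rw [← mul_div_assoc, div_le_div_iff₀ (by positivity) (by positivity)]
      nlinarith [mul_nonneg hM (by linarith : (0 : ℝ) ≤ K)]
    linarith
  · rintro ⟨x, y⟩ hv hpos
    simp only [hv, if_true] at hpos
    have hv' := hv
    simp only [D, Finset.mem_product, Finset.mem_Icc] at hv
    obtain ⟨⟨h1, h2⟩, h3, h4⟩ := hv
    have e := hlapg x y h1 h2 (by rw [abs_lt]; omega)
    have nb : ∀ x' y' : ℤ, (x' = 0 → x = 1 ∧ y' = y) → 0 ≤ x' → x' ≤ K → |y'| ≤ K →
        g (x', y') ≤ (if (x', y') ∈ D then g (x', y') else 0) := by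
      intro x' y' k0 k1 k2 k3
      split_ifs with hD
      · exact le_rfl
      · by_cases hx0 : x' = 0
        · obtain ⟨rfl, rfl⟩ := k0 hx0
          subst hx0
          have p1 := hBnn 1 y' (by norm_num) (by omega)
          have p2 := hBnn 0 y' (by norm_num) (by omega)
          simp only [hg] at hpos ⊢
          norm_num at hpos ⊢
          have q1 := mul_nonneg hM p1
          have q2 := mul_nonneg hM p2
          nlinarith
        · apply hgbd x' y' k1 k2 k3
          by_contra! hcon
          apply hD
          simp only [D, Finset.mem_product, Finset.mem_Icc]
          have := abs_le.1 k3
          have : y' ≠ K := fun h => hcon.2 (by rw [h, abs_of_nonneg]; omega)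
          have : y' ≠ -K := fun h => hcon.2 (by rw [h, abs_neg, abs_of_nonneg]; omega)
          have := hcon.1
          omega
    simp only [lapR, hv', if_true] at e ⊢
    have n1 := nb (x + 1) y (by omega) (by omega) (by omega) (by rw [abs_le]; omega)
    have n2 := nb (x - 1) y (by omega) (by omega) (by omega) (by rw [abs_le]; omega)
    have n3 := nb x (y + 1) (by omega) (by omega) (by omega) (by rw [abs_le]; omega)
    have n4 := nb x (y - 1) (by omega) (by omega) (by omega) (by rw [abs_le]; omega)
    linarith
  · intro v hv
    simp [hv]

theorem grad_est1 (u : V → ℝ) (v : V) (K : ℤ) (hK : 1 ≤ K) (M : ℝ)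
    (hb : ∀ x y : ℤ, |x| ≤ K → |y| ≤ K → |u (v.1 + x, v.2 + y)| ≤ M)
    (hh : ∀ x y : ℤ, |x| < K → |y| < K → lapR u (v.1 + x, v.2 + y) = 0) :
    |u (v.1 + 1, v.2) - u v| ≤ 4 * M / K := by
  rw [abs_le']
  constructor
  · have := grad_est0 (fun w => u (v.1 + w.1, v.2 + w.2)) K hK M hb ?_
    · simpa using this
    · intro x y hx hy
      have := hh x y hx hy
      simp only [lapR] at this ⊢
      convert this using 5 <;> ring_nf
  · have := grad_est0 (fun w => - u (v.1 + w.1, v.2 + w.2)) K hK M ?_ ?_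
    · simp at this; simp; linarith
    · intro x y hx hy; simpa using hb x y hx hy
    · intro x y hx hy
      have := hh x y hx hy
      simp only [lapR] at this ⊢
      simp only [← add_assoc, ← add_sub_assoc]
      linarith

theorem grad_est2 (u : V → ℝ) (v : V) (K : ℤ) (hK : 1 ≤ K) (M : ℝ)
    (hb : ∀ x y : ℤ, |x| ≤ K → |y| ≤ K → |u (v.1 + x, v.2 + y)| ≤ M)
    (hh : ∀ x y : ℤ, |x| < K → |y| < K → lapR u (v.1 + x, v.2 + y) = 0) :
    |u (v.1, v.2 + 1) - u v| ≤ 4 * M / K := by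
  have := grad_est1 (fun w => u (w.2, w.1)) (v.2, v.1) K hK M
    (fun x y hx hy => hb y x hy hx) (fun x y hx hy => by
      have := hh y x hy hx
      simp only [lapR] at this ⊢
      linarith)
  simpa using this

/-- Both first differences. -/
def dif (b : Bool) (u : V → ℝ) (v : V) : ℝ :=
  if b then u (v.1 + 1, v.2) - u v else u (v.1, v.2 + 1) - u v

theorem dif_est (b : Bool) (u : V → ℝ) (v : V) (K : ℤ) (hK : 1 ≤ K) (M : ℝ)
    (hb : ∀ x y : ℤ, |x| ≤ K → |y| ≤ K → |u (v.1 + x, v.2 + y)| ≤ M)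
    (hh : ∀ x y : ℤ, |x| < K → |y| < K → lapR u (v.1 + x, v.2 + y) = 0) :
    |dif b u v| ≤ 4 * M / K := by
  cases b
  · simpa [dif] using grad_est2 u v K hK M hb hh
  · simpa [dif] using grad_est1 u v K hK M hb hh

theorem lapR_dif (b : Bool) (u : V → ℝ) (v : V) (h0 : lapR u v = 0)
    (h1 : lapR u (v.1 + 1, v.2) = 0) (h2 : lapR u (v.1, v.2 + 1) = 0) :
    lapR (dif b u) v = 0 := by
  cases b
  · simp only [lapR, dif] at *
    simp only [Bool.false_eq_true, if_false]
    ring_nf at *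
    linarith
  · simp only [lapR, dif] at *
    simp only [if_true]
    ring_nf at *
    linarith

theorem dif2_est (b c : Bool) (u : V → ℝ) (v : V) (K : ℤ) (hK : 1 ≤ K) (M : ℝ)
    (hb : ∀ x y : ℤ, |x| ≤ 2 * K → |y| ≤ 2 * K → |u (v.1 + x, v.2 + y)| ≤ M)
    (hh : ∀ x y : ℤ, |x| < 2 * K → |y| < 2 * K → lapR u (v.1 + x, v.2 + y) = 0) :
    |dif c (dif b u) v| ≤ 16 * M / K ^ 2 := by
  have hKr : (1 : ℝ) ≤ K := by exact_mod_cast hK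
  have := dif_est c (dif b u) v K hK (4 * M / K) ?_ ?_
  · refine this.trans (le_of_eq ?_)
    field_simp; ring
  · intro x y hx hy
    rw [abs_le] at hx hy
    apply dif_est b u _ K hK M
    · intro x' y' hx' hy'
      rw [abs_le] at hx' hy'
      have := hb (x + x') (y + y') (by rw [abs_le]; omega) (by rw [abs_le]; omega)
      simpa [add_assoc] using this
    · intro x' y' hx' hy'
      rw [abs_lt] at hx' hy'
      have := hh (x + x') (y + y') (by rw [abs_lt]; omega) (by rw [abs_lt]; omega)
      simpa [add_assoc] using this
  · intro x y hx hy
    rw [abs_lt] at hx hy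
    apply lapR_dif
    · exact hh x y (by rw [abs_lt]; omega) (by rw [abs_lt]; omega)
    · have := hh (x + 1) y (by rw [abs_lt]; omega) (by rw [abs_lt]; omega)
      simpa [add_assoc] using this
    · have := hh x (y + 1) (by rw [abs_lt]; omega) (by rw [abs_lt]; omega)
      simpa [add_assoc] using this

/-- A function on the integers which is locally constant on an interval around 0. -/
theorem const_interval (f : ℤ → ℤ) (L : ℤ)
    (h : ∀ k, -L ≤ k → k < L → f (k + 1) = f k) : ∀ k, -L ≤ k → k ≤ L → f k = f 0 := by
  have pos : ∀ n : ℕ, (n : ℤ) ≤ L → f n = f 0 := by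
    intro n
    induction n with
    | zero => simp
    | succ n ih =>
      intro hn
      push_cast at hn ⊢
      rw [h n (by omega) (by omega)]
      exact ih (by omega)
  have neg : ∀ n : ℕ, (n : ℤ) ≤ L → f (-n) = f 0 := by
    intro n
    induction n with
    | zero => simp
    | succ n ih =>
      intro hn
      push_cast at hn ⊢
      rw [← h (-(n + 1)) (by omega) (by omega), ← ih (by omega)]
      congr 1; ring
  intro k h1 h2
  rcases le_total 0 k with hk | hk
  · lift k to ℕ using hk
    exact pos k h2
  · obtain ⟨n, rfl⟩ : ∃ n : ℕ, k = -n := ⟨(-k).toNat, by omega⟩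
    exact neg n (by omega)

theorem const_box (g : V → ℤ) (v : V) (L : ℤ)
    (h1 : ∀ x y : ℤ, |x| ≤ L → |y| ≤ L → g (v.1 + x + 1, v.2 + y) = g (v.1 + x, v.2 + y))
    (h2 : ∀ x y : ℤ, |x| ≤ L → |y| ≤ L → g (v.1 + x, v.2 + y + 1) = g (v.1 + x, v.2 + y)) :
    ∀ x y : ℤ, |x| ≤ L → |y| ≤ L → g (v.1 + x, v.2 + y) = g v := by
  intro x y hx hy
  have hL : 0 ≤ L := (abs_nonneg x).trans hx
  have hx' := abs_le.1 hx
  have hy' := abs_le.1 hy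
  have e1 := const_interval (fun k => g (v.1 + k, v.2 + y)) L (fun k k1 k2 => by
    have := h1 k y (by rw [abs_le]; omega) hy
    simpa [add_assoc] using this) x hx'.1 hx'.2
  have e2 := const_interval (fun k => g (v.1, v.2 + k)) L (fun k k1 k2 => by
    have := h2 0 k (by simpa using hL) (by rw [abs_le]; omega)
    simpa [add_assoc] using this) y hy'.1 hy'.2
  simp only [add_zero] at e1 e2
  rw [e1, e2]

/-- Rigidity: a bounded integer valued discrete harmonic function is affine on a smaller box. -/
theorem rigidity (H : V → ℤ) (v : V) (K L : ℤ) (hK : 1 ≤ K) (M : ℝ) (hMK : 16 * M < (K : ℝ) ^ 2)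
    (hb : ∀ x y : ℤ, |x| ≤ L + 2 * K → |y| ≤ L + 2 * K → |(H (v.1 + x, v.2 + y) : ℝ)| ≤ M)
    (hh : ∀ x y : ℤ, |x| < L + 2 * K → |y| < L + 2 * K → lapZ H (v.1 + x, v.2 + y) = 0) :
    ∃ a b : ℤ, ∀ x y : ℤ, |x| ≤ L → |y| ≤ L → H (v.1 + x, v.2 + y) = H v + a * x + b * y := by
  have hKr : (1 : ℝ) ≤ K := by exact_mod_cast hK
  set u : V → ℝ := fun w => (H w : ℝ) with hu
  have z : ∀ b c : Bool, ∀ x y : ℤ, |x| ≤ L → |y| ≤ L →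
      dif c (dif b u) (v.1 + x, v.2 + y) = 0 := by
    intro b c x y hx hy
    rw [abs_le] at hx hy
    have := dif2_est b c u (v.1 + x, v.2 + y) K hK M ?_ ?_
    · have h1 : |dif c (dif b u) (v.1 + x, v.2 + y)| < 1 := by
        refine lt_of_le_of_lt this ?_
        rw [div_lt_one (by positivity)]; exact hMK
      have : ∃ k : ℤ, dif c (dif b u) (v.1 + x, v.2 + y) = k := by
        cases b <;> cases c <;> simp only [dif, hu, if_true, if_false, Bool.false_eq_true] <;>
          norm_cast <;> exact ⟨_, rfl⟩
      obtain ⟨k, hk⟩ := this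
      rw [hk] at h1 ⊢
      have : |k| < 1 := by exact_mod_cast h1
      rw [Int.abs_lt_one_iff] at this
      simp [this]
    · intro x' y' hx' hy'
      rw [abs_le] at hx' hy'
      have := hb (x + x') (y + y') (by rw [abs_le]; omega) (by rw [abs_le]; omega)
      simpa [add_assoc] using this
    · intro x' y' hx' hy'
      rw [abs_lt] at hx' hy'
      have := hh (x + x') (y + y') (by rw [abs_lt]; omega) (by rw [abs_lt]; omega)
      simp only [← add_assoc] at this
      simp only [lapZ] at this
      simp only [lapR, hu]
      exact_mod_cast this
  have c1 := const_box (fun w => H (w.1 + 1, w.2) - H w) v L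
    (fun x y hx hy => by
      have := z true true x y hx hy
      simp only [dif, if_true, hu] at this
      have : (H (v.1 + x + 1 + 1, v.2 + y) - H (v.1 + x + 1, v.2 + y))
        - (H (v.1 + x + 1, v.2 + y) - H (v.1 + x, v.2 + y)) = 0 := by exact_mod_cast this
      simpa [sub_eq_zero] using this)
    (fun x y hx hy => by
      have := z true false x y hx hy
      simp only [dif, if_true, if_false, hu, Bool.false_eq_true] at this
      have : (H (v.1 + x + 1, v.2 + y + 1) - H (v.1 + x, v.2 + y + 1))
        - (H (v.1 + x + 1, v.2 + y) - H (v.1 + x, v.2 + y)) = 0 := by exact_mod_cast this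
      simpa [sub_eq_zero] using this)
  have c2 := const_box (fun w => H (w.1, w.2 + 1) - H w) v L
    (fun x y hx hy => by
      have := z false true x y hx hy
      simp only [dif, if_true, if_false, hu, Bool.false_eq_true] at this
      have : (H (v.1 + x + 1, v.2 + y + 1) - H (v.1 + x + 1, v.2 + y))
        - (H (v.1 + x, v.2 + y + 1) - H (v.1 + x, v.2 + y)) = 0 := by exact_mod_cast this
      simpa [sub_eq_zero] using this)
    (fun x y hx hy => by
      have := z false false x y hx hy
      simp only [dif, if_false, hu, Bool.false_eq_true] at this
      have : (H (v.1 + x, v.2 + y + 1 + 1) - H (v.1 + x, v.2 + y + 1))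
        - (H (v.1 + x, v.2 + y + 1) - H (v.1 + x, v.2 + y)) = 0 := by exact_mod_cast this
      simpa [sub_eq_zero] using this)
  simp only at c1 c2
  refine ⟨H (v.1 + 1, v.2) - H v, H (v.1, v.2 + 1) - H v, ?_⟩
  set a := H (v.1 + 1, v.2) - H v
  set b := H (v.1, v.2 + 1) - H v
  have c3 := const_box (fun w => H w - a * (w.1 - v.1) - b * (w.2 - v.2)) v L
    (fun x y hx hy => by
      have := c1 x y hx hy
      simp only
      linear_combination this)
    (fun x y hx hy => by
      have := c2 x y hx hy
      simp only
      linear_combination this)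
  intro x y hx hy
  have := c3 x y hx hy
  simp only [sub_self, mul_zero, sub_zero] at this
  linear_combination this

/-! ### Continuous calculus -/

abbrev Sm (ψ : ℝ × ℝ → ℝ) : Prop := ContDiff ℝ (⊤ : ℕ∞) ψ

noncomputable def pd (w : ℝ × ℝ) (ψ : ℝ × ℝ → ℝ) (x : ℝ × ℝ) : ℝ := fderiv ℝ ψ x w

noncomputable def lap (ψ : ℝ × ℝ → ℝ) (x : ℝ × ℝ) : ℝ :=
  pd (1, 0) (pd (1, 0) ψ) x + pd (0, 1) (pd (0, 1) ψ) x

theorem Sm.pd {ψ : ℝ × ℝ → ℝ} (h : Sm ψ) (w : ℝ × ℝ) : Sm (pd w ψ) := by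
  have : ContDiff ℝ (⊤ : ℕ∞) (fderiv ℝ ψ) := h.fderiv_right (by simp)
  exact this.clm_apply contDiff_const

theorem Sm.diff {ψ : ℝ × ℝ → ℝ} (h : Sm ψ) : Differentiable ℝ ψ := h.differentiable (by simp)

theorem Sm.lap {ψ : ℝ × ℝ → ℝ} (h : Sm ψ) : Sm (lap ψ) :=
  ((h.pd _).pd _).add ((h.pd _).pd _)

theorem pd_add {ψ χ : ℝ × ℝ → ℝ} (h : Sm ψ) (h' : Sm χ) (w) :
    pd w (fun x => ψ x + χ x) = fun x => pd w ψ x + pd w χ x := by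
  ext x
  simp only [pd]
  rw [fderiv_fun_add (h.diff x) (h'.diff x)]
  rfl

theorem lap_add {ψ χ : ℝ × ℝ → ℝ} (h : Sm ψ) (h' : Sm χ) (x) :
    lap (fun x => ψ x + χ x) x = lap ψ x + lap χ x := by
  simp only [lap, pd_add h h', pd_add (h.pd _) (h'.pd _)]
  ring

theorem pd_mul_const {ψ : ℝ × ℝ → ℝ} (h : Sm ψ) (c : ℝ) (w) :
    pd w (fun x => c * ψ x) = fun x => c * pd w ψ x := by
  ext x
  simp only [pd]
  rw [fderiv_const_mul (h.diff x)]
  rfl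

theorem lap_mul_const {ψ : ℝ × ℝ → ℝ} (h : Sm ψ) (c : ℝ) (x) :
    lap (fun x => c * ψ x) x = c * lap ψ x := by
  simp only [lap, pd_mul_const h, pd_mul_const (h.pd _)]
  ring

theorem pd_comp_smul (ψ : ℝ × ℝ → ℝ) (c : ℝ) (w) :
    pd w (fun x => ψ (c • x)) = fun x => c * pd w ψ (c • x) := by
  ext x
  simp only [pd]
  rw [fderiv_comp_smul]
  rfl

theorem Sm.comp_smul {ψ : ℝ × ℝ → ℝ} (h : Sm ψ) (c : ℝ) : Sm (fun x => ψ (c • x)) :=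
  h.comp (contDiff_id.const_smul c)

theorem lap_comp_smul {ψ : ℝ × ℝ → ℝ} (h : Sm ψ) (c : ℝ) (x) :
    lap (fun x => ψ (c • x)) x = c ^ 2 * lap ψ (c • x) := by
  simp only [lap, pd_comp_smul]
  rw [pd_mul_const ((h.pd _).comp_smul c), pd_mul_const ((h.pd _).comp_smul c)]
  simp only [pd_comp_smul]
  ring

theorem pd_comp_add (ψ : ℝ × ℝ → ℝ) (c : ℝ × ℝ) (w) :
    pd w (fun x => ψ (c + x)) = fun x => pd w ψ (c + x) := by
  ext x
  simp only [pd]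
  rw [fderiv_comp_add_left]

theorem lap_comp_add (ψ : ℝ × ℝ → ℝ) (c : ℝ × ℝ) (x) :
    lap (fun x => ψ (c + x)) x = lap ψ (c + x) := by
  simp only [lap, pd_comp_add]

theorem pd_congr {ψ χ : ℝ × ℝ → ℝ} {x : ℝ × ℝ} (h : ψ =ᶠ[𝓝 x] χ) (w) :
    pd w ψ =ᶠ[𝓝 x] pd w χ := by
  filter_upwards [h.fderiv (𝕜 := ℝ)] with y hy
  simp only [pd, hy]

theorem lap_congr {ψ χ : ℝ × ℝ → ℝ} {x : ℝ × ℝ} (h : ψ =ᶠ[𝓝 x] χ) : lap ψ x = lap χ x := by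
  simp only [lap]
  rw [(pd_congr (pd_congr h _) _).eq_of_nhds, (pd_congr (pd_congr h _) _).eq_of_nhds]

theorem tsupport_pd (ψ : ℝ × ℝ → ℝ) (w) : tsupport (pd w ψ) ⊆ tsupport ψ :=
  tsupport_fderiv_apply_subset ℝ w

theorem tsupport_lap (ψ : ℝ × ℝ → ℝ) : tsupport (lap ψ) ⊆ tsupport ψ := by
  have h1 := (tsupport_pd (pd (1, 0) ψ) (1, 0)).trans (tsupport_pd ψ (1, 0))
  have h2 := (tsupport_pd (pd (0, 1) ψ) (0, 1)).trans (tsupport_pd ψ (0, 1))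
  exact (tsupport_add _ _).trans (Set.union_subset h1 h2)

theorem lap_zero_of_notMem {ψ : ℝ × ℝ → ℝ} {x : ℝ × ℝ} (h : x ∉ tsupport ψ) : lap ψ x = 0 :=
  image_eq_zero_of_notMem_tsupport fun h' => h (tsupport_lap ψ h')

theorem HasCompactSupport.lap {ψ : ℝ × ℝ → ℝ} (h : HasCompactSupport ψ) :
    HasCompactSupport (lap ψ) :=
  HasCompactSupport.of_compactSpace_or h (tsupport_lap ψ)
where
  HasCompactSupport.of_compactSpace_or {ψ χ : ℝ × ℝ → ℝ} (h : HasCompactSupport ψ)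
      (h' : tsupport χ ⊆ tsupport ψ) : HasCompactSupport χ :=
    IsCompact.of_isClosed_subset h (isClosed_tsupport _) h'

theorem pd_hasDerivAt {ψ : ℝ × ℝ → ℝ} (h : Sm ψ) (x w : ℝ × ℝ) (t : ℝ) :
    HasDerivAt (fun t : ℝ => ψ (x + t • w)) (pd w ψ (x + t • w)) t := by
  have h1 : HasFDerivAt ψ (fderiv ℝ ψ (x + t • w)) (x + t • w) := (h.diff _).hasFDerivAt
  have h2 : HasDerivAt (fun t : ℝ => x + t • w) w t := by
    simpa using ((hasDerivAt_id t).smul_const w).const_add x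
  exact h1.comp_hasDerivAt t h2

theorem pd_eq_of_hasDerivAt {ψ : ℝ × ℝ → ℝ} {x w : ℝ × ℝ} {d : ℝ} (h : DifferentiableAt ℝ ψ x)
    (hd : HasDerivAt (fun t : ℝ => ψ (x + t • w)) d 0) : pd w ψ x = d := by
  have h1 : HasFDerivAt ψ (fderiv ℝ ψ x) (x + (0 : ℝ) • w) := by simpa using h.hasFDerivAt
  have h2 : HasDerivAt (fun t : ℝ => x + t • w) w 0 := by
    simpa using ((hasDerivAt_id (0 : ℝ)).smul_const w).const_add x
  exact (h1.comp_hasDerivAt 0 h2).unique hd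

/-- Second symmetric difference. -/
theorem second_diff {ψ : ℝ × ℝ → ℝ} (h : Sm ψ) (x w : ℝ × ℝ) {s : ℝ} (hs : 0 < s) :
    ∃ ξ ∈ Set.Ioo (-s) s,
      ψ (x + s • w) + ψ (x - s • w) - 2 * ψ x = s ^ 2 * pd w (pd w ψ) (x + ξ • w) := by
  set F : ℝ → ℝ := fun t => ψ (x + t • w) + ψ (x + (-t) • w) with hF
  have hder : ∀ t, HasDerivAt F (pd w ψ (x + t • w) - pd w ψ (x + (-t) • w)) t := by
    intro t
    have h1 := pd_hasDerivAt h x w t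
    have h2 := (pd_hasDerivAt h x w (-t)).scomp t (hasDerivAt_neg t)
    have := h1.add h2
    have e : pd w ψ (x + t • w) + (-1 : ℝ) • pd w ψ (x + (-t) • w) =
        pd w ψ (x + t • w) - pd w ψ (x + (-t) • w) := by rw [smul_eq_mul]; ring
    rw [← e]
    exact this
  obtain ⟨c, hc, hc'⟩ := exists_ratio_hasDerivAt_eq_ratio_slope F
    (fun t => pd w ψ (x + t • w) - pd w ψ (x + (-t) • w)) hs
    (fun t _ => (hder t).continuousAt.continuousWithinAt) (fun t _ => hder t)
    (fun t => t ^ 2) (fun t => 2 * t) (by fun_prop)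
    (fun t _ => by simpa using hasDerivAt_pow 2 t)
  obtain ⟨ξ, hξ, hξ'⟩ := exists_hasDerivAt_eq_slope (fun t : ℝ => pd w ψ (x + t • w))
    (fun t => pd w (pd w ψ) (x + t • w)) (show -c < c by linarith [hc.1])
    (fun t _ => (pd_hasDerivAt (h.pd w) x w t).continuousAt.continuousWithinAt)
    (fun t _ => pd_hasDerivAt (h.pd w) x w t)
  refine ⟨ξ, ⟨by linarith [hξ.1, hc.2], by linarith [hξ.2, hc.2]⟩, ?_⟩
  have hc0 : c ≠ 0 := hc.1.ne'
  simp only [hF] at hc'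
  rw [hξ']
  have e1 : c - -c = 2 * c := by ring
  rw [e1, mul_div_assoc', eq_div_iff (by simpa using hc0)]
  simp only [neg_smul, neg_zero, zero_smul, add_zero, sub_eq_add_neg] at hc' ⊢
  linarith

/-! ### The dipole test function -/

noncomputable def rho (x : ℝ × ℝ) : ℝ := x.1 ^ 2 + x.2 ^ 2

noncomputable def tau (r : ℝ) : ℝ := Real.smoothTransition (r - 1)

noncomputable def gtau (r : ℝ) : ℝ := tau r / r

noncomputable def dipQ (w : ℝ × ℝ) (x : ℝ × ℝ) : ℝ := (w.1 * x.1 + w.2 * x.2) * gtau (rho x)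

noncomputable def dipA (w : ℝ × ℝ) (x : ℝ × ℝ) : ℝ := 2 * dipQ w ((2 : ℝ) • x) - dipQ w x

theorem tau_zero {r : ℝ} (h : r ≤ 1) : tau r = 0 :=
  Real.smoothTransition.zero_of_nonpos (by linarith)

theorem tau_one {r : ℝ} (h : 2 ≤ r) : tau r = 1 :=
  Real.smoothTransition.one_of_one_le (by linarith)

theorem tau_smooth : ContDiff ℝ (⊤ : ℕ∞) tau :=
  Real.smoothTransition.contDiff.comp (contDiff_id.sub contDiff_const)

theorem gtau_smooth : ContDiff ℝ (⊤ : ℕ∞) gtau := by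
  rw [contDiff_iff_contDiffAt]
  intro r
  by_cases hr : r = 0
  · have : gtau =ᶠ[𝓝 r] fun _ => 0 := by
      filter_upwards [Iio_mem_nhds (show r < 1 by rw [hr]; norm_num)] with s hs
      simp [gtau, tau_zero (le_of_lt hs)]
    exact contDiffAt_const.congr_of_eventuallyEq this
  · exact tau_smooth.contDiffAt.div contDiffAt_id hr

theorem rho_smooth : Sm rho := (contDiff_fst.pow 2).add (contDiff_snd.pow 2)

theorem rho_smul (c : ℝ) (x : ℝ × ℝ) : rho (c • x) = c ^ 2 * rho x := by
  simp [rho]; ring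

theorem dipQ_smooth (w) : Sm (dipQ w) := by
  refine ContDiff.mul ?_ (gtau_smooth.comp rho_smooth)
  exact (contDiff_const.mul contDiff_fst).add (contDiff_const.mul contDiff_snd)

theorem dipA_smooth (w) : Sm (dipA w) :=
  (contDiff_const.mul ((dipQ_smooth w).comp_smul 2)).sub (dipQ_smooth w)

theorem dipQ_far {w x : ℝ × ℝ} (h : 2 ≤ rho x) :
    dipQ w x = (w.1 * x.1 + w.2 * x.2) / rho x := by
  simp [dipQ, gtau, tau_one h]; ring

theorem dipQ_near {w x : ℝ × ℝ} (h : rho x ≤ 1) : dipQ w x = 0 := by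
  simp [dipQ, gtau, tau_zero h]

theorem lap_dipQ_far {w x : ℝ × ℝ} (h : 2 < rho x) : lap (dipQ w) x = 0 := by
  have hop : IsOpen {y : ℝ × ℝ | 2 < rho y} := isOpen_lt continuous_const rho_smooth.continuous
  have key1 : ∀ y : ℝ × ℝ, 2 < rho y → pd (1, 0) (dipQ w) y =
      (w.1 * rho y - (w.1 * y.1 + w.2 * y.2) * (2 * y.1)) / rho y ^ 2 := by
    intro y hy
    apply pd_eq_of_hasDerivAt ((dipQ_smooth w).diff y)
    have h0 : (fun t : ℝ => dipQ w (y + t • ((1 : ℝ), (0 : ℝ)))) =ᶠ[𝓝 0]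
        fun t => (w.1 * (y.1 + t) + w.2 * y.2) / ((y.1 + t) ^ 2 + y.2 ^ 2) := by
      have hc : Continuous (fun t : ℝ => y + t • ((1 : ℝ), (0 : ℝ))) := by fun_prop
      filter_upwards [(hop.preimage hc).mem_nhds (x := 0)
        (by simpa [rho] using hy)] with t ht
      rw [dipQ_far (le_of_lt ht)]
      simp [rho]
    refine HasDerivAt.congr_of_eventuallyEq ?_ h0
    have h1 : HasDerivAt (fun t : ℝ => y.1 + t) 1 0 := (hasDerivAt_id (0:ℝ)).const_add y.1
    have h2 := ((h1.const_mul w.1).add_const (w.2 * y.2)).fun_div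
      ((h1.fun_pow 2).add_const (y.2 ^ 2)) (by simp only [rho] at hy; simp; linarith)
    refine h2.congr_deriv ?_
    simp [rho]
  have key2 : ∀ y : ℝ × ℝ, 2 < rho y → pd (0, 1) (dipQ w) y =
      (w.2 * rho y - (w.1 * y.1 + w.2 * y.2) * (2 * y.2)) / rho y ^ 2 := by
    intro y hy
    apply pd_eq_of_hasDerivAt ((dipQ_smooth w).diff y)
    have h0 : (fun t : ℝ => dipQ w (y + t • ((0 : ℝ), (1 : ℝ)))) =ᶠ[𝓝 0]
        fun t => (w.1 * y.1 + w.2 * (y.2 + t)) / (y.1 ^ 2 + (y.2 + t) ^ 2) := by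
      have hc : Continuous (fun t : ℝ => y + t • ((0 : ℝ), (1 : ℝ))) := by fun_prop
      filter_upwards [(hop.preimage hc).mem_nhds (x := 0)
        (by simpa [rho] using hy)] with t ht
      rw [dipQ_far (le_of_lt ht)]
      simp [rho]
    refine HasDerivAt.congr_of_eventuallyEq ?_ h0
    have h1 : HasDerivAt (fun t : ℝ => y.2 + t) 1 0 := (hasDerivAt_id (0:ℝ)).const_add y.2
    have h2 := ((h1.const_mul w.2).const_add (w.1 * y.1)).fun_div
      ((h1.fun_pow 2).const_add (y.1 ^ 2)) (by simp only [rho] at hy; simp; linarith)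
    refine h2.congr_deriv ?_
    simp [rho]
  have key11 : pd (1, 0) (pd (1, 0) (dipQ w)) x =
      ((w.1 * (2 * x.1) - (w.1 * (2 * x.1) + (w.1 * x.1 + w.2 * x.2) * 2)) * rho x ^ 2 -
        (w.1 * rho x - (w.1 * x.1 + w.2 * x.2) * (2 * x.1)) * (2 * rho x * (2 * x.1)))
          / (rho x ^ 2) ^ 2 := by
    apply pd_eq_of_hasDerivAt (((dipQ_smooth w).pd _).diff x)
    have h0 : (fun t : ℝ => pd (1, 0) (dipQ w) (x + t • ((1 : ℝ), (0 : ℝ)))) =ᶠ[𝓝 0]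
        fun t => (w.1 * ((x.1 + t) ^ 2 + x.2 ^ 2) -
          (w.1 * (x.1 + t) + w.2 * x.2) * (2 * (x.1 + t))) / ((x.1 + t) ^ 2 + x.2 ^ 2) ^ 2 := by
      have hc : Continuous (fun t : ℝ => x + t • ((1 : ℝ), (0 : ℝ))) := by fun_prop
      filter_upwards [(hop.preimage hc).mem_nhds (x := 0)
        (by simpa [rho] using h)] with t ht
      rw [key1 _ ht]
      simp [rho]
    refine HasDerivAt.congr_of_eventuallyEq ?_ h0
    have h1 : HasDerivAt (fun t : ℝ => x.1 + t) 1 0 := (hasDerivAt_id (0:ℝ)).const_add x.1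
    have hr := (h1.fun_pow 2).add_const (x.2 ^ 2)
    have h2 := ((hr.const_mul w.1).fun_sub
      (((h1.const_mul w.1).add_const (w.2 * x.2)).fun_mul (h1.const_mul 2))).fun_div
      (hr.fun_pow 2) (by simp only [rho] at h; simp; nlinarith)
    refine h2.congr_deriv ?_
    simp [rho]
  have key22 : pd (0, 1) (pd (0, 1) (dipQ w)) x =
      ((w.2 * (2 * x.2) - (w.2 * (2 * x.2) + (w.1 * x.1 + w.2 * x.2) * 2)) * rho x ^ 2 -
        (w.2 * rho x - (w.1 * x.1 + w.2 * x.2) * (2 * x.2)) * (2 * rho x * (2 * x.2)))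
          / (rho x ^ 2) ^ 2 := by
    apply pd_eq_of_hasDerivAt (((dipQ_smooth w).pd _).diff x)
    have h0 : (fun t : ℝ => pd (0, 1) (dipQ w) (x + t • ((0 : ℝ), (1 : ℝ)))) =ᶠ[𝓝 0]
        fun t => (w.2 * (x.1 ^ 2 + (x.2 + t) ^ 2) -
          (w.1 * x.1 + w.2 * (x.2 + t)) * (2 * (x.2 + t))) / (x.1 ^ 2 + (x.2 + t) ^ 2) ^ 2 := by
      have hc : Continuous (fun t : ℝ => x + t • ((0 : ℝ), (1 : ℝ))) := by fun_prop
      filter_upwards [(hop.preimage hc).mem_nhds (x := 0)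
        (by simpa [rho] using h)] with t ht
      rw [key2 _ ht]
      simp [rho]
    refine HasDerivAt.congr_of_eventuallyEq ?_ h0
    have h1 : HasDerivAt (fun t : ℝ => x.2 + t) 1 0 := (hasDerivAt_id (0:ℝ)).const_add x.2
    have hr := (h1.fun_pow 2).const_add (x.1 ^ 2)
    have h2 := ((hr.const_mul w.2).fun_sub
      (((h1.const_mul w.2).const_add (w.1 * x.1)).fun_mul (h1.const_mul 2))).fun_div
      (hr.fun_pow 2) (by simp only [rho] at h; simp; nlinarith)
    refine h2.congr_deriv ?_
    simp [rho]
  rw [lap, key11, key22, ← add_div, div_eq_zero_iff]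
  left
  simp only [rho]
  ring

/-! ### The balance lemma -/

noncomputable def sQ (w : ℝ × ℝ) (k : ℝ) (x : ℝ × ℝ) : ℝ := k * dipQ w (k • x)

theorem sQ_smooth (w k) : Sm (sQ w k) := contDiff_const.mul ((dipQ_smooth w).comp_smul k)

theorem lap_sQ (w k x) : lap (sQ w k) x = k ^ 3 * lap (dipQ w) (k • x) := by
  have := lap_mul_const ((dipQ_smooth w).comp_smul k) k x
  rw [lap_comp_smul (dipQ_smooth w)] at this
  rw [show sQ w k = fun x => k * dipQ w (k • x) from rfl, this]; ring

theorem norm_sq_le_rho (x : ℝ × ℝ) : ‖x‖ ^ 2 ≤ rho x := by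
  rw [Prod.norm_def, rho]
  rcases max_cases ‖x.1‖ ‖x.2‖ with h | h <;> rw [h.1] <;> simp [sq_nonneg]

theorem rho_le_norm_sq (x : ℝ × ℝ) : rho x ≤ 2 * ‖x‖ ^ 2 := by
  have h1 := norm_fst_le x
  have h2 := norm_snd_le x
  have h3 := sq_le_sq' (by linarith [norm_nonneg x.1, norm_nonneg x]) h1
  have h4 := sq_le_sq' (by linarith [norm_nonneg x.2, norm_nonneg x]) h2
  simp only [Real.norm_eq_abs, sq_abs] at h3 h4
  simp only [rho]; linarith

theorem rho_pos {x : ℝ × ℝ} (h : x ≠ 0) : 0 < rho x :=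
  lt_of_lt_of_le (by positivity) (norm_sq_le_rho x)

noncomputable def fker (u : ℝ) : ℝ := u * (4 * gtau (4 * u ^ 2) - gtau (u ^ 2))

theorem fker_cont : Continuous fker := by
  have := gtau_smooth.continuous
  unfold fker
  fun_prop

theorem fker_eq {u : ℝ} (h : 0 < u) : fker u = (tau (4 * u ^ 2) - tau (u ^ 2)) / u := by
  unfold fker gtau
  field_simp

theorem fker_int : Integrable fker := by
  refine fker_cont.integrable_of_hasCompactSupport ?_
  refine HasCompactSupport.intro (K := Set.Icc (-2) 2) isCompact_Icc fun u hu => ?_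
  have h : 4 ≤ u ^ 2 := by
    by_contra hh
    push Not at hh
    exact hu ⟨by nlinarith, by nlinarith⟩
  have hu0 : u ≠ 0 := by rintro rfl; norm_num at h
  unfold fker gtau
  rw [tau_one (by linarith), tau_one (by linarith)]
  field_simp
  ring

theorem kap_pos : 0 < ∫ u in Set.Ioi (0 : ℝ), fker u := by
  rw [setIntegral_pos_iff_support_of_nonneg_ae _ fker_int.integrableOn]
  · refine IsOpen.measure_pos _ ((fker_cont.isOpen_support).inter isOpen_Ioi) ⟨1, ?_, ?_⟩
    · rw [Function.mem_support, fker_eq one_pos, tau_one (by norm_num), tau_zero (by norm_num)]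
      norm_num
    · simp
  · filter_upwards [ae_restrict_mem measurableSet_Ioi] with u hu
    simp only [Pi.zero_apply]
    rw [fker_eq hu]
    refine div_nonneg (sub_nonneg.2 ?_) (le_of_lt hu)
    exact Real.smoothTransition.monotone (by nlinarith [sq_nonneg u])

theorem dip_ray (w l : ℝ × ℝ) (hl : l ≠ 0) {k : ℝ} (hk : 0 < k) :
    rho l * ∫ t in Set.Ioi (0 : ℝ), (sQ w (2 * k) (t • l) - sQ w k (t • l)) =
      (w.1 * l.1 + w.2 * l.2) * ∫ u in Set.Ioi (0 : ℝ), fker u := by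
  have hr := rho_pos hl
  set r := Real.sqrt (rho l) with hrd
  have hr0 : 0 < r := Real.sqrt_pos.2 hr
  have hr2 : r ^ 2 = rho l := Real.sq_sqrt hr.le
  have : ∀ t : ℝ, sQ w (2 * k) (t • l) - sQ w k (t • l) =
      (w.1 * l.1 + w.2 * l.2) * k / r * fker ((k * r) * t) := by
    intro t
    simp only [sQ, dipQ, rho_smul, fker]
    rw [show (2 * k) ^ 2 * (t ^ 2 * rho l) = 4 * (k * r * t) ^ 2 by rw [← hr2]; ring,
      show k ^ 2 * (t ^ 2 * rho l) = (k * r * t) ^ 2 by rw [← hr2]; ring]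
    simp
    field_simp
    norm_num
  simp_rw [this]
  rw [integral_const_mul, integral_comp_mul_left_Ioi _ _ (by positivity), mul_zero, ← hr2,
    smul_eq_mul]
  field_simp

theorem balance {ι : Type*} (s : Finset ι) (wt : ι → ℝ) (l : ι → ℝ × ℝ) (hl : ∀ i ∈ s, l i ≠ 0)
    (b : ℝ × ℝ → ℝ) (hb : AEStronglyMeasurable b) {R C : ℝ} (hR : 0 < R)
    (hbC : ∀ z, ‖z‖ < R → |b z| ≤ C * ‖z‖)
    (H : ∀ ψ : ℝ × ℝ → ℝ, Sm ψ → HasCompactSupport ψ → tsupport ψ ⊆ Metric.ball 0 R →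
      0 ∉ tsupport ψ → ∫ x, b x * lap ψ x =
        -∑ i ∈ s, wt i * rho (l i) * ∫ t in Set.Ioi (0 : ℝ), ψ (t • l i)) :
    ∑ i ∈ s, wt i • l i = 0 := by
  -- the scalar version
  have main : ∀ w : ℝ × ℝ, ∑ i ∈ s, wt i * (w.1 * (l i).1 + w.2 * (l i).2) = 0 := by
    intro w
    set κ := ∫ u in Set.Ioi (0 : ℝ), fker u with hκ
    set k : ℕ → ℝ := fun j => 2 / R * 2 ^ j with hk
    have hkpos : ∀ j, 0 < k j := fun j => by simp only [hk]; positivity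
    have hkge : ∀ j, 2 / R ≤ k j := fun j => by
      simp only [hk]
      exact le_mul_of_one_le_right (by positivity) (one_le_pow₀ (by norm_num))
    have hks : ∀ j, k (j + 1) = 2 * k j := fun j => by simp only [hk]; ring
    have hfar : ∀ j x, R ≤ ‖x‖ → 2 < rho (k j • x) := by
      intro j x hx
      rw [rho_smul]
      have h1 := norm_sq_le_rho x
      have h2 : 2 ≤ k j * ‖x‖ := by
        calc 2 = 2 / R * R := by field_simp
          _ ≤ _ := by gcongr; exact hkge j
      nlinarith [hkpos j, sq_nonneg (k j)]
    set g : ℝ × ℝ → ℝ := fun y => ‖y‖ * |lap (dipQ w) y| with hg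
    have hgc : Continuous g := continuous_norm.mul (dipQ_smooth w).lap.continuous.abs
    have hgs : HasCompactSupport g := by
      refine HasCompactSupport.intro (isCompact_closedBall (0 : ℝ × ℝ) 2) fun x hx => ?_
      have hx : 2 < ‖x‖ := by simpa using hx
      have : 2 < rho x := by nlinarith [norm_sq_le_rho x]
      simp [hg, lap_dipQ_far this]
    have hgi : Integrable g := hgc.integrable_of_hasCompactSupport hgs
    have hgk : ∀ j, Integrable (fun x => C * (k j ^ 2 * g (k j • x))) := fun j =>
      ((hgi.comp_smul (hkpos j).ne').const_mul _).const_mul _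
    have hgke : ∀ j, ∫ x, C * (k j ^ 2 * g (k j • x)) = C * ∫ x, g x := by
      intro j
      rw [integral_const_mul, integral_const_mul, Measure.integral_comp_smul]
      have : Module.finrank ℝ (ℝ × ℝ) = 2 := by simp
      rw [this, abs_of_nonneg (by have := hkpos j; positivity), smul_eq_mul]
      have := (hkpos j).ne'
      field_simp
    have hbd : ∀ j x, ‖b x * lap (sQ w (k j)) x‖ ≤ C * (k j ^ 2 * g (k j • x)) := by
      intro j x
      have hkj := hkpos j
      rw [lap_sQ, norm_mul, Real.norm_eq_abs]
      rcases lt_or_ge ‖x‖ R with hx | hx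
      · simp only [hg, norm_smul, norm_mul, Real.norm_eq_abs, abs_pow, abs_of_pos hkj]
        calc |b x| * (k j ^ 3 * |lap (dipQ w) (k j • x)|) ≤
            (C * ‖x‖) * (k j ^ 3 * |lap (dipQ w) (k j • x)|) := by gcongr; exact hbC x hx
          _ = _ := by ring
      · simp [hg, lap_dipQ_far (hfar j x hx)]
    have hinteg : ∀ j, Integrable (fun x => b x * lap (sQ w (k j)) x) := fun j =>
      (hgk j).mono' (hb.mul (sQ_smooth w _).lap.continuous.aestronglyMeasurable)
        (Eventually.of_forall (hbd j))
    have hB : ∀ j, |∫ x, b x * lap (sQ w (k j)) x| ≤ C * ∫ x, g x := by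
      intro j
      rw [← hgke j]
      exact norm_integral_le_of_norm_le (hgk j) (Eventually.of_forall (hbd j))
    have hstep : ∀ j, (∫ x, b x * lap (sQ w (k (j + 1))) x) - ∫ x, b x * lap (sQ w (k j)) x =
        -(κ * ∑ i ∈ s, wt i * (w.1 * (l i).1 + w.2 * (l i).2)) := by
      intro j
      rw [← integral_sub (hinteg _) (hinteg _)]
      have hkj := hkpos j
      set ψ : ℝ × ℝ → ℝ := fun x => sQ w (k (j + 1)) x + (-1) * sQ w (k j) x with hψ
      have hψs : Sm ψ := (sQ_smooth _ _).add (contDiff_const.mul (sQ_smooth _ _))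
      have hlap : ∀ x, lap ψ x = lap (sQ w (k (j + 1))) x - lap (sQ w (k j)) x := by
        intro x
        rw [hψ, lap_add (sQ_smooth _ _) (contDiff_const.mul (sQ_smooth _ _)),
          lap_mul_const (sQ_smooth _ _)]
        ring
      set K : Set (ℝ × ℝ) := {x | 1 ≤ rho (k (j + 1) • x)} ∩ {x | rho (k j • x) ≤ 2} with hK
      have hKc : IsClosed K := by
        have := rho_smooth.continuous
        exact (isClosed_le continuous_const (by fun_prop)).inter
          (isClosed_le (by fun_prop) continuous_const)
      have hsub : tsupport ψ ⊆ K := by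
        refine closure_minimal (fun x hx => ?_) hKc
        by_contra hxK
        apply hx
        simp only [hK, Set.mem_inter_iff, Set.mem_ofPred_eq, not_and_or, not_le] at hxK
        simp only [hψ, sQ]
        rcases hxK with h | h
        · have h' : rho (k j • x) ≤ 1 := by
            rw [rho_smul] at h ⊢
            rw [hks] at h
            have : 0 ≤ k j ^ 2 * rho x := mul_nonneg (sq_nonneg _) (by simp only [rho]; positivity)
            nlinarith
          rw [dipQ_near h.le, dipQ_near h']; simp
        · have h' : 2 ≤ rho (k (j + 1) • x) := by
            rw [rho_smul] at h ⊢
            rw [hks]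
            nlinarith
          rw [dipQ_far h.le, dipQ_far h', rho_smul, rho_smul]
          simp only [Prod.smul_fst, Prod.smul_snd, smul_eq_mul]
          have hx0 : rho x ≠ 0 := by rintro h0; rw [rho_smul, h0] at h; norm_num at h
          have := (hkpos j).ne'
          have := (hkpos (j + 1)).ne'
          field_simp
          ring
      have hball : K ⊆ Metric.ball 0 R := by
        intro x hx
        by_contra hh
        have : R ≤ ‖x‖ := by simpa using hh
        exact absurd hx.2 (not_le.2 (hfar j x this))
      have h0 : (0 : ℝ × ℝ) ∉ K := by
        rintro ⟨h, -⟩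
        simp [rho] at h
        linarith
      have hcs : HasCompactSupport ψ := by
        refine IsCompact.of_isClosed_subset (isCompact_closedBall (0 : ℝ × ℝ) R)
          (isClosed_tsupport _) ((hsub.trans hball).trans Metric.ball_subset_closedBall)
      have := H ψ hψs hcs (hsub.trans hball) (fun h => h0 (hsub h))
      simp_rw [← mul_sub, ← hlap]
      rw [this, Finset.mul_sum]
      congr 1
      refine Finset.sum_congr rfl fun i hi => ?_
      have := dip_ray w (l i) (hl i hi) (hkpos j)
      rw [mul_assoc]
      simp only [hψ, hks, neg_mul, one_mul, ← sub_eq_add_neg]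
      rw [this]
      ring
    have hsum : ∀ n : ℕ, (∫ x, b x * lap (sQ w (k n)) x) - ∫ x, b x * lap (sQ w (k 0)) x =
        -(n * (κ * ∑ i ∈ s, wt i * (w.1 * (l i).1 + w.2 * (l i).2))) := by
      intro n
      induction n with
      | zero => simp
      | succ n ih => push_cast; linarith [hstep n]
    by_contra hne
    have hpos : 0 < |κ * ∑ i ∈ s, wt i * (w.1 * (l i).1 + w.2 * (l i).2)| :=
      abs_pos.2 (mul_ne_zero kap_pos.ne' hne)
    obtain ⟨n, hn⟩ := exists_nat_gt (2 * (C * ∫ x, g x) /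
      |κ * ∑ i ∈ s, wt i * (w.1 * (l i).1 + w.2 * (l i).2)|)
    rw [div_lt_iff₀ hpos] at hn
    have h1 := congrArg abs (hsum n)
    rw [abs_neg, abs_mul, Nat.abs_cast] at h1
    have h2 := abs_sub (∫ x, b x * lap (sQ w (k n)) x) (∫ x, b x * lap (sQ w (k 0)) x)
    linarith [hB n, hB 0]
  have e1 := main (1, 0)
  have e2 := main (0, 1)
  ext
  · rw [Prod.fst_sum]; simpa using e1
  · rw [Prod.snd_sum]; simpa using e2

/-! ### The half-plane formula -/

theorem half_line {g g' g'' : ℝ → ℝ} (hg : ∀ t, HasDerivAt g (g' t) t)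
    (hg' : ∀ t, HasDerivAt g' (g'' t) t) (hc : Continuous g'') {K : ℝ}
    (h0 : ∀ t, K ≤ |t| → g t = 0) (h1 : ∀ t, K ≤ |t| → g' t = 0) (h2 : ∀ t, K ≤ |t| → g'' t = 0)
    (a c : ℝ) :
    (∫ t, max 0 (a * t + c) * g'' t) = |a| * g (-c / a) := by
  set F : ℝ → ℝ := fun t => (a * t + c) * g' t - a * g t with hF
  have hd : ∀ t, HasDerivAt F ((a * t + c) * g'' t) t := by
    intro t
    have e1 : HasDerivAt (fun t : ℝ => a * t + c) a t := by
      simpa using ((hasDerivAt_id t).const_mul a).add_const c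
    have := (e1.fun_mul (hg' t)).fun_sub ((hg t).const_mul a)
    refine this.congr_deriv ?_
    ring
  have hi : Integrable (fun t => (a * t + c) * g'' t) := by
    refine Continuous.integrable_of_hasCompactSupport (by fun_prop) ?_
    refine HasCompactSupport.intro (K := Set.Icc (-K) K) isCompact_Icc fun u hu => ?_
    rw [h2 u, mul_zero]
    by_contra hh
    push Not at hh
    exact hu ⟨(abs_lt.1 hh).1.le, (abs_lt.1 hh).2.le⟩
  have hz : ∀ t, K ≤ |t| → F t = 0 := fun t ht => by simp [hF, h0 t ht, h1 t ht]
  have htop : Tendsto F atTop (𝓝 0) := by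
    refine tendsto_const_nhds.congr' ?_
    filter_upwards [eventually_ge_atTop K] with t ht
    exact (hz t (ht.trans (le_abs_self t))).symm
  have hbot : Tendsto F atBot (𝓝 0) := by
    refine tendsto_const_nhds.congr' ?_
    filter_upwards [eventually_le_atBot (-K)] with t ht
    exact (hz t (by linarith [neg_le_abs t])).symm
  rcases lt_trichotomy a 0 with ha | ha | ha
  · have e : (fun t => max 0 (a * t + c) * g'' t) =
        (Set.Iic (-c / a)).indicator (fun t => (a * t + c) * g'' t) := by
      ext t
      by_cases ht : t ≤ -c / a
      · rw [Set.indicator_of_mem (by exact ht), max_eq_right]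
        rw [le_div_iff_of_neg ha] at ht; linarith
      · rw [Set.indicator_of_notMem (by exact ht), max_eq_left, zero_mul]
        rw [not_le, div_lt_iff_of_neg ha] at ht; linarith
    rw [e, integral_indicator measurableSet_Iic,
      integral_Iic_of_hasDerivAt_of_tendsto' (fun t _ => hd t) hi.integrableOn hbot]
    simp only [hF]
    have : a * (-c / a) + c = 0 := by field_simp [ha.ne]; ring
    rw [this, abs_of_neg ha]; ring
  · subst ha
    simp only [zero_mul, zero_add, abs_zero]
    simp only [zero_mul, zero_add] at hd hi
    rw [integral_const_mul]
    have hi' : Integrable g'' := by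
      refine Continuous.integrable_of_hasCompactSupport (by fun_prop) ?_
      refine HasCompactSupport.intro (K := Set.Icc (-K) K) isCompact_Icc fun u hu => ?_
      rw [h2 u]
      by_contra hh
      push Not at hh
      exact hu ⟨(abs_lt.1 hh).1.le, (abs_lt.1 hh).2.le⟩
    rw [integral_of_hasDerivAt_of_tendsto (m := 0) (n := 0) hg' hi']
    · simp
    · refine tendsto_const_nhds.congr' ?_
      filter_upwards [eventually_le_atBot (-K)] with t ht
      exact (h1 t (by linarith [neg_le_abs t])).symm
    · refine tendsto_const_nhds.congr' ?_
      filter_upwards [eventually_ge_atTop K] with t ht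
      exact (h1 t (ht.trans (le_abs_self t))).symm
  · have e : (fun t => max 0 (a * t + c) * g'' t) =
        (Set.Ioi (-c / a)).indicator (fun t => (a * t + c) * g'' t) := by
      ext t
      by_cases ht : -c / a < t
      · rw [Set.indicator_of_mem (by exact ht), max_eq_right]
        rw [div_lt_iff₀ ha] at ht; linarith
      · rw [Set.indicator_of_notMem (by exact ht), max_eq_left, zero_mul]
        rw [not_lt, le_div_iff₀ ha] at ht; linarith
    rw [e, integral_indicator measurableSet_Ioi,
      integral_Ioi_of_hasDerivAt_of_tendsto' (fun t _ => hd t) hi.integrableOn htop]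
    simp only [hF]
    have : a * (-c / a) + c = 0 := by field_simp [ha.ne]; ring
    rw [this, abs_of_pos ha]; ring

def crs (u v : ℝ × ℝ) : ℝ := u.1 * v.2 - u.2 * v.1

theorem half_plane0 {ψ : ℝ × ℝ → ℝ} (h : Sm ψ) (hs : HasCompactSupport ψ) (l : ℝ × ℝ) :
    ∫ x, max 0 (crs l x) * lap ψ x = rho l * ∫ s : ℝ, ψ (s • l) := by
  have hcrs : Continuous (fun x => crs l x) := by unfold crs; fun_prop
  obtain ⟨K, hK⟩ : ∃ K : ℝ, ∀ x, x ∈ tsupport ψ → ‖x‖ < K := by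
    obtain ⟨K, hK⟩ := hs.isBounded.subset_ball 0
    exact ⟨K, fun x hx => by simpa using hK hx⟩
  have hz : ∀ x : ℝ × ℝ, K ≤ ‖x‖ → x ∉ tsupport ψ := fun x hx hx' =>
    absurd (hK x hx') (not_lt.2 hx)
  have hI : ∀ w, Integrable (fun x => max 0 (crs l x) * pd w (pd w ψ) x) := by
    intro w
    refine Continuous.integrable_of_hasCompactSupport ?_ ?_
    · exact (continuous_const.max hcrs).mul ((h.pd w).pd w).continuous
    · exact HasCompactSupport.mul_left (IsCompact.of_isClosed_subset hs (isClosed_tsupport _)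
        ((tsupport_pd _ w).trans (tsupport_pd ψ w)))
  have e : ∀ x, max 0 (crs l x) * lap ψ x = max 0 (crs l x) * pd (1, 0) (pd (1, 0) ψ) x +
      max 0 (crs l x) * pd (0, 1) (pd (0, 1) ψ) x := fun x => by rw [lap]; ring
  have p0 : ∀ {w : ℝ × ℝ} {x}, x ∉ tsupport ψ → pd w ψ x = 0 := fun hx =>
    image_eq_zero_of_notMem_tsupport fun h' => hx (tsupport_pd ψ _ h')
  have p1 : ∀ {w : ℝ × ℝ} {x}, x ∉ tsupport ψ → pd w (pd w ψ) x = 0 := fun hx =>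
    image_eq_zero_of_notMem_tsupport fun h' => hx (tsupport_pd ψ _ (tsupport_pd _ _ h'))
  simp_rw [e]
  rw [integral_add (hI _) (hI _)]
  have hA : ∫ x, max 0 (crs l x) * pd (1, 0) (pd (1, 0) ψ) x = l.2 ^ 2 * ∫ s : ℝ, ψ (s • l) := by
    rw [Measure.volume_eq_prod, integral_prod_symm _ (by rw [← Measure.volume_eq_prod]; exact hI _)]
    have : ∀ y : ℝ, ∫ x, max 0 (crs l (x, y)) * pd (1, 0) (pd (1, 0) ψ) (x, y) =
        |l.2| * ψ (l.1 * y / l.2, y) := by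
      intro y
      have ex : ∀ t : ℝ, ((0 : ℝ), y) + t • ((1 : ℝ), (0 : ℝ)) = (t, y) := fun t => by simp
      have := half_line (g := fun t => ψ (t, y)) (g' := fun t => pd (1, 0) ψ (t, y))
        (g'' := fun t => pd (1, 0) (pd (1, 0) ψ) (t, y)) (K := K)
        (fun t => by simpa only [ex] using pd_hasDerivAt h (0, y) (1, 0) t)
        (fun t => by simpa only [ex] using pd_hasDerivAt (h.pd (1, 0)) (0, y) (1, 0) t)
        (((h.pd _).pd _).continuous.comp (by fun_prop))
        (fun t ht => image_eq_zero_of_notMem_tsupport (hz _ (ht.trans (norm_fst_le (t, y)))))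
        (fun t ht => p0 (hz _ (ht.trans (norm_fst_le (t, y)))))
        (fun t ht => p1 (hz _ (ht.trans (norm_fst_le (t, y))))) (-l.2) (l.1 * y)
      simp only [crs]
      rw [abs_neg, neg_div_neg_eq] at this
      rw [← this]
      congr 1; ext t; congr 2; ring
    simp_rw [this]
    rw [integral_const_mul]
    by_cases hl : l.2 = 0
    · simp [hl]
    have e2 := Measure.integral_comp_mul_left (fun y => ψ (l.1 * y / l.2, y)) l.2
    have e3 : ∀ s : ℝ, ψ (l.1 * (l.2 * s) / l.2, l.2 * s) = ψ (s • l) := by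
      intro s
      congr 1
      ext
      · simp; field_simp
      · simp; ring
    simp_rw [e3] at e2
    rw [e2, smul_eq_mul, abs_inv, ← sq_abs]
    have : |l.2| ≠ 0 := abs_ne_zero.2 hl
    field_simp
  have hB : ∫ x, max 0 (crs l x) * pd (0, 1) (pd (0, 1) ψ) x = l.1 ^ 2 * ∫ s : ℝ, ψ (s • l) := by
    rw [Measure.volume_eq_prod, integral_prod _ (by rw [← Measure.volume_eq_prod]; exact hI _)]
    have : ∀ x : ℝ, ∫ y, max 0 (crs l (x, y)) * pd (0, 1) (pd (0, 1) ψ) (x, y) =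
        |l.1| * ψ (x, l.2 * x / l.1) := by
      intro x
      have ex : ∀ t : ℝ, (x, (0 : ℝ)) + t • ((0 : ℝ), (1 : ℝ)) = (x, t) := fun t => by simp
      have := half_line (g := fun t => ψ (x, t)) (g' := fun t => pd (0, 1) ψ (x, t))
        (g'' := fun t => pd (0, 1) (pd (0, 1) ψ) (x, t)) (K := K)
        (fun t => by simpa only [ex] using pd_hasDerivAt h (x, 0) (0, 1) t)
        (fun t => by simpa only [ex] using pd_hasDerivAt (h.pd (0, 1)) (x, 0) (0, 1) t)
        (((h.pd _).pd _).continuous.comp (by fun_prop))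
        (fun t ht => image_eq_zero_of_notMem_tsupport (hz _ (ht.trans (norm_snd_le (x, t)))))
        (fun t ht => p0 (hz _ (ht.trans (norm_snd_le (x, t)))))
        (fun t ht => p1 (hz _ (ht.trans (norm_snd_le (x, t))))) l.1 (-(l.2 * x))
      simp only [crs]
      rw [neg_neg] at this
      rw [← this]
      rfl
    simp_rw [this]
    rw [integral_const_mul]
    by_cases hl : l.1 = 0
    · simp [hl]
    have e2 := Measure.integral_comp_mul_left (fun y => ψ (y, l.2 * y / l.1)) l.1
    have e3 : ∀ s : ℝ, ψ (l.1 * s, l.2 * (l.1 * s) / l.1) = ψ (s • l) := by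
      intro s
      congr 1
      ext
      · simp; ring
      · simp; field_simp
    simp_rw [e3] at e2
    rw [e2, smul_eq_mul, abs_inv, ← sq_abs]
    have : |l.1| ≠ 0 := abs_ne_zero.2 hl
    field_simp
  rw [hA, hB, rho]; ring

theorem Sm.comp_add {ψ : ℝ × ℝ → ℝ} (h : Sm ψ) (v : ℝ × ℝ) : Sm (fun x => ψ (v + x)) :=
  h.comp (contDiff_const.add contDiff_id)

theorem HasCompactSupport.comp_add {ψ : ℝ × ℝ → ℝ} (h : HasCompactSupport ψ) (v : ℝ × ℝ) :
    HasCompactSupport (fun x => ψ (v + x)) :=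
  h.comp_homeomorph (Homeomorph.addLeft v)

theorem half_plane {ψ : ℝ × ℝ → ℝ} (h : Sm ψ) (hs : HasCompactSupport ψ) (l v : ℝ × ℝ) :
    ∫ x, max 0 (crs l (x - v)) * lap ψ x = rho l * ∫ s : ℝ, ψ (v + s • l) := by
  rw [← integral_add_left_eq_self (fun x => max 0 (crs l (x - v)) * lap ψ x) v]
  have := half_plane0 (h.comp_add v) (hs.comp_add v) l
  rw [← this]
  congr 1
  ext x
  rw [lap_comp_add, add_sub_cancel_left]

/-! ### Localization -/

theorem localize (T : (ℝ × ℝ → ℝ) → ℝ)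
    (hadd : ∀ ψ χ, Sm ψ → HasCompactSupport ψ → Sm χ → HasCompactSupport χ →
      T (fun x => ψ x + χ x) = T ψ + T χ) (ψ : ℝ × ℝ → ℝ) (hψ : Sm ψ) (hs : HasCompactSupport ψ)
    (hloc : ∀ x ∈ tsupport ψ, ∃ ε > 0, ∀ χ, Sm χ → HasCompactSupport χ →
      tsupport χ ⊆ Metric.ball x ε → tsupport χ ⊆ tsupport ψ → T χ = 0) : T ψ = 0 := by
  choose! ε hε hT using hloc
  have hT0 : T (fun _ => 0) = 0 := by
    have := hadd (fun _ => 0) (fun _ => 0) contDiff_const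
      (HasCompactSupport.zero) contDiff_const HasCompactSupport.zero
    simp only [add_zero] at this
    linarith
  have key : ∀ t : Finset (ℝ × ℝ), (∀ x ∈ t, x ∈ tsupport ψ) → ∀ χ, Sm χ →
      tsupport χ ⊆ tsupport ψ → (∀ y, (∀ x ∈ t, y ∉ Metric.ball x (ε x / 4)) → χ y = 0) →
      T χ = 0 := by
    intro t
    induction t using Finset.induction_on with
    | empty =>
      intro _ χ _ _ h
      rw [show χ = fun _ => 0 from funext fun y => h y (by simp)]
      exact hT0
    | insert x t hx ih =>
      intro ht χ hχ hsub h
      have hx' := ht x (Finset.mem_insert_self _ _)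
      have hex := hε x hx'
      let f : ContDiffBump x := ⟨ε x / 4, ε x / 2, by linarith, by linarith⟩
      have hf : Sm (fun y => f y) := f.contDiff
      have hcs : ∀ {χ' : ℝ × ℝ → ℝ}, tsupport χ' ⊆ tsupport ψ → HasCompactSupport χ' := fun h' =>
        IsCompact.of_isClosed_subset hs (isClosed_tsupport _) h'
      have s1 : tsupport (fun y => f y * χ y) ⊆ tsupport χ :=
        tsupport_mul_subset_right (f := fun y => f y)
      have s2 : tsupport (fun y => (1 - f y) * χ y) ⊆ tsupport χ :=
        tsupport_mul_subset_right (f := fun y => 1 - f y)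
      have s3 : tsupport (fun y => f y * χ y) ⊆ Metric.ball x (ε x) := by
        refine (tsupport_mul_subset_left (f := fun y => f y)).trans ?_
        rw [f.tsupport_eq]
        exact Metric.closedBall_subset_ball (by change ε x / 2 < ε x; linarith)
      have e : χ = fun y => f y * χ y + (1 - f y) * χ y := by ext y; ring
      rw [e, hadd _ _ (hf.mul hχ) (hcs (s1.trans hsub)) ((contDiff_const.sub hf).mul hχ)
        (hcs (s2.trans hsub)), hT x hx' _ (hf.mul hχ) (hcs (s1.trans hsub)) s3 (s1.trans hsub),
        ih (fun y hy => ht y (Finset.mem_insert_of_mem hy)) _ ((contDiff_const.sub hf).mul hχ)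
          (s2.trans hsub), add_zero]
      intro y hy
      by_cases hyx : y ∈ Metric.ball x (ε x / 4)
      · rw [f.one_of_mem_closedBall (Metric.ball_subset_closedBall hyx)]; simp
      · rw [h y, mul_zero]
        intro x' hx'
        rcases Finset.mem_insert.1 hx' with rfl | hh
        · exact hyx
        · exact hy x' hh
  obtain ⟨t, ht, hcov⟩ := hs.elim_nhds_subcover (fun x => Metric.ball x (ε x / 4))
    (fun x hx => Metric.ball_mem_nhds x (by linarith [hε x hx]))
  refine key t ht ψ hψ subset_rfl fun y hy => ?_
  by_contra hne
  have : y ∈ tsupport ψ := subset_tsupport _ hne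
  have := hcov this
  simp only [Set.mem_iUnion] at this
  obtain ⟨x, hx, hx'⟩ := this
  exact hy x hx hx'

/-! ### Strong minimum principle -/

noncomputable def discF (z : ℝ × ℝ) (R k : ℝ) (x : ℝ × ℝ) : ℝ :=
  expNegInvGlue ((R ^ 2 - rho (x - z)) / k)

theorem discF_smooth (z R k) : Sm (discF z R k) := by
  refine expNegInvGlue.contDiff.comp ?_
  exact (contDiff_const.sub (rho_smooth.comp (contDiff_id.sub contDiff_const))).div_const _

noncomputable def eG1 (s : ℝ) : ℝ := s⁻¹ ^ 2 * expNegInvGlue s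
noncomputable def eG2 (s : ℝ) : ℝ := s⁻¹ ^ 2 * (s⁻¹ ^ 2 - 2 * s⁻¹) * expNegInvGlue s

theorem eG_deriv (s : ℝ) : HasDerivAt expNegInvGlue (eG1 s) s := by
  have := expNegInvGlue.hasDerivAt_polynomial_eval_inv_mul 1 s
  simpa [eG1] using this

theorem eG1_deriv (s : ℝ) : HasDerivAt eG1 (eG2 s) s := by
  have := expNegInvGlue.hasDerivAt_polynomial_eval_inv_mul (Polynomial.X ^ 2) s
  have h2 : HasDerivAt eG1 _ s :=
    this.congr_of_eventuallyEq (Eventually.of_forall fun t => by simp [eG1])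
  refine h2.congr_deriv ?_
  simp [eG2, one_add_one_eq_two]

theorem lap_discF (z : ℝ × ℝ) (R k : ℝ) (x : ℝ × ℝ) :
    lap (discF z R k) x = eG2 ((R ^ 2 - rho (x - z)) / k) * (4 * rho (x - z) / k ^ 2) -
      eG1 ((R ^ 2 - rho (x - z)) / k) * (4 / k) := by
  have hU1 : ∀ y : ℝ × ℝ, HasDerivAt (fun t : ℝ => (R ^ 2 - rho (y + t • ((1:ℝ), (0:ℝ)) - z)) / k)
      (-2 * (y.1 - z.1) / k) 0 := by
    intro y
    simp only [rho]
    have h1 : HasDerivAt (fun t : ℝ => y.1 + t - z.1) 1 0 :=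
      ((hasDerivAt_id (0:ℝ)).const_add y.1).sub_const z.1
    have := (((h1.fun_pow 2).add_const ((y.2 - z.2) ^ 2)).const_sub (R ^ 2)).div_const k
    have h3 := this.congr_of_eventuallyEq (Eventually.of_forall fun t => by simp :
      (fun t : ℝ => (R ^ 2 - ((y + t • ((1:ℝ), (0:ℝ)) - z).1 ^ 2 + (y + t • ((1:ℝ), (0:ℝ)) - z).2 ^ 2)) / k) =ᶠ[𝓝 0] _)
    exact h3.congr_deriv (by simp)
  have hU2 : ∀ y : ℝ × ℝ, HasDerivAt (fun t : ℝ => (R ^ 2 - rho (y + t • ((0:ℝ), (1:ℝ)) - z)) / k)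
      (-2 * (y.2 - z.2) / k) 0 := by
    intro y
    simp only [rho]
    have h1 : HasDerivAt (fun t : ℝ => y.2 + t - z.2) 1 0 :=
      ((hasDerivAt_id (0:ℝ)).const_add y.2).sub_const z.2
    have := (((h1.fun_pow 2).const_add ((y.1 - z.1) ^ 2)).const_sub (R ^ 2)).div_const k
    have h3 := this.congr_of_eventuallyEq (Eventually.of_forall fun t => by simp :
      (fun t : ℝ => (R ^ 2 - ((y + t • ((0:ℝ), (1:ℝ)) - z).1 ^ 2 + (y + t • ((0:ℝ), (1:ℝ)) - z).2 ^ 2)) / k) =ᶠ[𝓝 0] _)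
    exact h3.congr_deriv (by simp)
  have z1 : ∀ (y w : ℝ × ℝ), y + (0:ℝ) • w = y := fun y w => by simp
  have k1 : pd (1, 0) (discF z R k) = fun y =>
      eG1 ((R ^ 2 - rho (y - z)) / k) * (-2 * (y.1 - z.1) / k) := by
    ext y
    apply pd_eq_of_hasDerivAt ((discF_smooth z R k).diff y)
    have := HasDerivAt.comp (0:ℝ) (by simpa only [z1] using eG_deriv _) (hU1 y)
    exact this
  have k2 : pd (0, 1) (discF z R k) = fun y =>
      eG1 ((R ^ 2 - rho (y - z)) / k) * (-2 * (y.2 - z.2) / k) := by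
    ext y
    apply pd_eq_of_hasDerivAt ((discF_smooth z R k).diff y)
    have := HasDerivAt.comp (0:ℝ) (by simpa only [z1] using eG_deriv _) (hU2 y)
    exact this
  have k11 : pd (1, 0) (pd (1, 0) (discF z R k)) x =
      eG2 ((R ^ 2 - rho (x - z)) / k) * (-2 * (x.1 - z.1) / k) * (-2 * (x.1 - z.1) / k) +
      eG1 ((R ^ 2 - rho (x - z)) / k) * (-2 / k) := by
    apply pd_eq_of_hasDerivAt (((discF_smooth z R k).pd _).diff x)
    rw [k1]
    have h1 := HasDerivAt.comp (0:ℝ) (by simpa only [z1] using eG1_deriv _) (hU1 x)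
    have h2 : HasDerivAt (fun t : ℝ => -2 * ((x + t • ((1:ℝ), (0:ℝ))).1 - z.1) / k) (-2 / k) 0 := by
      have := ((((hasDerivAt_id (0:ℝ)).const_add x.1).sub_const z.1).const_mul (-2)).div_const k
      simpa using this
    have := h1.fun_mul h2
    simpa only [z1, Function.comp] using this
  have k22 : pd (0, 1) (pd (0, 1) (discF z R k)) x =
      eG2 ((R ^ 2 - rho (x - z)) / k) * (-2 * (x.2 - z.2) / k) * (-2 * (x.2 - z.2) / k) +
      eG1 ((R ^ 2 - rho (x - z)) / k) * (-2 / k) := by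
    apply pd_eq_of_hasDerivAt (((discF_smooth z R k).pd _).diff x)
    rw [k2]
    have h1 := HasDerivAt.comp (0:ℝ) (by simpa only [z1] using eG1_deriv _) (hU2 x)
    have h2 : HasDerivAt (fun t : ℝ => -2 * ((x + t • ((0:ℝ), (1:ℝ))).2 - z.2) / k) (-2 / k) 0 := by
      have := ((((hasDerivAt_id (0:ℝ)).const_add x.2).sub_const z.2).const_mul (-2)).div_const k
      simpa using this
    have := h1.fun_mul h2
    simpa only [z1, Function.comp] using this
  rw [lap, k11, k22]
  simp only [rho, Prod.fst_sub, Prod.snd_sub]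
  by_cases hk : k = 0
  · simp [hk]
  field_simp
  ring

theorem strong_min {h : ℝ × ℝ → ℝ} (hm : AEStronglyMeasurable h) {C : ℝ}
    (hb : ∀ x, |h x| ≤ C) (h0 : ∀ x, 0 ≤ h x) (z : ℝ × ℝ) {r R : ℝ} (hr : 0 < r)
    (hS : ∀ ψ : ℝ × ℝ → ℝ, Sm ψ → (∀ x, 0 ≤ ψ x) → tsupport ψ ⊆ {x | rho (x - z) ≤ R ^ 2} →
      ∫ x, h x * lap ψ x ≤ 0)
    (hz : ∀ x, rho (x - z) < r ^ 2 → h x = 0) :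
    ∀ᵐ x, rho (x - z) < R ^ 2 → h x = 0 := by
  obtain ⟨k, hk⟩ := exists_gt (2 * R ^ 2 + R ^ 4 / r ^ 2)
  have hk0 : 0 < k := lt_of_le_of_lt (by positivity) hk
  set ψ := discF z R k with hψ
  have hsm : Sm ψ := discF_smooth z R k
  have hrc : Continuous (fun x : ℝ × ℝ => rho (x - z)) :=
    rho_smooth.continuous.comp (by fun_prop)
  have hts : tsupport ψ ⊆ {x | rho (x - z) ≤ R ^ 2} := by
    refine closure_minimal (fun x hx => ?_) (isClosed_le hrc continuous_const)
    by_contra hh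
    apply hx
    apply expNegInvGlue.zero_of_nonpos
    have : R ^ 2 < rho (x - z) := not_le.1 hh
    exact div_nonpos_of_nonpos_of_nonneg (by linarith) hk0.le
  have hcpt : IsCompact {x : ℝ × ℝ | rho (x - z) ≤ R ^ 2} := by
    refine Metric.isCompact_of_isClosed_isBounded (isClosed_le hrc continuous_const) ?_
    refine (Metric.isBounded_closedBall (x := z) (r := |R|)).subset fun x hx => ?_
    rw [mem_closedBall_iff_norm]
    have h1 : rho (x - z) ≤ R ^ 2 := hx
    have h2 := norm_sq_le_rho (x - z)
    exact abs_le_of_sq_le_sq' (by rw [sq_abs]; linarith) (abs_nonneg R) |>.2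
  have hcs : HasCompactSupport ψ := IsCompact.of_isClosed_subset hcpt (isClosed_tsupport _) hts
  have hle := hS ψ hsm (fun x => expNegInvGlue.nonneg _) hts
  have hpos : ∀ x, r ^ 2 ≤ rho (x - z) → rho (x - z) < R ^ 2 → 0 < lap ψ x := by
    intro x h1 h2
    rw [hψ, lap_discF]
    set ρ := rho (x - z)
    have hu : 0 < (R ^ 2 - ρ) / k := div_pos (by linarith) hk0
    set U := (R ^ 2 - ρ) / k with hU
    have hUk : U * k = R ^ 2 - ρ := by rw [hU]; field_simp
    have hG : 0 < expNegInvGlue U := expNegInvGlue.pos_of_pos hu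
    have e : eG2 U * (4 * ρ / k ^ 2) - eG1 U * (4 / k) =
        expNegInvGlue U * (4 / (k ^ 3 * U ^ 4)) * (ρ * (k - 2 * (U * k)) - (U * k) ^ 2) := by
      unfold eG1 eG2; field_simp
    rw [e, hUk]
    refine mul_pos (by positivity) ?_
    have hk' : R ^ 4 < r ^ 2 * (k - 2 * R ^ 2) := by
      have : R ^ 4 / r ^ 2 < k - 2 * R ^ 2 := by linarith
      rw [div_lt_iff₀ (by positivity)] at this; linarith
    have hr2 : 0 < r ^ 2 := by positivity
    have hkR : 0 < k - 2 * R ^ 2 := by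
      have : 0 ≤ R ^ 4 / r ^ 2 := by positivity
      linarith
    nlinarith [mul_le_mul_of_nonneg_right h1 hkR.le]
  have hnn : ∀ x, 0 ≤ h x * lap ψ x := by
    intro x
    by_cases h1 : rho (x - z) < r ^ 2
    · rw [hz x h1, zero_mul]
    · by_cases h2 : rho (x - z) < R ^ 2
      · exact mul_nonneg (h0 x) (hpos x (not_lt.1 h1) h2).le
      · rw [hψ, lap_discF]
        have : (R ^ 2 - rho (x - z)) / k ≤ 0 :=
          div_nonpos_of_nonpos_of_nonneg (by linarith) hk0.le
        simp [eG1, eG2, expNegInvGlue.zero_of_nonpos this]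
  have hinteg : Integrable (fun x => h x * lap ψ x) := by
    refine Integrable.bdd_mul (c := C) ?_ hm (Eventually.of_forall hb)
    exact hsm.lap.continuous.integrable_of_hasCompactSupport hcs.lap
  have heq : ∫ x, h x * lap ψ x = 0 := le_antisymm hle (integral_nonneg hnn)
  rw [integral_eq_zero_iff_of_nonneg hnn hinteg] at heq
  filter_upwards [heq] with x hx hxR
  by_cases h1 : rho (x - z) < r ^ 2
  · exact hz x h1
  · have := hpos x (not_lt.1 h1) hxR
    simp only [Pi.zero_apply] at hx
    rcases mul_eq_zero.1 hx with h | h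
    · exact h
    · exact absurd h this.ne'

/-! ### Planar convex geometry -/

def dot (n x : ℝ × ℝ) : ℝ := n.1 * x.1 + n.2 * x.2

theorem dot_self_pos {n : ℝ × ℝ} (h : n ≠ 0) : 0 < dot n n := by
  have := rho_pos h
  simp only [rho, dot] at *; linarith

theorem dot_crs_inj {n x y : ℝ × ℝ} (hn : n ≠ 0) (h1 : dot n x = dot n y)
    (h2 : crs n x = crs n y) : x = y := by
  have hr := rho_pos hn
  simp only [rho, dot, crs] at *
  ext
  · have : (n.1 ^ 2 + n.2 ^ 2) * (x.1 - y.1) = 0 := by linear_combination n.1 * h1 - n.2 * h2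
    rcases mul_eq_zero.1 this with h | h <;> linarith
  · have : (n.1 ^ 2 + n.2 ^ 2) * (x.2 - y.2) = 0 := by linear_combination n.2 * h1 + n.1 * h2
    rcases mul_eq_zero.1 this with h | h <;> linarith

structure Body (Ω : Set (ℝ × ℝ)) : Prop where
  conv : Convex ℝ Ω
  cpt : IsCompact Ω
  int : (interior Ω).Nonempty

theorem min_interior {Ω : Set (ℝ × ℝ)} {n : ℝ × ℝ} (hn : n ≠ 0) {c : ℝ}
    (h : ∀ x ∈ Ω, c ≤ dot n x) {x : ℝ × ℝ} (hx : x ∈ interior Ω) : c < dot n x := by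
  have hc : Continuous (fun t : ℝ => x - t • n) := by fun_prop
  have h1 : ∀ᶠ t in 𝓝 (0 : ℝ), x - t • n ∈ Ω :=
    hc.continuousAt.eventually_mem (by simpa using mem_interior_iff_mem_nhds.1 hx)
  have h2 : ∀ᶠ t in 𝓝[>] (0 : ℝ), x - t • n ∈ Ω := h1.filter_mono nhdsWithin_le_nhds
  obtain ⟨t, ht, ht0⟩ := (h2.and self_mem_nhdsWithin).exists
  have := h _ ht
  have hd := dot_self_pos hn
  have e : dot n (x - t • n) = dot n x - t * dot n n := by simp [dot]; ring
  rw [e] at this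
  have : 0 < t * dot n n := mul_pos ht0 hd
  linarith

theorem strong_dual_dot (f : StrongDual ℝ (ℝ × ℝ)) (x : ℝ × ℝ) :
    f x = dot (f (1, 0), f (0, 1)) x := by
  have : x = x.1 • ((1:ℝ), (0:ℝ)) + x.2 • ((0:ℝ), (1:ℝ)) := by ext <;> simp
  conv_lhs => rw [this, map_add, map_smul, map_smul]
  simp [dot]; ring

theorem dot_neg_left (n x : ℝ × ℝ) : dot (-n) x = -dot n x := by simp [dot]; ring

theorem dot_cont (n : ℝ × ℝ) : Continuous (dot n) := by unfold dot; fun_prop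

theorem crs_cont (n : ℝ × ℝ) : Continuous (crs n) := by unfold crs; fun_prop

theorem support {Ω : Set (ℝ × ℝ)} (hΩ : Body Ω) {x : ℝ × ℝ} (hx : x ∉ interior Ω) :
    ∃ n : ℝ × ℝ, n ≠ 0 ∧ ∀ y ∈ Ω, dot n x ≤ dot n y := by
  obtain ⟨f, hf⟩ := geometric_hahn_banach_open_point hΩ.conv.interior isOpen_interior hx
  refine ⟨-(f (1, 0), f (0, 1)), ?_, ?_⟩
  · intro h0
    obtain ⟨y, hy⟩ := hΩ.int
    have := hf y hy
    rw [strong_dual_dot, strong_dual_dot f x, neg_eq_zero.1 h0] at this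
    simp [dot] at this
  · intro y hy
    have hcl : Ω ⊆ closure (interior Ω) := by
      rw [hΩ.conv.closure_interior_eq_closure_of_nonempty_interior hΩ.int]
      exact subset_closure
    rw [dot_neg_left, dot_neg_left, ← strong_dual_dot, ← strong_dual_dot, neg_le_neg_iff]
    exact closure_minimal (fun z hz => (hf z hz).le)
      (isClosed_le f.continuous continuous_const) (hcl hy)

theorem dot_combo (n x y : ℝ × ℝ) (a b : ℝ) : dot n (a • x + b • y) = a * dot n x + b * dot n y := by
  simp [dot]; ring

theorem crs_combo (n x y : ℝ × ℝ) (a b : ℝ) : crs n (a • x + b • y) = a * crs n x + b * crs n y := by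
  simp [crs]; ring

theorem Body.closed {Ω : Set (ℝ × ℝ)} (hΩ : Body Ω) : IsClosed Ω := hΩ.cpt.isClosed

theorem Body.mem_frontier {Ω : Set (ℝ × ℝ)} (hΩ : Body Ω) {x : ℝ × ℝ} :
    x ∈ frontier Ω ↔ x ∈ Ω ∧ x ∉ interior Ω := by
  rw [hΩ.closed.frontier_eq]; rfl

theorem combo_ge {a b c X Y : ℝ} (ha : 0 < a) (hb : 0 < b) (hab : a + b = 1)
    (h : c = a * X + b * Y) (hX : c ≤ X) (hY : c ≤ Y) : X = c ∧ Y = c := by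
  have hbe : b = 1 - a := by linarith
  have e : a * (X - c) + b * (Y - c) = 0 := by
    have : a * (X - c) + b * (Y - c) = (a * X + b * Y) - (a + b) * c := by ring
    rw [this, ← h, hab]; ring
  have h1 := mul_nonneg ha.le (sub_nonneg.2 hX)
  have h2 := mul_nonneg hb.le (sub_nonneg.2 hY)
  have e1 : a * (X - c) = 0 := by linarith
  have e2 : b * (Y - c) = 0 := by linarith
  rcases mul_eq_zero.1 e1 with h | h <;> rcases mul_eq_zero.1 e2 with h' | h'
  · linarith
  · linarith
  · linarith
  · exact ⟨by linarith, by linarith⟩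

theorem combo_le {a b c X Y : ℝ} (ha : 0 < a) (hb : 0 < b) (hab : a + b = 1)
    (h : c = a * X + b * Y) (hX : X ≤ c) (hY : Y ≤ c) : X = c ∧ Y = c := by
  have := combo_ge (c := -c) (X := -X) (Y := -Y) ha hb hab (by rw [h]; ring) (by linarith) (by linarith)
  exact ⟨by linarith, by linarith⟩

/-- A face containing two points is a side. -/
theorem face {Ω : Set (ℝ × ℝ)} (hΩ : Body Ω) {n : ℝ × ℝ} (hn : n ≠ 0) {c : ℝ}
    (h : ∀ x ∈ Ω, c ≤ dot n x) {p q : ℝ × ℝ} (hp : p ∈ Ω) (hq : q ∈ Ω) (hpq : p ≠ q)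
    (hpc : dot n p = c) (hqc : dot n q = c) :
    ∃ A B, IsSide Ω A B ∧ dot n A = c ∧ dot n B = c ∧
      ∀ x ∈ Ω, dot n x = c → x ∈ segment ℝ A B := by
  set F := Ω ∩ {x | dot n x = c} with hF
  have hFc : IsCompact F := hΩ.cpt.inter_right (isClosed_eq (dot_cont n) continuous_const)
  have hFn : F.Nonempty := ⟨p, hp, hpc⟩
  obtain ⟨A, hA, hAm⟩ := hFc.exists_isMinOn hFn (crs_cont n).continuousOn
  obtain ⟨B, hB, hBm⟩ := hFc.exists_isMaxOn hFn (crs_cont n).continuousOn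
  have hAB : crs n A < crs n B := by
    rcases lt_or_ge (crs n A) (crs n B) with h' | h'
    · exact h'
    · exfalso
      apply hpq
      have a1 : crs n A ≤ crs n p := hAm ⟨hp, hpc⟩
      have a2 : crs n A ≤ crs n q := hAm ⟨hq, hqc⟩
      have b1 : crs n p ≤ crs n B := hBm ⟨hp, hpc⟩
      have b2 : crs n q ≤ crs n B := hBm ⟨hq, hqc⟩
      exact dot_crs_inj hn (hpc.trans hqc.symm) (by linarith)
  have hsub : ∀ x ∈ Ω, dot n x = c → x ∈ segment ℝ A B := by
    intro x hx hxc
    have a1 : crs n A ≤ crs n x := hAm ⟨hx, hxc⟩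
    have b1 : crs n x ≤ crs n B := hBm ⟨hx, hxc⟩
    have hd : 0 < crs n B - crs n A := by linarith
    refine ⟨(crs n B - crs n x) / (crs n B - crs n A), (crs n x - crs n A) / (crs n B - crs n A),
      div_nonneg (by linarith) hd.le, div_nonneg (by linarith) hd.le, ?_, ?_⟩
    · field_simp; ring
    · apply dot_crs_inj hn
      · rw [dot_combo, hA.2, hB.2, hxc]; field_simp; ring
      · rw [crs_combo]; field_simp; ring
  have hext : ∀ A' ∈ F, (∀ x ∈ F, crs n A' ≤ crs n x) ∨ (∀ x ∈ F, crs n x ≤ crs n A') →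
      A' ∈ Set.extremePoints ℝ Ω := by
    intro A' hA' hm
    rw [mem_extremePoints]
    refine ⟨hA'.1, fun x hx y hy hxy => ?_⟩
    obtain ⟨a, b, ha, hb, hab, e⟩ := hxy
    have e1 := dot_combo n x y a b
    rw [e, hA'.2] at e1
    have x1 := h x hx
    have y1 := h y hy
    obtain ⟨hxc, hyc⟩ := combo_ge ha hb hab e1 x1 y1
    have e2 := crs_combo n x y a b
    rw [e] at e2
    have hxy : crs n x = crs n A' ∧ crs n y = crs n A' := by
      rcases hm with hm | hm
      · exact combo_ge ha hb hab e2 (hm x ⟨hx, hxc⟩) (hm y ⟨hy, hyc⟩)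
      · exact combo_le ha hb hab e2 (hm x ⟨hx, hxc⟩) (hm y ⟨hy, hyc⟩)
    exact ⟨dot_crs_inj hn (hxc.trans hA'.2.symm) hxy.1,
      dot_crs_inj hn (hyc.trans hA'.2.symm) hxy.2⟩
  refine ⟨A, B, ⟨?_, hext A hA (Or.inl fun x hx => hAm hx), hext B hB (Or.inr fun x hx => hBm hx),
    ?_⟩, hA.2, hB.2, hsub⟩
  · rintro rfl; exact lt_irrefl _ hAB
  · intro x hx
    have hxΩ : x ∈ Ω := hΩ.conv.segment_subset hA.1 hB.1 hx
    refine hΩ.mem_frontier.2 ⟨hxΩ, fun hi => ?_⟩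
    have := min_interior hn h hi
    obtain ⟨a, b, ha, hb, hab, e⟩ := hx
    rw [← e, dot_combo, hA.2, hB.2, ← add_mul, hab, one_mul] at this
    exact lt_irrefl _ this

/-- Every boundary point is a corner or lies inside a side. -/
theorem side_or_extreme {Ω : Set (ℝ × ℝ)} (hΩ : Body Ω) {v : ℝ × ℝ} (hv : v ∈ frontier Ω) :
    v ∈ Set.extremePoints ℝ Ω ∨ ∃ A B, IsSide Ω A B ∧ v ∈ openSegment ℝ A B := by
  rw [hΩ.mem_frontier] at hv
  obtain ⟨n, hn, h⟩ := support hΩ hv.2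
  by_cases hw : ∃ w ∈ Ω, w ≠ v ∧ dot n w = dot n v
  · obtain ⟨w, hw, hwv, hwn⟩ := hw
    obtain ⟨A, B, hAB, hA, hB, hF⟩ := face hΩ hn h hw hv.1 hwv hwn rfl
    have := hF v hv.1 rfl
    rw [← insert_endpoints_openSegment] at this
    rcases this with rfl | rfl | h'
    · exact Or.inl hAB.2.1
    · exact Or.inl hAB.2.2.1
    · exact Or.inr ⟨A, B, hAB, h'⟩
  · left
    push Not at hw
    rw [mem_extremePoints]
    refine ⟨hv.1, fun x hx y hy hxy => ?_⟩
    obtain ⟨a, b, ha, hb, hab, e⟩ := hxy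
    have e1 := dot_combo n x y a b
    rw [e] at e1
    have x1 := h x hx
    have y1 := h y hy
    obtain ⟨hxc, hyc⟩ := combo_ge ha hb hab e1 x1 y1
    exact ⟨by_contra fun hne => hw x hx hne hxc, by_contra fun hne => hw y hy hne hyc⟩

theorem IsSide.symm {Ω : Set (ℝ × ℝ)} {a b : ℝ × ℝ} (h : IsSide Ω a b) : IsSide Ω b a :=
  ⟨h.1.symm, h.2.2.1, h.2.1, by rw [segment_symm]; exact h.2.2.2⟩

/-- `a, b` a side with `Ω` on its left. -/
def LSide (Ω : Set (ℝ × ℝ)) (a b : ℝ × ℝ) : Prop :=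
  IsSide Ω a b ∧ ∀ x ∈ Ω, 0 ≤ crs (b - a) (x - a)

theorem crs_swap (a b x : ℝ × ℝ) : crs (a - b) (x - b) = -crs (b - a) (x - a) := by
  simp [crs]; ring

theorem side_support {Ω : Set (ℝ × ℝ)} (hΩ : Body Ω) {a b : ℝ × ℝ} (hs : IsSide Ω a b) :
    LSide Ω a b ∨ LSide Ω b a := by
  have hmid : midpoint ℝ a b ∈ frontier Ω := hs.2.2.2 (midpoint_mem_segment a b)
  rw [hΩ.mem_frontier] at hmid
  obtain ⟨n, hn, h⟩ := support hΩ hmid.2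
  have ha := h a hs.2.1.1
  have hb := h b hs.2.2.1.1
  have hm : dot n (midpoint ℝ a b) = (dot n a + dot n b) / 2 := by
    rw [midpoint_eq_smul_add]; simp [dot]; ring
  have hab : dot n a = dot n b := by linarith
  have hdir : dot n (b - a) = 0 := by
    have : dot n (b - a) = dot n b - dot n a := by simp [dot]; ring
    rw [this, hab, sub_self]
  have hd : b - a ≠ 0 := sub_ne_zero.2 hs.1.symm
  have hr := rho_pos hd
  have hx : ∀ x ∈ Ω, crs n (b - a) * crs (b - a) (x - a) ≤ 0 := by
    intro x hx
    have h1 := h x hx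
    have e : crs n (b - a) * crs (b - a) (x - a) =
        -(rho (b - a)) * dot n (x - a) + dot (b - a) (x - a) * dot n (b - a) := by
      simp only [crs, dot, rho]; ring
    have e' : crs n (b - a) * crs (b - a) (x - a) = -rho (b - a) * dot n (x - a) := by
      rw [e, hdir]; ring
    have e2 : dot n (x - a) = dot n x - dot n a := by simp [dot]; ring
    have : 0 ≤ rho (b - a) * dot n (x - a) := mul_nonneg hr.le (by rw [e2]; linarith)
    linarith
  have hne : crs n (b - a) ≠ 0 := by
    intro h0
    apply hd
    exact dot_crs_inj hn (by rw [hdir]; simp [dot]) (by rw [h0]; simp [crs])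
  rcases lt_or_gt_of_ne hne with h0 | h0
  · left
    refine ⟨hs, fun x hx' => ?_⟩
    by_contra hlt
    push Not at hlt
    have := mul_pos_of_neg_of_neg h0 hlt
    linarith [hx x hx']
  · right
    refine ⟨hs.symm, fun x hx' => ?_⟩
    rw [crs_swap]
    by_contra hlt
    push Not at hlt
    have := mul_pos h0 (by linarith : 0 < crs (b - a) (x - a))
    linarith [hx x hx']

theorem crs_eq_dot (l x : ℝ × ℝ) : crs l x = dot (-l.2, l.1) x := by simp [crs, dot]; ring

theorem rot_ne {l : ℝ × ℝ} (h : l ≠ 0) : ((-l.2, l.1) : ℝ × ℝ) ≠ 0 := by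
  intro h0
  apply h
  have h1 := congrArg Prod.fst h0
  have h2 := congrArg Prod.snd h0
  simp at h1 h2
  exact Prod.ext h2 h1

theorem crs_sub (l x y : ℝ × ℝ) : crs l (x - y) = crs l x - crs l y := by simp [crs]; ring
theorem crs_smul (l x : ℝ × ℝ) (t : ℝ) : crs l (t • x) = t * crs l x := by simp [crs]; ring
theorem crs_smul_left (l x : ℝ × ℝ) (t : ℝ) : crs (t • l) x = t * crs l x := by simp [crs]; ring
theorem crs_self (l : ℝ × ℝ) : crs l l = 0 := by simp [crs]; ring
theorem crs_anti (l x : ℝ × ℝ) : crs l x = - crs x l := by simp [crs]; ring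

theorem LSide.int {Ω : Set (ℝ × ℝ)} {a b : ℝ × ℝ} (h : LSide Ω a b) {x : ℝ × ℝ}
    (hx : x ∈ interior Ω) : 0 < crs (b - a) (x - a) := by
  have hd : b - a ≠ 0 := sub_ne_zero.2 h.1.1.symm
  have := min_interior (rot_ne hd) (c := crs (b - a) a) (Ω := Ω) (fun y hy => by
    have := h.2 y hy
    rw [crs_sub] at this
    rw [← crs_eq_dot]; linarith) hx
  rw [← crs_eq_dot] at this
  rw [crs_sub]; linarith

theorem flat {Ω : Set (ℝ × ℝ)} (hΩ : Body Ω) {a b : ℝ × ℝ} (h : LSide Ω a b) {q : ℝ × ℝ}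
    (hq : q ∈ openSegment ℝ a b) :
    ∃ ε > 0, ∀ x ∈ Metric.ball q ε, (0 < crs (b - a) (x - a) → x ∈ interior Ω) ∧
      (crs (b - a) (x - a) = 0 → x ∈ openSegment ℝ a b) := by
  obtain ⟨c, hc⟩ := hΩ.int
  have hD := h.int hc
  set D := crs (b - a) (c - a) with hDd
  have hexp : ∀ x, x = (1 - crs (x - a) (c - a) / D - crs (b - a) (x - a) / D) • a +
      (crs (x - a) (c - a) / D) • b + (crs (b - a) (x - a) / D) • c := by
    intro x
    have hD' : D ≠ 0 := hD.ne'
    ext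
    · simp only [Prod.fst_add, Prod.smul_fst, smul_eq_mul]
      field_simp
      simp only [hDd, crs, Prod.fst_sub, Prod.snd_sub]; ring
    · simp only [Prod.snd_add, Prod.smul_snd, smul_eq_mul]
      field_simp
      simp only [hDd, crs, Prod.fst_sub, Prod.snd_sub]; ring
  have ca : Continuous (fun x : ℝ × ℝ => crs (x - a) (c - a)) := by unfold crs; fun_prop
  have cb : Continuous (fun x : ℝ × ℝ => crs (b - a) (x - a)) := by unfold crs; fun_prop
  have oW : IsOpen {x : ℝ × ℝ | 0 < crs (x - a) (c - a) ∧
      crs (x - a) (c - a) + crs (b - a) (x - a) < D} :=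
    (isOpen_lt continuous_const ca).inter (isOpen_lt (ca.add cb) continuous_const)
  have oV : IsOpen {x : ℝ × ℝ | (0 < crs (x - a) (c - a) ∧
      crs (x - a) (c - a) + crs (b - a) (x - a) < D) ∧ 0 < crs (b - a) (x - a)} :=
    oW.inter (isOpen_lt continuous_const cb)
  have hV : {x : ℝ × ℝ | (0 < crs (x - a) (c - a) ∧
      crs (x - a) (c - a) + crs (b - a) (x - a) < D) ∧ 0 < crs (b - a) (x - a)} ⊆ Ω := by
    rintro x ⟨⟨h1, h2⟩, h3⟩
    rw [hexp x]
    have e1 : 0 < 1 - crs (x - a) (c - a) / D - crs (b - a) (x - a) / D := by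
      have : (crs (x - a) (c - a) + crs (b - a) (x - a)) / D < 1 := (div_lt_one hD).2 h2
      rw [add_div] at this; linarith
    have := hΩ.conv.sum_mem (t := Finset.univ) (w := ![1 - crs (x - a) (c - a) / D - crs (b - a) (x - a) / D,
      crs (x - a) (c - a) / D, crs (b - a) (x - a) / D]) (z := ![a, b, c]) (by
        intro i _; fin_cases i
        · exact e1.le
        · exact (div_pos h1 hD).le
        · exact (div_pos h3 hD).le) (by simp [Fin.sum_univ_three]; ring) (by
        intro i _; fin_cases i
        · exact h.1.2.1.1
        · exact h.1.2.2.1.1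
        · exact interior_subset hc)
    simpa [Fin.sum_univ_three] using this
  have hqW : q ∈ {x : ℝ × ℝ | 0 < crs (x - a) (c - a) ∧
      crs (x - a) (c - a) + crs (b - a) (x - a) < D} := by
    obtain ⟨s, t, hs, ht, hst, rfl⟩ := hq
    have hs' : s = 1 - t := by linarith
    have e1 : crs (s • a + t • b - a) (c - a) = t * D := by
      rw [hs', hDd]; simp [crs]; ring
    have e2 : crs (b - a) (s • a + t • b - a) = 0 := by
      rw [hs']; simp [crs]; ring
    refine ⟨?_, ?_⟩
    · rw [e1]; exact mul_pos ht hD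
    · rw [e1, e2]; nlinarith
  obtain ⟨ε, hε, hb⟩ := Metric.isOpen_iff.1 oW q hqW
  refine ⟨ε, hε, fun x hx => ⟨fun h3 => ?_, fun h0 => ?_⟩⟩
  · exact interior_maximal hV oV ⟨hb hx, h3⟩
  · obtain ⟨h1, h2⟩ := hb hx
    have := hexp x
    rw [h0] at this h2
    refine ⟨1 - crs (x - a) (c - a) / D, _, ?_, div_pos h1 hD, ?_, ?_⟩
    · have := (div_lt_one hD).2 h2
      rw [add_zero] at this; linarith
    · ring
    · conv_rhs => rw [this]
      simp

theorem flat' {Ω : Set (ℝ × ℝ)} (hΩ : Body Ω) {a b : ℝ × ℝ} (h : IsSide Ω a b) :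
    ∃ σ : ℝ, (σ = 1 ∨ σ = -1) ∧ (∀ x ∈ Ω, 0 ≤ σ * crs (b - a) (x - a)) ∧
      (∀ x ∈ interior Ω, 0 < σ * crs (b - a) (x - a)) ∧
      ∀ q ∈ openSegment ℝ a b, ∃ ε > 0, ∀ x ∈ Metric.ball q ε,
        (0 < σ * crs (b - a) (x - a) → x ∈ interior Ω) ∧
        (σ * crs (b - a) (x - a) = 0 → x ∈ openSegment ℝ a b) := by
  rcases side_support hΩ h with h | h
  · refine ⟨1, Or.inl rfl, ?_, ?_, ?_⟩
    · simpa using h.2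
    · intro x hx; rw [one_mul]; exact h.int hx
    · intro q hq; simp only [one_mul]; exact flat hΩ h hq
  · refine ⟨-1, Or.inr rfl, ?_, ?_, ?_⟩
    · intro x hx; rw [neg_one_mul, ← crs_swap]; exact h.2 x hx
    · intro x hx; rw [neg_one_mul, ← crs_swap]; exact h.int hx
    · intro q hq
      rw [openSegment_symm] at hq
      obtain ⟨ε, hε, H⟩ := flat hΩ h hq
      refine ⟨ε, hε, fun x hx => ?_⟩
      rw [neg_one_mul, ← crs_swap, openSegment_symm]
      exact H x hx

theorem ext_endpoint {Ω : Set (ℝ × ℝ)} {v A B : ℝ × ℝ} (hv : v ∈ Set.extremePoints ℝ Ω)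
    (hA : A ∈ Ω) (hB : B ∈ Ω) (h : v ∈ segment ℝ A B) (hAB : A ≠ B) : v = A ∨ v = B := by
  rw [← insert_endpoints_openSegment] at h
  rcases h with h | h | h
  · exact Or.inl h
  · exact Or.inr h
  · rw [mem_extremePoints] at hv
    obtain ⟨h1, h2⟩ := hv.2 A hA B hB h
    exact absurd (h1.trans h2.symm) hAB

/-- two sides at a corner are not parallel -/
theorem sides_crs_ne {Ω : Set (ℝ × ℝ)} {v a b : ℝ × ℝ} (hab : a ≠ b) (ha : IsSide Ω v a)
    (hb : IsSide Ω v b) : crs (a - v) (b - v) ≠ 0 := by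
  intro h0
  have hd : a - v ≠ 0 := sub_ne_zero.2 ha.1.symm
  have hr := rho_pos hd
  obtain ⟨t, ht⟩ : ∃ t : ℝ, b - v = t • (a - v) := by
    refine ⟨dot (a - v) (b - v) / rho (a - v), dot_crs_inj hd ?_ ?_⟩
    · have : dot (a - v) ((dot (a - v) (b - v) / rho (a - v)) • (a - v)) =
        dot (a - v) (b - v) / rho (a - v) * rho (a - v) := by
          simp [dot, rho]; ring
      rw [this]; field_simp
    · rw [h0, crs_smul, crs_self, mul_zero]
  have hbv : b = v + t • (a - v) := by rw [← ht]; abel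
  have h1 : t ≠ 1 := by rintro rfl; apply hab; rw [hbv]; simp
  have h2 : t ≠ 0 := by rintro rfl; apply hb.1; rw [hbv]; simp
  have ea := ha.2.1; have eb := ha.2.2.1; have ec := hb.2.2.1
  rw [mem_extremePoints] at ea eb ec
  rcases lt_or_gt_of_ne h2 with h | h
  · have := ea.2 a eb.1 b ec.1 ⟨(-t) / (1 - t), 1 / (1 - t), div_pos (by linarith) (by linarith),
      div_pos one_pos (by linarith), by rw [← add_div, div_eq_one_iff_eq (by linarith)]; ring, by
        have : (1 - t) ≠ 0 := by linarith
        rw [hbv]; ext <;> simp <;> field_simp <;> ring⟩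
    exact ha.1 this.1.symm
  · rcases lt_or_gt_of_ne h1 with h' | h'
    · have := ec.2 v ea.1 a eb.1 ⟨1 - t, t, by linarith, h, by ring, by
        rw [hbv]; ext <;> simp <;> ring⟩
      exact hb.1 this.1
    · have := eb.2 v ea.1 b ec.1 ⟨(t - 1) / t, 1 / t, div_pos (by linarith) h,
        div_pos one_pos h, by rw [← add_div, div_eq_one_iff_eq (by linarith)]; ring, by
        rw [hbv]; ext <;> simp <;> field_simp <;> ring⟩
      exact ha.1 this.1

theorem at_most_two {Ω : Set (ℝ × ℝ)} (hΩ : Body Ω) {v a b c : ℝ × ℝ} (hab : a ≠ b) (hac : a ≠ c)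
    (hbc : b ≠ c) (ha : IsSide Ω v a) (hb : IsSide Ω v b) (hc : IsSide Ω v c) : False := by
  obtain ⟨σa, sa, ha', -, -⟩ := flat' hΩ ha
  obtain ⟨σb, sb, hb', -, -⟩ := flat' hΩ hb
  obtain ⟨σc, sc, hc', -, -⟩ := flat' hΩ hc
  have n1 := sides_crs_ne hab ha hb
  have n2 := sides_crs_ne hac ha hc
  have n3 := sides_crs_ne hbc hb hc
  have a1 := ha' b hb.2.2.1.1
  have a2 := ha' c hc.2.2.1.1
  have b1 := hb' a ha.2.2.1.1
  have b2 := hb' c hc.2.2.1.1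
  have c1 := hc' a ha.2.2.1.1
  have c2 := hc' b hb.2.2.1.1
  rw [crs_anti (b - v) (a - v)] at b1
  rw [crs_anti (c - v) (a - v)] at c1
  rw [crs_anti (c - v) (b - v)] at c2
  have k : ∀ x : ℝ, x ≠ 0 → 0 ≤ x → 0 ≤ -x → False := fun x h1 h2 h3 => h1 (by linarith)
  rcases sa with rfl | rfl <;> rcases sb with rfl | rfl <;> rcases sc with rfl | rfl <;>
    first
    | exact k _ n1 (by linarith) (by linarith)
    | exact k _ n2 (by linarith) (by linarith)
    | exact k _ n3 (by linarith) (by linarith)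

theorem poly_body {Ω : Set (ℝ × ℝ)} (h : IsLatticePolygon Ω) : Body Ω := by
  obtain ⟨⟨S, rfl⟩, hi⟩ := h
  exact ⟨convex_convexHull ℝ _, ((S.finite_toSet.image _).isCompact_convexHull (𝕜 := ℝ)), hi⟩

theorem poly_ext {Ω : Set (ℝ × ℝ)} (h : IsLatticePolygon Ω) {v : ℝ × ℝ}
    (hv : v ∈ Set.extremePoints ℝ Ω) : ∃ w : ℤ × ℤ, v = toR w := by
  obtain ⟨⟨S, rfl⟩, hi⟩ := h
  obtain ⟨w, -, hw⟩ := extremePoints_convexHull_subset hv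
  exact ⟨w, hw.symm⟩

theorem poly_ext_fin {Ω : Set (ℝ × ℝ)} (h : IsLatticePolygon Ω) :
    (Set.extremePoints ℝ Ω).Finite := by
  obtain ⟨⟨S, rfl⟩, hi⟩ := h
  exact (S.finite_toSet.image _).subset extremePoints_convexHull_subset

theorem two_sides_aux {Ω : Set (ℝ × ℝ)} (hΩ : Body Ω) {v a0 : ℝ × ℝ}
    (hv : v ∈ Set.extremePoints ℝ Ω) (ha0 : a0 ∈ Ω) (hne : a0 ≠ v) (σ : ℝ) (hσ : σ = 1 ∨ σ = -1)
    (h : ∀ x ∈ Ω, 0 ≤ σ * crs (a0 - v) (x - v)) :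
    ∃ a, IsSide Ω v a ∧ ∃ s : ℝ, 0 < s ∧ a0 - v = s • (a - v) ∧
      ∀ x ∈ interior Ω, 0 < σ * crs (a - v) (x - v) := by
  have hσ0 : σ ≠ 0 := by rcases hσ with rfl | rfl <;> norm_num
  have hd : a0 - v ≠ 0 := sub_ne_zero.2 hne
  have hd' : σ • (a0 - v) ≠ 0 := smul_ne_zero hσ0 hd
  have key : ∀ x, dot (-(σ • (a0 - v)).2, (σ • (a0 - v)).1) x = σ * crs (a0 - v) x := by
    intro x; rw [← crs_eq_dot, crs_smul_left]
  have hmin : ∀ x ∈ Ω, σ * crs (a0 - v) v ≤ dot (-(σ • (a0 - v)).2, (σ • (a0 - v)).1) x := by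
    intro x hx
    have := h x hx
    rw [crs_sub] at this
    rw [key]; linarith
  have ev : dot (-(σ • (a0 - v)).2, (σ • (a0 - v)).1) v = σ * crs (a0 - v) v := key v
  have ea : dot (-(σ • (a0 - v)).2, (σ • (a0 - v)).1) a0 = σ * crs (a0 - v) v := by
    rw [key]
    have := crs_sub (a0 - v) a0 v
    rw [crs_self] at this
    rw [show crs (a0 - v) a0 = crs (a0 - v) v by linarith]
  obtain ⟨A, B, hs, -, -, hF⟩ := face hΩ (rot_ne hd') hmin ha0 hv.1 hne ea ev
  have main : ∀ A, IsSide Ω v A → a0 ∈ segment ℝ v A → 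
      ∃ a, IsSide Ω v a ∧ ∃ s : ℝ, 0 < s ∧ a0 - v = s • (a - v) ∧
      ∀ x ∈ interior Ω, 0 < σ * crs (a - v) (x - v) := by
    intro a hs ha
    refine ⟨a, hs, ?_⟩
    obtain ⟨p, q, hp, hq, hpq, e⟩ := ha
    have eq : a0 - v = q • (a - v) := by
      rw [← e, show p = 1 - q by linarith]; ext <;> simp <;> ring
    have hq0 : 0 < q := by
      rcases hq.lt_or_eq with h | h
      · exact h
      · exfalso; apply hd; rw [eq, ← h, zero_smul]
    refine ⟨q, hq0, eq, fun x hx => ?_⟩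
    have := min_interior (rot_ne hd') hmin hx
    rw [key] at this
    have h2 : 0 < σ * crs (a0 - v) (x - v) := by rw [crs_sub]; linarith
    rw [eq, crs_smul_left] at h2
    by_contra hc
    push Not at hc
    have := mul_nonpos_of_nonneg_of_nonpos hq0.le hc
    linarith
  rcases ext_endpoint hv hs.2.1.1 hs.2.2.1.1 (hF v hv.1 ev) hs.1 with rfl | rfl
  · exact main B hs (hF a0 ha0 ea)
  · exact main A hs.symm (by rw [segment_symm]; exact hF a0 ha0 ea)

theorem two_sides {Ω : Set (ℝ × ℝ)} (h : IsLatticePolygon Ω) {v : ℝ × ℝ}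
    (hv : v ∈ Set.extremePoints ℝ Ω) : ∃ a b, a ≠ b ∧ IsSide Ω v a ∧ IsSide Ω v b := by
  have hΩ := poly_body h
  obtain ⟨⟨S, hS⟩, hi⟩ := h
  have hv' := hv
  rw [hΩ.conv.mem_extremePoints_iff_mem_sdiff_convexHull_sdiff] at hv'
  set S' : Finset (ℝ × ℝ) := (S.image toR).erase v with hS'
  have hsub : (convexHull ℝ (S' : Set (ℝ × ℝ))) ⊆ convexHull ℝ (Ω \ {v}) := by
    apply convexHull_mono
    intro s hs
    simp only [hS', Finset.coe_erase, Finset.coe_image] at hs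
    exact ⟨by rw [hS]; exact subset_convexHull ℝ _ hs.1, hs.2⟩
  have hnot : v ∉ convexHull ℝ (S' : Set (ℝ × ℝ)) := fun h => hv'.2 (hsub h)
  obtain ⟨f, u, hfu, hfv⟩ := geometric_hahn_banach_point_closed (convex_convexHull ℝ _)
    (S'.finite_toSet.isCompact_convexHull (𝕜 := ℝ)).isClosed hnot
  set n : ℝ × ℝ := (f (1, 0), f (0, 1))
  have hn : ∀ s ∈ S', 0 < dot n (s - v) := by
    intro s hs
    have := hfv s (subset_convexHull ℝ _ hs)
    rw [← strong_dual_dot, map_sub]; linarith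
  have hne : S'.Nonempty := by
    by_contra hne
    rw [Finset.not_nonempty_iff_eq_empty] at hne
    have h1 : Ω ⊆ {v} := by
      rw [hS]
      apply convexHull_min _ (convex_singleton v)
      intro s hs
      by_contra hsv
      have : s ∈ S' := by
        rw [hS', Finset.mem_erase]
        exact ⟨hsv, by rw [← Finset.mem_coe, Finset.coe_image]; exact hs⟩
      simp [hne] at this
    obtain ⟨x, hx⟩ := hi
    have := interior_mono h1 hx
    simp at this
  have hrn : 0 < rho n := by
    obtain ⟨s, hs⟩ := hne
    apply rho_pos
    intro h0
    have := hn s hs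
    rw [h0] at this; simp [dot] at this
  have hid : ∀ x y : ℝ × ℝ, rho n * crs y x = dot n y * crs n x - crs n y * dot n x := by
    intro x y; simp only [rho, crs, dot]; ring
  have hmem : ∀ s ∈ S', s ∈ Ω ∧ s ≠ v := by
    intro s hs
    rw [hS', Finset.mem_erase, ← Finset.mem_coe, Finset.coe_image] at hs
    exact ⟨by rw [hS]; exact subset_convexHull ℝ _ hs.2, hs.1⟩
  have hext : ∀ (σ : ℝ) (a0 : ℝ × ℝ), (∀ s ∈ S', 0 ≤ σ * crs (a0 - v) (s - v)) →
      ∀ x ∈ Ω, 0 ≤ σ * crs (a0 - v) (x - v) := by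
    intro σ a0 hs
    have : Ω ⊆ {x | 0 ≤ σ * crs (a0 - v) (x - v)} := by
      rw [hS]
      apply convexHull_min
      · intro s hsS
        by_cases hsv : s = v
        · subst hsv; simp [crs]
        · exact hs s (by rw [hS', Finset.mem_erase]
                         exact ⟨hsv, by rw [← Finset.mem_coe, Finset.coe_image]; exact hsS⟩)
      · intro x hx y hy p q hp hq hpq
        show 0 ≤ σ * crs (a0 - v) (p • x + q • y - v)
        have : σ * crs (a0 - v) (p • x + q • y - v) =
          p * (σ * crs (a0 - v) (x - v)) + q * (σ * crs (a0 - v) (y - v)) := by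
            rw [show q = 1 - p by linarith]; simp [crs]; ring
        rw [this]
        exact add_nonneg (mul_nonneg hp hx) (mul_nonneg hq hy)
    exact this
  obtain ⟨a0, ha0, hmin⟩ := S'.exists_min_image (fun s => crs n (s - v) / dot n (s - v)) hne
  obtain ⟨b0, hb0, hmax⟩ := S'.exists_max_image (fun s => crs n (s - v) / dot n (s - v)) hne
  obtain ⟨a, ha, s, hs, eas, hai⟩ := two_sides_aux hΩ hv (hmem a0 ha0).1 (hmem a0 ha0).2 1
    (Or.inl rfl) (hext 1 a0 (fun s hs => by
      have := hmin s hs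
      rw [div_le_div_iff₀ (hn _ ha0) (hn _ hs)] at this
      have h2 := hid (s - v) (a0 - v)
      rw [one_mul]
      by_contra hc
      push Not at hc
      have := mul_neg_of_pos_of_neg hrn hc
      linarith))
  obtain ⟨b, hb, t, ht, ebt, hbi⟩ := two_sides_aux hΩ hv (hmem b0 hb0).1 (hmem b0 hb0).2 (-1)
    (Or.inr rfl) (hext (-1) b0 (fun s hs => by
      have := hmax s hs
      rw [div_le_div_iff₀ (hn _ hs) (hn _ hb0)] at this
      have h2 := hid (s - v) (b0 - v)
      rw [neg_one_mul]
      by_contra hc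
      push Not at hc
      have := mul_pos hrn (by linarith : 0 < crs (b0 - v) (s - v))
      linarith))
  refine ⟨a, b, ?_, ha, hb⟩
  rintro rfl
  obtain ⟨x, hx⟩ := hi
  have := hai x hx
  have := hbi x hx
  linarith

theorem corner {Ω : Set (ℝ × ℝ)} (h : IsLatticePolygon Ω) {v a b : ℝ × ℝ} (hab : a ≠ b)
    (ha : IsSide Ω v a) (hb : IsSide Ω v b) :
    ∃ r > 0, ∀ x ∈ Metric.ball v r, x ∈ frontier Ω → x ≠ v →
      x ∈ openSegment ℝ v a ∨ x ∈ openSegment ℝ v b := by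
  have hΩ := poly_body h
  have hf := poly_ext_fin h
  have e1 : ∀ᶠ x in 𝓝 v, ∀ w ∈ Set.extremePoints ℝ Ω, w ≠ v → x ≠ w := by
    rw [Filter.eventually_all_finite hf]
    intro w hw
    by_cases hwv : w = v
    · simp [hwv]
    · filter_upwards [isOpen_ne.mem_nhds (Ne.symm hwv)] with x hx _ using hx
  have e2 : ∀ᶠ x in 𝓝 v, ∀ p ∈ (Set.extremePoints ℝ Ω) ×ˢ (Set.extremePoints ℝ Ω),
      v ∉ segment ℝ p.1 p.2 → x ∉ segment ℝ p.1 p.2 := by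
    rw [Filter.eventually_all_finite (hf.prod hf)]
    intro p hp
    by_cases hvp : v ∈ segment ℝ p.1 p.2
    · simp [hvp]
    · have hcl : IsClosed (segment ℝ p.1 p.2) := by
        rw [← convexHull_pair]
        exact ((Set.toFinite _).isCompact_convexHull (𝕜 := ℝ)).isClosed
      filter_upwards [hcl.isOpen_compl.mem_nhds hvp] with x hx _ using hx
  obtain ⟨r, hr, hball⟩ := Metric.eventually_nhds_iff_ball.1 (e1.and e2)
  refine ⟨r, hr, fun x hx hxf hxv => ?_⟩
  obtain ⟨h1, h2⟩ := hball x hx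
  have fin : ∀ c, IsSide Ω v c → x ∈ openSegment ℝ v c →
      x ∈ openSegment ℝ v a ∨ x ∈ openSegment ℝ v b := by
    intro c hc hxc
    by_cases hca : c = a
    · subst hca; exact Or.inl hxc
    by_cases hcb : c = b
    · subst hcb; exact Or.inr hxc
    exact (at_most_two hΩ hab (Ne.symm hca) (Ne.symm hcb) ha hb hc).elim
  rcases side_or_extreme hΩ hxf with hxe | ⟨A, B, hs, hx'⟩
  · exact absurd rfl (h1 x hxe hxv)
  · have hv : v ∈ segment ℝ A B := by
      by_contra hv
      exact h2 (A, B) ⟨hs.2.1, hs.2.2.1⟩ hv (openSegment_subset_segment ℝ A B hx')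
    rcases ext_endpoint ha.2.1 hs.2.1.1 hs.2.2.1.1 hv hs.1 with rfl | rfl
    · exact fin B hs hx'
    · exact fin A hs.symm (by rw [openSegment_symm]; exact hx')

theorem seg_closed (a b : ℝ × ℝ) : IsClosed (segment ℝ a b) := by
  rw [← convexHull_pair]
  exact ((Set.toFinite _).isCompact_convexHull (𝕜 := ℝ)).isClosed

theorem gsupp_closed (E : Finset Seg) : IsClosed (gsupp E) :=
  E.finite_toSet.isClosed_biUnion (fun _ _ => seg_closed _ _)

theorem mem_gsupp {E : Finset Seg} {x : ℝ × ℝ} : x ∈ gsupp E ↔ ∃ e ∈ E, x ∈ seg e := by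
  simp [gsupp]

theorem gsupp_sub {Ω C : Set (ℝ × ℝ)} (hΩ : Body Ω) {E : Finset Seg}
    (hS : gsupp E = closure (C ∩ interior Ω)) : gsupp E ⊆ Ω := by
  rw [hS]; exact closure_minimal (fun x hx => interior_subset hx.2) hΩ.closed

theorem edge_int {Ω C : Set (ℝ × ℝ)} (hΩ : Body Ω) {E : Finset Seg} (hE : EdgeSet E)
    (hPl : Planar E) (hS : gsupp E = closure (C ∩ interior Ω)) {e : Seg} (he : e ∈ E)
    {x : ℝ × ℝ} (hx : x ∈ openSegment ℝ e.1 e.2) : x ∈ interior Ω := by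
  by_contra hxi
  have hG := gsupp_sub hΩ hS
  have hse : seg e ⊆ Ω := fun y hy => hG (mem_gsupp.2 ⟨e, he, hy⟩)
  have hx1 : x ∈ seg e := openSegment_subset_segment ℝ _ _ hx
  obtain ⟨n, hn, hmin⟩ := support hΩ hxi
  have hdis : ∀ y ∈ seg e, y ∉ interior Ω := by
    obtain ⟨a, b, ha, hb, hab, ex⟩ := hx
    have e1 := dot_combo n e.1 e.2 a b
    rw [ex] at e1
    obtain ⟨h1, h2⟩ := combo_ge ha hb hab e1 (hmin _ (hse (left_mem_segment ℝ _ _)))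
      (hmin _ (hse (right_mem_segment ℝ _ _)))
    rintro y ⟨p, q, hp, hq, hpq, rfl⟩ hyi
    have := min_interior hn hmin hyi
    rw [dot_combo, h1, h2, ← add_mul, hpq, one_mul] at this
    exact lt_irrefl _ this
  have hsub : gsupp E ⊆ gsupp (E.erase e) := by
    conv_lhs => rw [hS]
    apply closure_minimal _ (gsupp_closed _)
    intro y hy
    have hy' : y ∈ gsupp E := by rw [hS]; exact subset_closure hy
    obtain ⟨e', he', hye⟩ := mem_gsupp.1 hy'
    refine mem_gsupp.2 ⟨e', Finset.mem_erase.2 ⟨?_, he'⟩, hye⟩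
    rintro rfl
    exact hdis y hye hy.2
  obtain ⟨e', he', hxe'⟩ := mem_gsupp.1 (hsub (mem_gsupp.2 ⟨e, he, hx1⟩))
  rw [Finset.mem_erase] at he'
  have := (hPl e he e' he'.2 (Ne.symm he'.1) ⟨hx1, hxe'⟩).1
  have hne := (hE e he).1
  rcases this with h | h
  · rw [h] at hx; exact hne (left_mem_openSegment_iff.1 hx)
  · rw [Set.mem_singleton_iff] at h
    rw [h] at hx; exact hne (right_mem_openSegment_iff.1 hx)

theorem endpoint_of {Ω C : Set (ℝ × ℝ)} (hΩ : Body Ω) {E : Finset Seg} (hE : EdgeSet E)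
    (hPl : Planar E) (hS : gsupp E = closure (C ∩ interior Ω)) {v : ℝ × ℝ}
    (hv : v ∉ interior Ω ∨ IsVert E v) : ∀ e ∈ E, v ∈ seg e → e.1 = v ∨ e.2 = v := by
  intro e he hve
  rcases hv with hv | ⟨e', he', hv'⟩
  · rw [seg, ← insert_endpoints_openSegment] at hve
    rcases hve with h | h | h
    · exact Or.inl h.symm
    · exact Or.inr h.symm
    · exact absurd (edge_int hΩ hE hPl hS he h) hv
  · by_cases hee : e = e'
    · subst hee; exact hv'
    have hv'' : v ∈ seg e' := by
      rcases hv' with rfl | rfl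
      · exact left_mem_segment ℝ _ _
      · exact right_mem_segment ℝ _ _
    rcases (hPl e he e' he' hee ⟨hve, hv''⟩).1 with h | h
    · exact Or.inl h.symm
    · exact Or.inr (Set.mem_singleton_iff.1 h).symm

theorem contact_finite {Ω C : Set (ℝ × ℝ)} (hΩ : Body Ω) {E : Finset Seg} (hE : EdgeSet E)
    (hPl : Planar E) (hS : gsupp E = closure (C ∩ interior Ω)) :
    (gsupp E ∩ frontier Ω).Finite := by
  classical
  refine (E.finite_toSet.image Prod.fst |>.union (E.finite_toSet.image Prod.snd)).subset ?_
  rintro v ⟨hv, hvf⟩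
  obtain ⟨e, he, hve⟩ := mem_gsupp.1 hv
  rcases endpoint_of hΩ hE hPl hS (Or.inl (hΩ.mem_frontier.1 hvf).2) e he hve with h | h
  · exact Or.inl ⟨e, he, h⟩
  · exact Or.inr ⟨e, he, h⟩

/-! ### primitive vectors -/

theorem PrimOut.ne {d : ℝ × ℝ} {l : ℤ × ℤ} (h : PrimOut d l) : toR l ≠ 0 := by
  intro h0
  have h1 := congrArg Prod.fst h0
  have h2 := congrArg Prod.snd h0
  simp [toR] at h1 h2
  have := h.1
  rw [h1, h2] at this
  simp at this

theorem PrimOut.unique {d : ℝ × ℝ} {l l' : ℤ × ℤ} (h : PrimOut d l) (h' : PrimOut d l') :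
    l = l' := by
  obtain ⟨g, t, ht, e⟩ := h
  obtain ⟨g', t', ht', e'⟩ := h'
  have e1 : t * (l.1 : ℝ) = t' * l'.1 := by
    have := congrArg Prod.fst (e.symm.trans e'); simpa [toR] using this
  have e2 : t * (l.2 : ℝ) = t' * l'.2 := by
    have := congrArg Prod.snd (e.symm.trans e'); simpa [toR] using this
  have b := Int.gcd_eq_gcd_ab l.1 l.2
  have b' := Int.gcd_eq_gcd_ab l'.1 l'.2
  rw [g] at b; rw [g'] at b'
  set x := Int.gcdA l.1 l.2; set y := Int.gcdB l.1 l.2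
  set x' := Int.gcdA l'.1 l'.2; set y' := Int.gcdB l'.1 l'.2
  have bR : (1:ℝ) = l.1 * x + l.2 * y := by exact_mod_cast b
  have bR' : (1:ℝ) = l'.1 * x' + l'.2 * y' := by exact_mod_cast b'
  -- t = t' * k, t' = t * k'
  have k1 : t = t' * ((l'.1 * x + l'.2 * y : ℤ) : ℝ) := by
    push_cast; linear_combination t * bR + x * e1 + y * e2
  have k2 : t' = t * ((l.1 * x' + l.2 * y' : ℤ) : ℝ) := by
    push_cast; linear_combination t' * bR' - x' * e1 - y' * e2
  set k := l'.1 * x + l'.2 * y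
  set k' := l.1 * x' + l.2 * y'
  have hk : 0 < k := by
    have : (0:ℝ) < k := by
      by_contra hc; push Not at hc
      have := mul_nonpos_of_nonneg_of_nonpos ht'.le hc; linarith
    exact_mod_cast this
  have hkk : k * k' = 1 := by
    have : t' * 1 = t' * ((k:ℝ) * k') := by
      conv_lhs => rw [mul_one, k2, k1]
      ring
    have := mul_left_cancel₀ ht'.ne' this
    exact_mod_cast this.symm
  have hk1 : k = 1 := Int.eq_one_or_neg_one_of_mul_eq_one hkk |>.resolve_right (by omega)
  have tt : t = t' := by rw [k1, hk1]; simp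
  subst tt
  ext
  · exact_mod_cast mul_left_cancel₀ ht.ne' e1
  · exact_mod_cast mul_left_cancel₀ ht.ne' e2

theorem prim_spec {d : ℝ × ℝ} (h : RatDir d) : PrimOut d (prim d) := by
  unfold prim
  have h' : ∃ l, PrimOut d l := h
  rw [dif_pos h']
  exact h'.choose_spec

theorem prim_eq {d : ℝ × ℝ} {l : ℤ × ℤ} (h : PrimOut d l) : prim d = l :=
  (prim_spec ⟨l, h⟩).unique h

theorem PrimOut.neg {d : ℝ × ℝ} {l : ℤ × ℤ} (h : PrimOut d l) : PrimOut (-d) (-l) := by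
  obtain ⟨g, t, ht, e⟩ := h
  refine ⟨by simpa using g, t, ht, ?_⟩
  rw [e]; ext <;> simp [toR]

theorem prim_neg {d : ℝ × ℝ} (h : RatDir d) : prim (-d) = -prim d := prim_eq (prim_spec h).neg

theorem ratDir_lattice {w : ℤ × ℤ} (hw : w ≠ 0) : RatDir (toR w) := by
  have hg : 0 < Int.gcd w.1 w.2 := by
    rw [Nat.pos_iff_ne_zero, Ne, Int.gcd_eq_zero_iff]
    rintro ⟨h1, h2⟩; exact hw (Prod.ext h1 h2)
  refine ⟨(w.1 / Int.gcd w.1 w.2, w.2 / Int.gcd w.1 w.2), ?_, (Int.gcd w.1 w.2 : ℝ), by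
    exact_mod_cast hg, ?_⟩
  · exact Int.gcd_ediv_gcd_ediv_gcd hg
  · have h1 : ((Int.gcd w.1 w.2 : ℤ)) * (w.1 / Int.gcd w.1 w.2) = w.1 :=
      Int.mul_ediv_cancel' (Int.gcd_dvd_left ..)
    have h2 : ((Int.gcd w.1 w.2 : ℤ)) * (w.2 / Int.gcd w.1 w.2) = w.2 :=
      Int.mul_ediv_cancel' (Int.gcd_dvd_right ..)
    ext
    · simp only [toR, Prod.smul_mk, smul_eq_mul]; exact_mod_cast h1.symm
    · simp only [toR, Prod.smul_mk, smul_eq_mul]; exact_mod_cast h2.symm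

theorem side_ratDir {Ω : Set (ℝ × ℝ)} (h : IsLatticePolygon Ω) {a b : ℝ × ℝ} (hs : IsSide Ω a b) :
    RatDir (b - a) := by
  obtain ⟨w, hw⟩ := poly_ext h hs.2.1
  obtain ⟨w', hw'⟩ := poly_ext h hs.2.2.1
  have : b - a = toR (w' - w) := by rw [hw, hw']; ext <;> simp [toR]
  rw [this]
  apply ratDir_lattice
  intro h0
  apply hs.1
  rw [hw, hw', sub_eq_zero.1 h0]

theorem prim_annih {l a : ℤ × ℤ} (g : Int.gcd l.1 l.2 = 1) (h : a.1 * l.1 + a.2 * l.2 = 0) :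
    ∃ δ : ℤ, a = (-(δ * l.2), δ * l.1) := by
  have b := Int.gcd_eq_gcd_ab l.1 l.2
  rw [g] at b
  set x := Int.gcdA l.1 l.2; set y := Int.gcdB l.1 l.2
  refine ⟨x * a.2 - y * a.1, ?_⟩
  ext
  · show a.1 = _
    push_cast at b
    linear_combination a.1 * b + x * h
  · show a.2 = _
    push_cast at b
    linear_combination a.2 * b + y * h

/-! ### local form of the pairing -/

theorem enorm2_sq (l : ℝ × ℝ) : enorm2 l * enorm2 l = rho l := by
  unfold enorm2 rho
  exact Real.mul_self_sqrt (by positivity)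

theorem enorm2_smul {t : ℝ} (ht : 0 < t) (l : ℝ × ℝ) : enorm2 (t • l) = t * enorm2 l := by
  unfold enorm2
  have : (t • l).1 ^ 2 + (t • l).2 ^ 2 = t ^ 2 * (l.1 ^ 2 + l.2 ^ 2) := by simp; ring
  rw [this, Real.sqrt_mul (by positivity), Real.sqrt_sq ht.le]

theorem edge_term {a b : ℝ × ℝ} {l : ℤ × ℤ} (h : PrimOut (b - a) l) :
    ∃ τ : ℝ, 0 < τ ∧ b - a = τ • toR l ∧ ∀ ψ : ℝ × ℝ → ℝ,
      enorm2 (toR l) * segInt (a, b) ψ = rho (toR l) * ∫ s in (0:ℝ)..τ, ψ (a + s • toR l) := by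
  obtain ⟨g, t, ht, e⟩ := h
  refine ⟨t, ht, e, fun ψ => ?_⟩
  have h1 : t * ∫ s in (0:ℝ)..1, ψ (a + (s * t) • toR l) = ∫ s in (0:ℝ)..t, ψ (a + s • toR l) := by
    have := intervalIntegral.mul_integral_comp_mul_right (a := 0) (b := 1)
      (f := fun s => ψ (a + s • toR l)) t
    simpa using this
  unfold segInt
  show enorm2 (toR l) * (enorm2 (b - a) * ∫ s in (0:ℝ)..1, ψ (a + s • (b - a))) = _
  rw [← h1, e, enorm2_smul ht, ← enorm2_sq]
  simp only [smul_smul]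
  ring

theorem segInt_swap (e : Seg) (ψ : ℝ × ℝ → ℝ) : segInt (e.2, e.1) ψ = segInt e ψ := by
  unfold segInt
  have h1 : enorm2 (e.1 - e.2) = enorm2 (e.2 - e.1) := by
    unfold enorm2; congr 1; simp only [Prod.fst_sub, Prod.snd_sub]; ring
  have h2 := intervalIntegral.integral_comp_sub_left (a := 0) (b := 1)
    (fun t => ψ (e.1 + t • (e.2 - e.1))) 1
  simp only [sub_zero, sub_self] at h2
  show enorm2 (e.1 - e.2) * (∫ t in (0:ℝ)..1, ψ (e.2 + t • (e.1 - e.2))) = _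
  rw [h1, ← h2]
  congr 2
  funext t
  congr 1
  ext <;> simp <;> ring

theorem edge_ray {v b : ℝ × ℝ} {l : ℤ × ℤ} (h : PrimOut (b - v) l) :
    ∃ r > 0, ∀ ψ : ℝ × ℝ → ℝ, tsupport ψ ⊆ Metric.ball v r →
      enorm2 (toR l) * segInt (v, b) ψ =
        rho (toR l) * ∫ s in Set.Ioi (0:ℝ), ψ (v + s • toR l) := by
  obtain ⟨τ, hτ, e, H⟩ := edge_term h
  have hl : 0 < ‖toR l‖ := norm_pos_iff.2 h.ne
  refine ⟨τ * ‖toR l‖, by positivity, fun ψ hψ => ?_⟩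
  rw [H, intervalIntegral.integral_of_le hτ.le]
  congr 1
  symm
  apply setIntegral_eq_of_subset_of_forall_sdiff_eq_zero measurableSet_Ioi (fun x hx => hx.1)
  rintro s ⟨hs, hs'⟩
  by_contra hne
  have := hψ (subset_tsupport ψ (Function.mem_support.2 hne))
  rw [Metric.mem_ball, dist_eq_norm, add_sub_cancel_left, norm_smul, Real.norm_eq_abs,
    abs_of_pos hs] at this
  exact hs' ⟨hs, (lt_of_mul_lt_mul_right this hl.le).le⟩

theorem outDir_prim {E : Finset Seg} (hR : ∀ e ∈ E, RatDir (e.2 - e.1)) {v : ℝ × ℝ} {e : Seg}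
    (he : e ∈ E) (h : e.1 = v ∨ e.2 = v) :
    ∃ b, PrimOut (b - v) (outDir v e) ∧ b ∈ seg e ∧ (∀ ψ, segInt (v, b) ψ = segInt e ψ) ∧
      enorm2 (toR (prim (e.2 - e.1))) = enorm2 (toR (outDir v e)) := by
  by_cases h1 : e.1 = v
  · refine ⟨e.2, ?_, right_mem_segment ℝ _ _, ?_, ?_⟩
    · rw [outDir, if_pos h1, ← h1]; exact prim_spec (hR e he)
    · intro ψ; rw [← h1]
    · rw [outDir, if_pos h1]
  · have h2 := h.resolve_left h1
    refine ⟨e.1, ?_, left_mem_segment ℝ _ _, ?_, ?_⟩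
    · rw [outDir, if_neg h1, ← h2]
      apply prim_spec
      have := (prim_spec (hR e he)).neg
      rw [neg_sub] at this
      exact ⟨_, this⟩
    · intro ψ; rw [← h2, segInt_swap]
    · rw [outDir, if_neg h1, ← neg_sub e.2 e.1, prim_neg (hR e he)]
      unfold enorm2; congr 1; simp [toR]

theorem segInt_zero {e : Seg} {ψ : ℝ × ℝ → ℝ} (h : ∀ x ∈ seg e, ψ x = 0) : segInt e ψ = 0 := by
  unfold segInt
  rw [intervalIntegral.integral_of_le zero_le_one]
  rw [setIntegral_eq_zero_of_forall_eq_zero, mul_zero]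
  intro t ht
  apply h
  rw [seg, segment_eq_image']
  exact ⟨t, ⟨ht.1.le, ht.2⟩, rfl⟩

open Classical in
theorem local_pairing {E : Finset Seg} (m : Seg → ℕ) (hR : ∀ e ∈ E, RatDir (e.2 - e.1))
    {v : ℝ × ℝ} (hv : ∀ e ∈ E, v ∈ seg e → e.1 = v ∨ e.2 = v) :
    ∃ r > 0, ∀ ψ : ℝ × ℝ → ℝ, tsupport ψ ⊆ Metric.ball v r →
      tropPairing E m ψ = ∑ e ∈ E.filter (fun e => e.1 = v ∨ e.2 = v),
        (m e : ℝ) * rho (toR (outDir v e)) * ∫ s in Set.Ioi (0:ℝ), ψ (v + s • toR (outDir v e)) := by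
  have hloc : ∀ e ∈ E, ∃ r > 0, ∀ ψ : ℝ × ℝ → ℝ, tsupport ψ ⊆ Metric.ball v r →
      enorm2 (toR (prim (e.2 - e.1))) * (m e : ℝ) * segInt e ψ =
        if e.1 = v ∨ e.2 = v then
        (m e : ℝ) * rho (toR (outDir v e)) * ∫ s in Set.Ioi (0:ℝ), ψ (v + s • toR (outDir v e))
        else 0 := by
    intro e he
    by_cases h : e.1 = v ∨ e.2 = v
    · obtain ⟨b, hb, -, hs, hn⟩ := outDir_prim hR he h
      obtain ⟨r, hr, H⟩ := edge_ray hb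
      refine ⟨r, hr, fun ψ hψ => ?_⟩
      have := H ψ hψ
      rw [if_pos h, hn, ← hs]
      linear_combination (m e : ℝ) * this
    · have hvs : v ∉ seg e := fun hh => h (hv e he hh)
      obtain ⟨r, hr, H⟩ := Metric.isOpen_iff.1 (seg_closed e.1 e.2).isOpen_compl v hvs
      refine ⟨r, hr, fun ψ hψ => ?_⟩
      rw [if_neg h, segInt_zero, mul_zero]
      intro x hx
      by_contra hne
      exact H (hψ (subset_tsupport ψ (Function.mem_support.2 hne))) hx
  choose! r hr H using hloc
  obtain ⟨ρ, hρ, hρr⟩ : ∃ ρ > 0, ∀ e ∈ E, ρ ≤ r e := by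
    rcases E.eq_empty_or_nonempty with rfl | hne
    · exact ⟨1, one_pos, by simp⟩
    · obtain ⟨e, he, hm⟩ := E.exists_min_image r hne
      exact ⟨r e, hr e he, hm⟩
  refine ⟨ρ, hρ, fun ψ hψ => ?_⟩
  rw [tropPairing, Finset.sum_filter]
  exact Finset.sum_congr rfl fun e he => H e he ψ (hψ.trans (Metric.ball_subset_ball (hρr e he)))

/-- The odometer data at scale `N`. -/
structure Odo (Ω : Set (ℝ × ℝ)) (P : Finset (ℝ × ℝ)) (N : ℕ) (φ : V → ℤ) (H : V → ℤ) : Prop where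
  nonneg : ∀ v, 0 ≤ H v
  off : ∀ v, v ∉ latGrid Ω N → H v = 0
  eq : ∀ v ∈ latGrid Ω N, φ v = stateN Ω P N v + lapZ H v
  le : ∀ v ∈ latGrid Ω N, φ v ≤ 3
  least : ∀ G : V → ℤ, (∀ v, 0 ≤ G v) → (∀ v ∈ latGrid Ω N, stateN Ω P N v + lapZ G v ≤ 3) →
    ∀ v, H v ≤ G v

theorem exists_odo {Ω : Set (ℝ × ℝ)} {P : Finset (ℝ × ℝ)} {N : ℕ} {φ : V → ℤ}
    (h : Relaxes (latGrid Ω N) (stateN Ω P N) φ) : ∃ H, Odo Ω P N φ H := by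
  obtain ⟨H, h1, h2, h3, h4, h5⟩ := odometer _ _ _ h
  exact ⟨H, h1, h2, h3, h4, h5⟩

theorem flr_le (N : ℕ) (x : ℝ × ℝ) : ((flr N x).1 : ℝ) ≤ N * x.1 ∧ (N * x.1 : ℝ) < (flr N x).1 + 1 ∧
    ((flr N x).2 : ℝ) ≤ N * x.2 ∧ (N * x.2 : ℝ) < (flr N x).2 + 1 :=
  ⟨Int.floor_le _, Int.lt_floor_add_one _, Int.floor_le _, Int.lt_floor_add_one _⟩

theorem mem_latGrid {Ω : Set (ℝ × ℝ)} {N : ℕ} (hN : 1 ≤ N) {v : V} :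
    v ∈ latGrid Ω N ↔ (((v.1 : ℝ) / N, (v.2 : ℝ) / N) : ℝ × ℝ) ∈ Ω := by
  have hN' : (N : ℝ) ≠ 0 := by positivity
  unfold latGrid
  rw [Set.mem_ofPred_eq, Set.mem_smul_set_iff_inv_smul_mem₀ hN']
  have : (N : ℝ)⁻¹ • toR v = ((v.1 : ℝ) / N, (v.2 : ℝ) / N) := by
    ext <;> simp [toR] <;> field_simp
  rw [this]

theorem barrier {Ω : Set (ℝ × ℝ)} (hΩ : Body Ω) {P : Finset (ℝ × ℝ)} (hP : ↑P ⊆ interior Ω)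
    {n : ℤ × ℤ} (hn : n ≠ 0) {c : ℤ} (hc : ∀ x ∈ Ω, (c : ℝ) ≤ dot (toR n) x) :
    ∃ A K : ℤ, 0 ≤ A ∧ 0 ≤ K ∧ ∀ N : ℕ, 1 ≤ N → ∀ φ H, Odo Ω P N φ H → ∀ v ∈ latGrid Ω N,
      H v ≤ A * N ∧ H v ≤ K * (n.1 * v.1 + n.2 * v.2 - N * c + (|n.1| + |n.2|)) := by
  obtain ⟨R, hR⟩ := hΩ.cpt.isBounded.exists_norm_le
  set A : ℤ := 2 * ⌈R⌉ + 2 with hA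
  have hR0 : 0 ≤ R := by
    obtain ⟨x, hx⟩ := hΩ.int
    exact (norm_nonneg _).trans (hR x (interior_subset hx))
  have hA0 : 0 ≤ A := by have := Int.ceil_nonneg hR0; omega
  have hnR : toR n ≠ 0 := by
    intro h0; apply hn
    have h1 := congrArg Prod.fst h0
    have h2 := congrArg Prod.snd h0
    simp [toR] at h1 h2
    exact Prod.ext h1 h2
  obtain ⟨K, hK0, hK⟩ : ∃ K : ℤ, 0 ≤ K ∧ ∀ p ∈ P, (A : ℝ) ≤ K * (dot (toR n) p - c) := by
    have hpos : ∀ p ∈ P, 0 < dot (toR n) p - c := fun p hp =>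
      sub_pos.2 (min_interior hnR hc (hP hp))
    refine ⟨∑ p ∈ P, ⌈(A : ℝ) / (dot (toR n) p - c)⌉, ?_, ?_⟩
    · apply Finset.sum_nonneg
      intro p hp
      exact Int.ceil_nonneg (div_nonneg (by exact_mod_cast hA0) (hpos p hp).le)
    · intro p hp
      rw [← div_le_iff₀ (hpos p hp)]
      refine (Int.le_ceil _).trans ?_
      exact_mod_cast Finset.single_le_sum (f := fun p => ⌈(A : ℝ) / (dot (toR n) p - c)⌉)
        (fun p hp => Int.ceil_nonneg (div_nonneg (by exact_mod_cast hA0) (hpos p hp).le)) hp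
  refine ⟨P.card * A, P.card * K, by positivity, by positivity, fun N hN φ H hH => ?_⟩
  set C : ℤ := |n.1| + |n.2| with hC
  set g : V → ℤ := fun v => K * (n.1 * v.1 + n.2 * v.2 - N * c + C) with hg
  set f : ℝ × ℝ → V → ℤ := fun p v => A * N - |v.1 - (flr N p).1| with hf
  have hNR : (1:ℝ) ≤ N := by exact_mod_cast hN
  -- points near Γ
  have near : ∀ v ∈ latGrid Ω N, ∀ w : V, |w.1 - v.1| + |w.2 - v.2| ≤ 1 →
      0 ≤ g w ∧ ∀ p ∈ P, 0 ≤ f p w := by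
    intro v hv w hw
    rw [mem_latGrid hN] at hv
    have h1 := hc _ hv
    have h2 := hR _ hv
    constructor
    · have : (N * c : ℝ) ≤ n.1 * v.1 + n.2 * v.2 := by
        simp only [dot, toR] at h1
        have e : (n.1 : ℝ) * (v.1 / N) + n.2 * (v.2 / N) = (n.1 * v.1 + n.2 * v.2) / N := by
          field_simp
        rw [e, le_div_iff₀ (by linarith)] at h1
        linarith
      have h3 : N * c ≤ n.1 * v.1 + n.2 * v.2 := by exact_mod_cast this
      apply mul_nonneg hK0
      have h4 : |n.1 * (w.1 - v.1)| ≤ |n.1| := by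
        rw [abs_mul]
        have : |w.1 - v.1| ≤ 1 := by have := abs_nonneg (w.2 - v.2); linarith
        nlinarith [abs_nonneg n.1]
      have h5 : |n.2 * (w.2 - v.2)| ≤ |n.2| := by
        rw [abs_mul]
        have : |w.2 - v.2| ≤ 1 := by have := abs_nonneg (w.1 - v.1); linarith
        nlinarith [abs_nonneg n.2]
      have h6 := neg_abs_le (n.1 * (w.1 - v.1))
      have h7 := neg_abs_le (n.2 * (w.2 - v.2))
      have : n.1 * w.1 + n.2 * w.2 - N * c + C =
        (n.1 * v.1 + n.2 * v.2 - N * c) + n.1 * (w.1 - v.1) + n.2 * (w.2 - v.2) + C := by ring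
      rw [this, hC]; linarith
    · intro p hp
      have h3 := hR p (interior_subset (hP hp))
      have a1 : |(v.1 : ℝ) / N| ≤ R := (norm_fst_le (((v.1 : ℝ) / N, (v.2 : ℝ) / N) : ℝ × ℝ)).trans h2
      have a2 : |p.1| ≤ R := (norm_fst_le p).trans h3
      rw [abs_le] at a1 a2
      have b1 : (v.1 : ℝ) ≤ R * N := by rw [← div_le_iff₀ (by linarith)]; exact a1.2
      have b2 : -R * N ≤ v.1 := by rw [← le_div_iff₀ (by linarith)]; exact a1.1
      obtain ⟨f1, f2, -, -⟩ := flr_le N p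
      have c1 : (N:ℝ) * p.1 ≤ R * N := by nlinarith
      have c2 : -R * N ≤ N * p.1 := by nlinarith
      have hw1 : |w.1 - v.1| ≤ 1 := by have := abs_nonneg (w.2 - v.2); linarith
      have hc1 : R ≤ ⌈R⌉ := Int.le_ceil R
      have hc2 : R * N ≤ ⌈R⌉ * N := by nlinarith
      have : (|w.1 - (flr N p).1| : ℝ) ≤ A * N := by
        rw [abs_le] at hw1
        have w1 : (w.1 - v.1 : ℝ) ≤ 1 := by exact_mod_cast hw1.2
        have w2 : (-1 : ℝ) ≤ w.1 - v.1 := by exact_mod_cast hw1.1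
        rw [hA, abs_le]; push_cast
        constructor <;> nlinarith
      have : |w.1 - (flr N p).1| ≤ A * N := by exact_mod_cast this
      simp only [hf]; linarith
  have hGbound := hH.least (fun v => ∑ p ∈ P, max 0 (min (f p v) (g v)))
    (fun v => Finset.sum_nonneg fun p _ => le_max_left _ _) (by
    intro v hv
    have hst : stateN Ω P N v = 3 + ∑ p ∈ P, (if v = flr N p then 1 else 0) := by
      unfold stateN; rw [if_pos hv]
    have hlap : lapZ (fun v => ∑ p ∈ P, max 0 (min (f p v) (g v))) v =
        ∑ p ∈ P, lapZ (fun v => max 0 (min (f p v) (g v))) v := by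
      simp only [lapZ, Finset.mul_sum, ← Finset.sum_add_distrib, ← Finset.sum_sub_distrib]
    rw [hst, hlap, add_assoc, ← Finset.sum_add_distrib]
    have : ∑ p ∈ P, ((if v = flr N p then (1:ℤ) else 0) +
        lapZ (fun v => max 0 (min (f p v) (g v))) v) ≤ 0 := by
      apply Finset.sum_nonpos
      intro p hp
      have e : ∀ w : V, |w.1 - v.1| + |w.2 - v.2| ≤ 1 →
          max 0 (min (f p w) (g w)) = min (f p w) (g w) := by
        intro w hw
        obtain ⟨g1, g2⟩ := near v hv w hw
        exact max_eq_right (le_min (g2 p hp) g1)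
      have e0 := e v (by simp)
      have e1 := e (v.1 + 1, v.2) (by simp)
      have e2 := e (v.1 - 1, v.2) (by simp)
      have e3 := e (v.1, v.2 + 1) (by simp)
      have e4 := e (v.1, v.2 - 1) (by simp)
      have hl : lapZ (fun v => max 0 (min (f p v) (g v))) v = lapZ (fun v => min (f p v) (g v)) v := by
        simp only [lapZ, e0, e1, e2, e3, e4]
      rw [hl]
      have m1 : ∀ w, min (f p w) (g w) ≤ f p w := fun w => min_le_left _ _
      have m2 : ∀ w, min (f p w) (g w) ≤ g w := fun w => min_le_right _ _
      have lf : lapZ (fun v => min (f p v) (g v)) v ≤ lapZ (f p) v + 4 * (f p v - min (f p v) (g v)) := by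
        have := m1 (v.1 + 1, v.2); have := m1 (v.1 - 1, v.2)
        have := m1 (v.1, v.2 + 1); have := m1 (v.1, v.2 - 1)
        simp only [lapZ]; linarith
      have lg : lapZ (fun v => min (f p v) (g v)) v ≤ lapZ g v + 4 * (g v - min (f p v) (g v)) := by
        have := m2 (v.1 + 1, v.2); have := m2 (v.1 - 1, v.2)
        have := m2 (v.1, v.2 + 1); have := m2 (v.1, v.2 - 1)
        simp only [lapZ]; linarith
      have lg0 : lapZ g v = 0 := by simp only [lapZ, hg]; ring
      have lf0 : lapZ (f p) v = 2 * |v.1 - (flr N p).1| - |v.1 + 1 - (flr N p).1| - |v.1 - 1 - (flr N p).1| := by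
        simp only [lapZ, hf]; ring
      have lf1 : lapZ (f p) v ≤ 0 := by
        rw [lf0]
        have := abs_add_le (v.1 + 1 - (flr N p).1) (v.1 - 1 - (flr N p).1)
        rw [show v.1 + 1 - (flr N p).1 + (v.1 - 1 - (flr N p).1) = 2 * (v.1 - (flr N p).1) by ring,
          abs_mul] at this
        norm_num at this
        linarith
      by_cases hvp : v = flr N p
      · rw [if_pos hvp]
        have lf2 : lapZ (f p) v = -2 := by
          rw [lf0, hvp]; simp
        have hfg : f p v ≤ g v := by
          have hfv : f p v = A * N := by simp only [hf, hvp, sub_self, abs_zero, sub_zero]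
          rw [hfv]
          obtain ⟨f1, f2, f3, f4⟩ := flr_le N p
          rw [← hvp] at f1 f2 f3 f4
          have hk := hK p hp
          have h1 : (n.1 : ℝ) * (N * p.1) - |(n.1 : ℝ)| ≤ n.1 * v.1 := by
            have : (n.1 : ℝ) * (N * p.1 - v.1) ≤ |(n.1 : ℝ)| * 1 := by
              refine (le_abs_self _).trans ?_
              rw [abs_mul]
              apply mul_le_mul_of_nonneg_left _ (abs_nonneg _)
              rw [abs_le]; constructor <;> linarith
            linarith
          have h2 : (n.2 : ℝ) * (N * p.2) - |(n.2 : ℝ)| ≤ n.2 * v.2 := by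
            have : (n.2 : ℝ) * (N * p.2 - v.2) ≤ |(n.2 : ℝ)| * 1 := by
              refine (le_abs_self _).trans ?_
              rw [abs_mul]
              apply mul_le_mul_of_nonneg_left _ (abs_nonneg _)
              rw [abs_le]; constructor <;> linarith
            linarith
          have : (A * N : ℝ) ≤ K * (n.1 * v.1 + n.2 * v.2 - N * c + (|(n.1:ℝ)| + |(n.2:ℝ)|)) := by
            calc (A * N : ℝ) ≤ (K * (dot (toR n) p - c)) * N :=
                  mul_le_mul_of_nonneg_right hk (by linarith)
              _ = K * (n.1 * (N * p.1) + n.2 * (N * p.2) - N * c) := by simp only [dot, toR]; ring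
              _ ≤ _ := by
                  apply mul_le_mul_of_nonneg_left _ (by exact_mod_cast hK0)
                  linarith
          simp only [hg, hC]
          exact_mod_cast this
        rw [min_eq_left hfg] at lf
        linarith
      · rw [if_neg hvp]
        rcases le_total (f p v) (g v) with h | h
        · rw [min_eq_left h] at lf; linarith
        · rw [min_eq_right h] at lg; linarith
    linarith)
  intro v hv
  obtain ⟨g1, g2⟩ := near v hv v (by simp)
  have hb := hGbound v
  constructor
  · refine hb.trans ((Finset.sum_le_card_nsmul P _ (A * N) fun p hp => ?_).trans ?_)
    · refine max_le (by positivity) ((min_le_left _ _).trans ?_)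
      simp only [hf]; have := abs_nonneg (v.1 - (flr N p).1); linarith
    · rw [nsmul_eq_mul]; apply le_of_eq; ring
  · refine hb.trans ((Finset.sum_le_card_nsmul P _ (g v) fun p hp => ?_).trans ?_)
    · exact max_le g1 (min_le_right _ _)
    · rw [nsmul_eq_mul]; apply le_of_eq; simp only [hg]; ring

/-- the domain where the limit is locally affine -/
def dom (Ω : Set (ℝ × ℝ)) (P : Finset (ℝ × ℝ)) (E : Finset Seg) : Set (ℝ × ℝ) :=
  interior Ω \ (gsupp E ∪ ↑P)

structure Ctx (Ω : Set (ℝ × ℝ)) (P : Finset (ℝ × ℝ)) (φ : ℕ → V → ℤ) (C : Set (ℝ × ℝ))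
    (E : Finset Seg) (H : ℕ → V → ℤ) : Prop where
  poly : IsLatticePolygon Ω
  hP : ↑P ⊆ interior Ω
  hPn : P.Nonempty
  odo : ∀ N, Odo Ω P N (φ N) (H N)
  hC : Filter.Tendsto (fun N => EMetric.hausdorffEdist (devSet Ω N (φ N)) C)
      Filter.atTop (nhds 0)
  hS : gsupp E = closure (C ∩ interior Ω)

theorem dom_open (Ω : Set (ℝ × ℝ)) (P : Finset (ℝ × ℝ)) (E : Finset Seg) : IsOpen (dom Ω P E) :=
  isOpen_interior.sdiff ((gsupp_closed E).union P.finite_toSet.isClosed)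

theorem sup_lt {x y : ℝ × ℝ} {r : ℝ} (h1 : |x.1 - y.1| < r) (h2 : |x.2 - y.2| < r) :
    x ∈ Metric.ball y r := by
  rw [Metric.mem_ball, dist_eq_norm, Prod.norm_def]
  exact max_lt h1 h2

theorem sup_of {x y : ℝ × ℝ} {r : ℝ} (h : x ∈ Metric.ball y r) :
    |x.1 - y.1| < r ∧ |x.2 - y.2| < r := by
  rw [Metric.mem_ball, dist_eq_norm, Prod.norm_def] at h
  exact max_lt_iff.1 h

/-- near a point of the domain the odometer is harmonic at scale `N` -/
theorem harm {Ω : Set (ℝ × ℝ)} {P : Finset (ℝ × ℝ)} {φ : ℕ → V → ℤ} {C : Set (ℝ × ℝ)}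
    {E : Finset Seg} {H : ℕ → V → ℤ} (c : Ctx Ω P φ C E H) {x : ℝ × ℝ} {r : ℝ} (hr : 0 < r)
    (hx : Metric.ball x r ⊆ dom Ω P E) :
    ∀ᶠ N : ℕ in atTop, ∀ w : V, |(w.1 : ℝ) - N * x.1| ≤ r / 2 * N → |(w.2 : ℝ) - N * x.2| ≤ r / 2 * N →
      lapZ (H N) w = 0 := by
  have e1 : ∀ᶠ N in atTop, EMetric.hausdorffEdist (devSet Ω N (φ N)) C < ENNReal.ofReal (r / 4) :=
    c.hC.eventually_lt_const (by simpa using hr)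
  have e2 : ∀ᶠ N : ℕ in atTop, 4 / r < N := tendsto_natCast_atTop_atTop.eventually_gt_atTop _
  filter_upwards [e1, e2, eventually_ge_atTop 1] with N h1 h2 hN w hw1 hw2
  have hNR : (0:ℝ) < N := by exact_mod_cast hN
  have hNr : 1 < r / 4 * N := by
    rw [div_lt_iff₀ hr] at h2; linarith
  set y : ℝ × ℝ := ((w.1 : ℝ) / N, (w.2 : ℝ) / N) with hy
  have y1 : |y.1 - x.1| ≤ r / 2 := by
    have : y.1 - x.1 = (w.1 - N * x.1) / N := by simp only [hy]; field_simp
    rw [this, abs_div, abs_of_pos hNR, div_le_iff₀ hNR]; exact hw1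
  have y2 : |y.2 - x.2| ≤ r / 2 := by
    have : y.2 - x.2 = (w.2 - N * x.2) / N := by simp only [hy]; field_simp
    rw [this, abs_div, abs_of_pos hNR, div_le_iff₀ hNR]; exact hw2
  have hyU : y ∈ dom Ω P E := hx (sup_lt (by linarith) (by linarith))
  have hwΓ : w ∈ latGrid Ω N := (mem_latGrid hN).2 (interior_subset hyU.1)
  have hst : stateN Ω P N w = 3 := by
    unfold stateN
    rw [if_pos hwΓ, Finset.sum_eq_zero, add_zero]
    intro p hp
    rw [if_neg]
    rintro rfl
    obtain ⟨f1, f2, f3, f4⟩ := flr_le N p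
    have p1 : |p.1 - y.1| ≤ r / 4 := by
      have : p.1 - y.1 = (N * p.1 - (flr N p).1) / N := by simp only [hy]; field_simp
      rw [this, abs_div, abs_of_pos hNR, div_le_iff₀ hNR, abs_of_nonneg (by linarith)]; linarith
    have p2 : |p.2 - y.2| ≤ r / 4 := by
      have : p.2 - y.2 = (N * p.2 - (flr N p).2) / N := by simp only [hy]; field_simp
      rw [this, abs_div, abs_of_pos hNR, div_le_iff₀ hNR, abs_of_nonneg (by linarith)]; linarith
    have : p ∈ Metric.ball x r := by
      rw [abs_le] at y1 y2 p1 p2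
      apply sup_lt <;> rw [abs_lt] <;> constructor <;> linarith
    exact (hx this).2 (Or.inr hp)
  have hle := (c.odo N).le w hwΓ
  have heq := (c.odo N).eq w hwΓ
  have hge : 3 ≤ φ N w := by
    by_contra hlt
    push Not at hlt
    have hyd : y ∈ devSet Ω N (φ N) := ⟨w, hwΓ, hlt, rfl⟩
    obtain ⟨z, hz, hyz⟩ := Metric.exists_edist_lt_of_hausdorffEDist_lt hyd h1
    rw [edist_dist, ENNReal.ofReal_lt_ofReal_iff (by linarith)] at hyz
    have hzb : z ∈ Metric.ball x r := by
      rw [dist_comm] at hyz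
      obtain ⟨z1, z2⟩ := sup_of (Metric.mem_ball.2 hyz)
      rw [abs_le] at y1 y2
      rw [abs_lt] at z1 z2
      apply sup_lt <;> rw [abs_lt] <;> constructor <;> linarith
    have hzU := hx hzb
    exact hzU.2 (Or.inl (by rw [c.hS]; exact subset_closure ⟨hz, hzU.1⟩))
  rw [hst] at heq
  omega

theorem local_affine {Ω : Set (ℝ × ℝ)} {P : Finset (ℝ × ℝ)} {φ : ℕ → V → ℤ} {C : Set (ℝ × ℝ)}
    {E : Finset Seg} {H : ℕ → V → ℤ} (c : Ctx Ω P φ C E H) {A : ℤ}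
    (hA : ∀ N : ℕ, 1 ≤ N → ∀ v, H N v ≤ A * N) {x : ℝ × ℝ} (hx : x ∈ dom Ω P E) :
    ∃ ε > 0, Metric.ball x ε ⊆ dom Ω P E ∧ ∃ B : ℤ, ∀ᶠ N : ℕ in atTop, ∃ a b : ℤ, |a| ≤ B ∧ |b| ≤ B ∧
      ∀ y ∈ Metric.ball x ε, H N (flr N y) = H N (flr N x) +
        a * ((flr N y).1 - (flr N x).1) + b * ((flr N y).2 - (flr N x).2) := by
  obtain ⟨r, hr, hball⟩ := Metric.isOpen_iff.1 (dom_open Ω P E) x hx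
  refine ⟨r / 8, by linarith, (Metric.ball_subset_ball (by linarith)).trans hball,
    ⌈(A:ℝ) / (r / 8)⌉, ?_⟩
  have e2 : ∀ᶠ N : ℕ in atTop, 64 / r < N := tendsto_natCast_atTop_atTop.eventually_gt_atTop _
  have e3 : ∀ᶠ N : ℕ in atTop, 16 * A / (r / 8) ^ 2 < N :=
    tendsto_natCast_atTop_atTop.eventually_gt_atTop _
  filter_upwards [harm c hr hball, e2, e3, eventually_ge_atTop 1] with N hh h2 h3 hN
  have hNR : (0:ℝ) < N := by exact_mod_cast hN
  have hNr : 64 < r * N := by rw [div_lt_iff₀ hr] at h2; linarith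
  have h3' : 16 * A < (r / 8) ^ 2 * N := by
    rw [div_lt_iff₀ (by positivity)] at h3; linarith
  set K : ℤ := ⌈r / 8 * N⌉ with hK
  have k1 : r / 8 * N ≤ K := Int.le_ceil _
  have k2 : (K:ℝ) < r / 8 * N + 1 := Int.ceil_lt_add_one _
  have hK1 : 1 ≤ K := by
    have : (0:ℝ) < K := by linarith
    have : 0 < K := by exact_mod_cast this
    omega
  set v := flr N x with hv
  obtain ⟨f1, f2, f3, f4⟩ := flr_le N x
  rw [← hv] at f1 f2 f3 f4
  have hb : ∀ w, |(H N w : ℝ)| ≤ A * N := by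
    intro w
    have h0 : (0:ℝ) ≤ H N w := by exact_mod_cast (c.odo N).nonneg w
    rw [abs_of_nonneg h0]
    exact_mod_cast hA N hN w
  obtain ⟨a, b, hab⟩ := rigidity (H N) v K (K + 1) hK1 (A * N) (by
      have : (r / 8 * N) ^ 2 ≤ (K:ℝ) ^ 2 := pow_le_pow_left₀ (by positivity) k1 2
      nlinarith) (fun x y _ _ => hb _) (by
      intro p q hp hq
      have hp' : |(p:ℝ)| ≤ 3 * K + 1 := by
        have : |p| ≤ 3 * K + 1 := by omega
        exact_mod_cast this
      have hq' : |(q:ℝ)| ≤ 3 * K + 1 := by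
        have : |q| ≤ 3 * K + 1 := by omega
        exact_mod_cast this
      rw [abs_le] at hp' hq'
      apply hh
      · push_cast; rw [abs_le]; constructor <;> linarith
      · push_cast; rw [abs_le]; constructor <;> linarith)
  have hK0 : (0:ℝ) < K := by linarith
  have slope : ∀ a : ℤ, |(a:ℝ) * K| ≤ A * N → |a| ≤ ⌈(A:ℝ) / (r / 8)⌉ := by
    intro a ha
    rw [abs_mul, abs_of_pos hK0] at ha
    have h4 : |(a:ℝ)| * (r / 8 * N) ≤ A * N :=
      (mul_le_mul_of_nonneg_left k1 (abs_nonneg _)).trans ha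
    have h5 : |(a:ℝ)| ≤ A / (r / 8) := by
      rw [le_div_iff₀ (by linarith)]
      have : (|(a:ℝ)| * (r / 8)) * N ≤ A * N := by linarith
      exact le_of_mul_le_mul_right this hNR
    have := h5.trans (Int.le_ceil _)
    exact_mod_cast this
  have diffb : ∀ w w', |(H N w : ℝ) - H N w'| ≤ A * N := by
    intro w w'
    have h0 : (0:ℝ) ≤ H N w := by exact_mod_cast (c.odo N).nonneg w
    have h0' : (0:ℝ) ≤ H N w' := by exact_mod_cast (c.odo N).nonneg w'
    have h1 := le_of_abs_le (hb w)
    have h1' := le_of_abs_le (hb w')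
    rw [abs_le]; constructor <;> linarith
  refine ⟨a, b, slope a ?_, slope b ?_, ?_⟩
  · have := hab K 0 (by rw [abs_of_pos (by omega)]; omega) (by simp; omega)
    have h' : ((a:ℝ) * K) = H N (v.1 + K, v.2 + 0) - H N v := by rw [this]; push_cast; ring
    rw [h']; exact diffb _ _
  · have := hab 0 K (by simp; omega) (by rw [abs_of_pos (by omega)]; omega)
    have h' : ((b:ℝ) * K) = H N (v.1 + 0, v.2 + K) - H N v := by rw [this]; push_cast; ring
    rw [h']; exact diffb _ _
  · intro y hy
    obtain ⟨y1, y2⟩ := sup_of hy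
    obtain ⟨g1, g2, g3, g4⟩ := flr_le N y
    set u := flr N y
    have yy1 : |N * y.1 - N * x.1| ≤ r / 8 * N := by
      rw [← mul_sub, abs_mul, abs_of_pos hNR, mul_comm]
      exact mul_le_mul_of_nonneg_right y1.le hNR.le
    have yy2 : |N * y.2 - N * x.2| ≤ r / 8 * N := by
      rw [← mul_sub, abs_mul, abs_of_pos hNR, mul_comm]
      exact mul_le_mul_of_nonneg_right y2.le hNR.le
    rw [abs_le] at yy1 yy2
    have := hab (u.1 - v.1) (u.2 - v.2) (by
      have : |((u.1 - v.1 : ℤ) : ℝ)| ≤ ((K + 1 : ℤ) : ℝ) := by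
        push_cast; rw [abs_le]; constructor <;> linarith
      exact_mod_cast this) (by
      have : |((u.2 - v.2 : ℤ) : ℝ)| ≤ ((K + 1 : ℤ) : ℝ) := by
        push_cast; rw [abs_le]; constructor <;> linarith
      exact_mod_cast this)
    have e : (v.1 + (u.1 - v.1), v.2 + (u.2 - v.2)) = u := by ext <;> simp
    rw [e] at this
    exact this

/-- the rescaled odometer -/
noncomputable def gN (H : ℕ → V → ℤ) (N : ℕ) (x : ℝ × ℝ) : ℝ := (H N (flr N x) : ℝ) / N

theorem flr_div (N : ℕ) (hN : 1 ≤ N) (x : ℝ × ℝ) :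
    |((flr N x).1 : ℝ) / N - x.1| ≤ 1 / N ∧ |((flr N x).2 : ℝ) / N - x.2| ≤ 1 / N := by
  have hNR : (0:ℝ) < N := by exact_mod_cast hN
  obtain ⟨f1, f2, f3, f4⟩ := flr_le N x
  constructor
  · have : ((flr N x).1 : ℝ) / N - x.1 = ((flr N x).1 - N * x.1) / N := by field_simp
    rw [this, abs_div, abs_of_pos hNR]
    gcongr
    rw [abs_le]; constructor <;> linarith
  · have : ((flr N x).2 : ℝ) / N - x.2 = ((flr N x).2 - N * x.2) / N := by field_simp
    rw [this, abs_div, abs_of_pos hNR]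
    gcongr
    rw [abs_le]; constructor <;> linarith

theorem flr_tendsto (x : ℝ × ℝ) :
    Tendsto (fun N : ℕ => ((flr N x).1 : ℝ) / N) atTop (𝓝 x.1) ∧
    Tendsto (fun N : ℕ => ((flr N x).2 : ℝ) / N) atTop (𝓝 x.2) := by
  constructor
  · rw [tendsto_iff_dist_tendsto_zero]
    refine squeeze_zero' (Eventually.of_forall fun _ => dist_nonneg) ?_
      tendsto_one_div_atTop_nhds_zero_nat
    filter_upwards [eventually_ge_atTop 1] with N hN
    exact (flr_div N hN x).1
  · rw [tendsto_iff_dist_tendsto_zero]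
    refine squeeze_zero' (Eventually.of_forall fun _ => dist_nonneg) ?_
      tendsto_one_div_atTop_nhds_zero_nat
    filter_upwards [eventually_ge_atTop 1] with N hN
    exact (flr_div N hN x).2

theorem gN_nonneg {Ω : Set (ℝ × ℝ)} {P : Finset (ℝ × ℝ)} {φ : ℕ → V → ℤ} {C : Set (ℝ × ℝ)}
    {E : Finset Seg} {H : ℕ → V → ℤ} (c : Ctx Ω P φ C E H) (N : ℕ) (x : ℝ × ℝ) : 0 ≤ gN H N x := by
  have : (0:ℝ) ≤ H N (flr N x) := by exact_mod_cast (c.odo N).nonneg _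
  unfold gN; positivity

theorem gN_le {H : ℕ → V → ℤ} {A : ℤ} (hA0 : 0 ≤ A)
    (hA : ∀ N : ℕ, 1 ≤ N → ∀ v, H N v ≤ A * N) (N : ℕ) (x : ℝ × ℝ) : gN H N x ≤ A := by
  unfold gN
  rcases Nat.eq_zero_or_pos N with h | h
  · subst h; simp; exact_mod_cast hA0
  · have hNR : (0:ℝ) < N := by exact_mod_cast h
    rw [div_le_iff₀ hNR]
    exact_mod_cast hA N h _

theorem g_close {Ω : Set (ℝ × ℝ)} {P : Finset (ℝ × ℝ)} {φ : ℕ → V → ℤ} {C : Set (ℝ × ℝ)}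
    {E : Finset Seg} {H : ℕ → V → ℤ} (c : Ctx Ω P φ C E H) {A : ℤ}
    (hA : ∀ N : ℕ, 1 ≤ N → ∀ v, H N v ≤ A * N) {x : ℝ × ℝ} (hx : x ∈ dom Ω P E)
    {η : ℝ} (hη : 0 < η) : ∃ δ > 0, ∀ y ∈ Metric.ball x δ, ∀ᶠ N : ℕ in atTop,
      |gN H N y - gN H N x| < η := by
  obtain ⟨ε, hε, -, B, hB⟩ := local_affine c hA hx
  set B' : ℝ := |(B:ℝ)| + 1 with hB'
  have hB0 : 0 < B' := by positivity
  refine ⟨min ε (η / (8 * B')), by positivity, fun y hy => ?_⟩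
  obtain ⟨y1, y2⟩ := sup_of (Metric.ball_subset_ball (min_le_right _ _) hy)
  have e2 : ∀ᶠ N : ℕ in atTop, 8 * 2 * B' / η < N := tendsto_natCast_atTop_atTop.eventually_gt_atTop _
  filter_upwards [hB, e2, eventually_ge_atTop 1] with N ⟨a, b, ha, hb, hab⟩ h2 hN
  have hNR : (0:ℝ) < N := by exact_mod_cast hN
  have hq := hab y (Metric.ball_subset_ball (min_le_left _ _) hy)
  have ha' : |(a:ℝ)| ≤ B' := by
    have : |(a:ℝ)| ≤ B := by exact_mod_cast ha
    linarith [le_abs_self (B:ℝ)]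
  have hb' : |(b:ℝ)| ≤ B' := by
    have : |(b:ℝ)| ≤ B := by exact_mod_cast hb
    linarith [le_abs_self (B:ℝ)]
  have hd : gN H N y - gN H N x = a * (((flr N y).1:ℝ) / N - (flr N x).1 / N) +
      b * (((flr N y).2:ℝ) / N - (flr N x).2 / N) := by
    unfold gN; rw [hq]; push_cast; field_simp; ring
  obtain ⟨p1, p2⟩ := flr_div N hN y
  obtain ⟨q1, q2⟩ := flr_div N hN x
  have h1N : 1 / (N:ℝ) < η / (16 * B') := by
    rw [div_lt_div_iff₀ hNR (by positivity)]
    rw [div_lt_iff₀ hη] at h2; linarith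
  have k : η / (16 * B') = η / (8 * B') / 2 := by field_simp; norm_num
  have c1 : |((flr N y).1:ℝ) / N - (flr N x).1 / N| ≤ 2 * (η / (8 * B')) := by
    rw [abs_lt] at y1; rw [abs_le] at *
    constructor <;> linarith [p1.1, p1.2, q1.1, q1.2]
  have c2 : |((flr N y).2:ℝ) / N - (flr N x).2 / N| ≤ 2 * (η / (8 * B')) := by
    rw [abs_lt] at y2; rw [abs_le] at *
    constructor <;> linarith [p2.1, p2.2, q2.1, q2.2]
  rw [hd]
  calc _ ≤ |(a:ℝ)| * |((flr N y).1:ℝ) / N - (flr N x).1 / N| +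
        |(b:ℝ)| * |((flr N y).2:ℝ) / N - (flr N x).2 / N| := by
        rw [← abs_mul, ← abs_mul]; exact abs_add_le _ _
    _ ≤ B' * (2 * (η / (8 * B'))) + B' * (2 * (η / (8 * B'))) := by gcongr
    _ = η / 2 := by field_simp; norm_num
    _ < η := by linarith

theorem flr_meas (N : ℕ) : Measurable (flr N) := by
  unfold flr; fun_prop

theorem gN_meas (H : ℕ → V → ℤ) (N : ℕ) : Measurable (gN H N) := by
  unfold gN
  have : Measurable fun x => ((H N (flr N x) : ℤ) : ℝ) :=
    (measurable_of_countable (fun v : V => ((H N v : ℤ) : ℝ))).comp (flr_meas N)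
  exact this.div_const _

theorem sub_limit {Ω : Set (ℝ × ℝ)} {P : Finset (ℝ × ℝ)} {φ : ℕ → V → ℤ} {C : Set (ℝ × ℝ)}
    {E : Finset Seg} {H : ℕ → V → ℤ} (c : Ctx Ω P φ C E H) {A : ℤ} (hA0 : 0 ≤ A)
    (hA : ∀ N : ℕ, 1 ≤ N → ∀ v, H N v ≤ A * N) :
    ∃ θ : ℕ → ℕ, StrictMono θ ∧ ∃ h : ℝ × ℝ → ℝ, Measurable h ∧ (∀ x ∉ dom Ω P E, h x = 0) ∧
      ∀ x ∈ dom Ω P E, Tendsto (fun k => gN H (θ k) x) atTop (𝓝 (h x)) := by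
  set D := TopologicalSpace.denseSeq (ℝ × ℝ)
  have hcpt : IsCompact (Set.pi Set.univ fun _ : ℕ => Set.Icc (0:ℝ) A) :=
    isCompact_univ_pi fun _ => isCompact_Icc
  obtain ⟨L, -, θ, hθ, hL⟩ := hcpt.tendsto_subseq (x := fun N k => gN H N (D k))
    (fun N k _ => ⟨gN_nonneg c N _, gN_le hA0 hA N _⟩)
  rw [tendsto_pi_nhds] at hL
  have hlim : ∀ x ∈ dom Ω P E, ∃ l, Tendsto (fun k => gN H (θ k) x) atTop (𝓝 l) := by
    intro x hx
    apply cauchySeq_tendsto_of_complete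
    rw [Metric.cauchySeq_iff']
    intro η hη
    obtain ⟨δ, hδ, hcl⟩ := g_close c hA hx (η := η / 4) (by linarith)
    obtain ⟨j, hj⟩ := (TopologicalSpace.denseRange_denseSeq (ℝ × ℝ)).exists_dist_lt x hδ
    have h1 := hθ.tendsto_atTop.eventually (hcl (D j) (by rwa [Metric.mem_ball, dist_comm]))
    have h2 := (hL j).eventually (Metric.ball_mem_nhds (L j) (ε := η / 4) (by linarith))
    have h3 : ∀ᶠ k in atTop, |gN H (θ k) x - L j| < η / 2 := by
      filter_upwards [h1, h2] with k h1 h2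
      have h2' : |gN H (θ k) (D j) - L j| < η / 4 := h2
      rw [abs_lt] at *
      constructor <;> linarith [h1.1, h1.2, h2'.1, h2'.2]
    obtain ⟨K, hK⟩ := eventually_atTop.1 h3
    refine ⟨K, fun n hn => ?_⟩
    have a1 := hK n hn
    have a2 := hK K le_rfl
    rw [Real.dist_eq]
    rw [abs_lt] at *
    constructor <;> linarith [a1.1, a1.2, a2.1, a2.2]
  classical
  choose! l hl using hlim
  refine ⟨θ, hθ, (dom Ω P E).indicator l, ?_, fun x hx => Set.indicator_of_notMem hx _,
    fun x hx => by rw [Set.indicator_of_mem hx]; exact hl x hx⟩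
  refine measurable_of_tendsto_metrizable
    (f := fun k => (dom Ω P E).indicator (gN H (θ k)))
    (fun k => (gN_meas H _).indicator (dom_open Ω P E).measurableSet) ?_
  rw [tendsto_pi_nhds]
  intro x
  by_cases hx : x ∈ dom Ω P E
  · simp only [Set.indicator_of_mem hx]; exact hl x hx
  · simp only [Set.indicator_of_notMem hx]; exact tendsto_const_nhds

theorem limit_affine {Ω : Set (ℝ × ℝ)} {P : Finset (ℝ × ℝ)} {φ : ℕ → V → ℤ} {C : Set (ℝ × ℝ)}
    {E : Finset Seg} {H : ℕ → V → ℤ} (c : Ctx Ω P φ C E H) {A : ℤ}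
    (hA : ∀ N : ℕ, 1 ≤ N → ∀ v, H N v ≤ A * N) {θ : ℕ → ℕ} (hθ : StrictMono θ) {h : ℝ × ℝ → ℝ}
    (hl : ∀ x ∈ dom Ω P E, Tendsto (fun k => gN H (θ k) x) atTop (𝓝 (h x)))
    {x : ℝ × ℝ} (hx : x ∈ dom Ω P E) :
    ∃ ε > 0, Metric.ball x ε ⊆ dom Ω P E ∧ ∃ a b : ℤ,
      (∀ᶠ k in atTop, ∀ y ∈ Metric.ball x ε, H (θ k) (flr (θ k) y) = H (θ k) (flr (θ k) x) +
        a * ((flr (θ k) y).1 - (flr (θ k) x).1) + b * ((flr (θ k) y).2 - (flr (θ k) x).2)) ∧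
      ∀ y ∈ Metric.ball x ε,
      h y = h x + a * (y.1 - x.1) + b * (y.2 - x.2) := by
  obtain ⟨ε, hε, hsub, B, hB⟩ := local_affine c hA hx
  refine ⟨ε, hε, hsub, ?_⟩
  have hB' := hθ.tendsto_atTop.eventually hB
  set W : ℤ × ℤ → ℕ → Prop := fun p k => ∀ y ∈ Metric.ball x ε,
      H (θ k) (flr (θ k) y) = H (θ k) (flr (θ k) x) +
        p.1 * ((flr (θ k) y).1 - (flr (θ k) x).1) + p.2 * ((flr (θ k) y).2 - (flr (θ k) x).2)
    with hW
  have hfl : ∀ z, Tendsto (fun k : ℕ => ((flr (θ k) z).1 : ℝ) / (θ k : ℕ)) atTop (𝓝 z.1) ∧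
      Tendsto (fun k : ℕ => ((flr (θ k) z).2 : ℝ) / (θ k : ℕ)) atTop (𝓝 z.2) := fun z =>
    ⟨(flr_tendsto z).1.comp hθ.tendsto_atTop, (flr_tendsto z).2.comp hθ.tendsto_atTop⟩
  have haff : ∀ p : ℤ × ℤ, (∃ᶠ k in atTop, W p k) → ∀ y ∈ Metric.ball x ε,
      h y = h x + p.1 * (y.1 - x.1) + p.2 * (y.2 - x.2) := by
    rintro ⟨a, b⟩ hf y hy
    refine tendsto_nhds_unique_of_frequently_eq (hl y (hsub hy))
      ((((hl x hx).add (((hfl y).1.sub (hfl x).1).const_mul (a:ℝ))).add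
        (((hfl y).2.sub (hfl x).2).const_mul (b:ℝ)))) (hf.mono fun k hk => ?_)
    have := hk y hy
    unfold gN
    rw [this]; push_cast
    ring
  have key : ∀ T : Set (ℤ × ℤ), (∃ᶠ k in atTop, ∃ p ∈ T,
      p ∈ Finset.Icc (-B) B ×ˢ Finset.Icc (-B) B ∧ W p k) → ∃ p ∈ T, ∃ᶠ k in atTop, W p k := by
    intro T hT
    by_contra hcon
    push Not at hcon
    have hall := (eventually_all_finset (Finset.Icc (-B) B ×ˢ Finset.Icc (-B) B)
      (l := atTop) (p := fun p k => p ∈ T → ¬ W p k)).2 (fun p _ => by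
        by_cases hp : p ∈ T
        · filter_upwards [hcon p hp] with k hk _ using hk
        · exact Eventually.of_forall fun k h => absurd h hp)
    obtain ⟨k, ⟨p, hpT, hpS, hpW⟩, hk⟩ := (hT.and_eventually hall).exists
    exact hk p hpS hpT hpW
  have hex : ∀ᶠ k in atTop, ∃ p, p ∈ Finset.Icc (-B) B ×ˢ Finset.Icc (-B) B ∧ W p k := by
    filter_upwards [hB'] with k ⟨a, b, ha, hb, hab⟩
    refine ⟨(a, b), ?_, hab⟩
    rw [Finset.mem_product, Finset.mem_Icc, Finset.mem_Icc]
    exact ⟨abs_le.1 ha, abs_le.1 hb⟩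
  obtain ⟨p, -, hp⟩ := key Set.univ (hex.frequently.mono fun k ⟨p, h1, h2⟩ => ⟨p, trivial, h1, h2⟩)
  refine ⟨p.1, p.2, ?_, haff p hp⟩
  by_contra hcon
  obtain ⟨q, hq, hqf⟩ := key {q | q ≠ p} (((not_eventually.1 hcon).and_eventually hex).mono
    fun k ⟨h1, q, hq1, hq2⟩ => ⟨q, fun h => h1 (h ▸ hq2), hq1, hq2⟩)
  apply hq
  have e := haff p hp
  have e' := haff q hqf
  have m1 : (x.1 + ε / 2, x.2) ∈ Metric.ball x ε := by
    apply sup_lt <;> simp [abs_of_pos (half_pos hε), hε]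
  have m2 : (x.1, x.2 + ε / 2) ∈ Metric.ball x ε := by
    apply sup_lt <;> simp [abs_of_pos (half_pos hε), hε]
  have t1 := (e _ m1).symm.trans (e' _ m1)
  have t2 := (e _ m2).symm.trans (e' _ m2)
  simp only [add_sub_cancel_left, sub_self, mul_zero, add_zero] at t1 t2
  have r1 : (q.1:ℝ) = p.1 := by
    have : (q.1 - p.1 : ℝ) * (ε / 2) = 0 := by linarith
    rcases mul_eq_zero.1 this with h | h <;> linarith
  have r2 : (q.2:ℝ) = p.2 := by
    have : (q.2 - p.2 : ℝ) * (ε / 2) = 0 := by linarith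
    rcases mul_eq_zero.1 this with h | h <;> linarith
  exact Prod.ext (by exact_mod_cast r1) (by exact_mod_cast r2)

theorem seg_null (a b : ℝ × ℝ) : volume (segment ℝ a b) = 0 := by
  have h1 : segment ℝ a b ⊆ (affineSpan ℝ ({a, b} : Set (ℝ × ℝ)) : Set (ℝ × ℝ)) := by
    rw [segment_eq_image_lineMap]
    rintro _ ⟨t, -, rfl⟩
    exact AffineMap.lineMap_mem_affineSpan_pair t a b
  refine measure_mono_null h1 (Measure.addHaar_affineSubspace _ _ ?_)
  intro h
  have h2 := collinear_iff_finrank_le_one.1 (collinear_pair ℝ a b)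
  rw [← direction_affineSpan, h, AffineSubspace.direction_top, finrank_top] at h2
  simp at h2

theorem gsupp_null (E : Finset Seg) : volume (gsupp E) = 0 :=
  (measure_biUnion_null_iff E.countable_toSet).2 fun e _ => seg_null e.1 e.2

theorem ae_dom (Ω : Set (ℝ × ℝ)) (P : Finset (ℝ × ℝ)) (E : Finset Seg) :
    ∀ᵐ x : ℝ × ℝ, x ∈ interior Ω → x ∈ dom Ω P E := by
  have h1 : volume (gsupp E ∪ (↑P : Set (ℝ × ℝ))) = 0 :=
    measure_union_null (gsupp_null E) (P.finite_toSet.measure_zero _)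
  have : ∀ᵐ x : ℝ × ℝ, x ∉ gsupp E ∪ (↑P : Set (ℝ × ℝ)) := measure_eq_zero_iff_ae_notMem.1 h1
  filter_upwards [this] with x hx hi using ⟨hi, hx⟩

theorem bdd_mul_int {f ψ : ℝ × ℝ → ℝ} (hf : Measurable f) {M : ℝ} (hM : ∀ x, |f x| ≤ M)
    (hψ : Continuous ψ) (hs : HasCompactSupport ψ) : Integrable (fun x => f x * ψ x) :=
  (hψ.integrable_of_hasCompactSupport hs).bdd_mul (c := M) hf.aestronglyMeasurable
    (Eventually.of_forall hM)

theorem shift_int (f ψ : ℝ × ℝ → ℝ) (w : ℝ × ℝ) :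
    ∫ x, f (x + w) * ψ x = ∫ x, f x * ψ (x - w) := by
  have := integral_add_right_eq_self (μ := volume) (fun x => f x * ψ (x - w)) w
  simp only [add_sub_cancel_right] at this
  exact this

theorem comp_add_int {f ψ : ℝ × ℝ → ℝ} (hf : Measurable f) {M : ℝ} (hM : ∀ x, |f x| ≤ M)
    (hψ : Continuous ψ) (hs : HasCompactSupport ψ) (w : ℝ × ℝ) :
    Integrable (fun x => f (x + w) * ψ x) ∧ Integrable (fun x => f x * ψ (x + w)) := by
  refine ⟨bdd_mul_int (hf.comp (measurable_id.add_const w)) (fun x => hM _) hψ hs, ?_⟩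
  refine bdd_mul_int hf hM (hψ.comp (continuous_id.add continuous_const)) ?_
  exact hs.comp_homeomorph (Homeomorph.addRight w)

theorem integral5 {a b c d e : ℝ × ℝ → ℝ} (ha : Integrable a) (hb : Integrable b)
    (hc : Integrable c) (hd : Integrable d) (he : Integrable e) :
    ∫ x, (a x + b x + c x + d x - 4 * e x) =
      (∫ x, a x) + (∫ x, b x) + (∫ x, c x) + (∫ x, d x) - 4 * ∫ x, e x := by
  have h1 : Integrable (fun x => a x + b x) := ha.add hb
  have h2 : Integrable (fun x => a x + b x + c x) := h1.add hc
  have h3 : Integrable (fun x => a x + b x + c x + d x) := h2.add hd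
  rw [integral_sub h3 (he.const_mul 4), integral_add h2 hd, integral_add h1 hc, integral_add ha hb,
    integral_const_mul]

theorem ibp {f ψ : ℝ × ℝ → ℝ} (hf : Measurable f) {M : ℝ} (hM : ∀ x, |f x| ≤ M)
    (hψ : Continuous ψ) (hs : HasCompactSupport ψ) (u w : ℝ × ℝ) :
    ∫ x, (f (x + u) + f (x - u) + f (x + w) + f (x - w) - 4 * f x) * ψ x =
    ∫ x, f x * ((ψ (x + u) + ψ (x - u) - 2 * ψ x) + (ψ (x + w) + ψ (x - w) - 2 * ψ x)) := by
  have I := comp_add_int hf hM hψ hs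
  have i0 := bdd_mul_int hf hM hψ hs
  have l : ∀ x, (f (x + u) + f (x - u) + f (x + w) + f (x - w) - 4 * f x) * ψ x =
      f (x + u) * ψ x + f (x + -u) * ψ x + f (x + w) * ψ x + f (x + -w) * ψ x - 4 * (f x * ψ x) := by
    intro x; rw [← sub_eq_add_neg, ← sub_eq_add_neg]; ring
  have r : ∀ x, f x * ((ψ (x + u) + ψ (x - u) - 2 * ψ x) + (ψ (x + w) + ψ (x - w) - 2 * ψ x)) =
      f x * ψ (x + u) + f x * ψ (x + -u) + f x * ψ (x + w) + f x * ψ (x + -w)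
        - 4 * (f x * ψ x) := by
    intro x; rw [← sub_eq_add_neg, ← sub_eq_add_neg]; ring
  simp only [l, r]
  rw [integral5 (I u).1 (I (-u)).1 (I w).1 (I (-w)).1 i0,
    integral5 (I u).2 (I (-u)).2 (I w).2 (I (-w)).2 i0]
  rw [shift_int, shift_int, shift_int, shift_int]
  simp only [sub_neg_eq_add, sub_eq_add_neg, neg_neg]
  ring

theorem flr_add (N : ℕ) (hN : 1 ≤ N) (x : ℝ × ℝ) (a b : ℤ) :
    flr N (x + (1 / (N:ℝ)) • toR (a, b)) = ((flr N x).1 + a, (flr N x).2 + b) := by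
  have hNR : (N:ℝ) ≠ 0 := by positivity
  unfold flr toR
  simp only [Prod.fst_add, Prod.smul_fst, smul_eq_mul, Prod.snd_add, Prod.smul_snd]
  ext
  · simp only [mul_add, ← mul_assoc, mul_one_div_cancel hNR, one_mul, Int.floor_add_intCast]
  · simp only [mul_add, ← mul_assoc, mul_one_div_cancel hNR, one_mul, Int.floor_add_intCast]

theorem flr_add' (N : ℕ) (hN : 1 ≤ N) (x : ℝ × ℝ) :
    flr N (x + (1 / (N:ℝ)) • (1, 0)) = ((flr N x).1 + 1, (flr N x).2) ∧
    flr N (x - (1 / (N:ℝ)) • (1, 0)) = ((flr N x).1 - 1, (flr N x).2) ∧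
    flr N (x + (1 / (N:ℝ)) • (0, 1)) = ((flr N x).1, (flr N x).2 + 1) ∧
    flr N (x - (1 / (N:ℝ)) • (0, 1)) = ((flr N x).1, (flr N x).2 - 1) := by
  have e1 : ((1:ℝ), (0:ℝ)) = toR (1, 0) := by simp [toR]
  have e2 : ((0:ℝ), (1:ℝ)) = toR (0, 1) := by simp [toR]
  have n1 : ∀ x : ℝ × ℝ, x - (1 / (N:ℝ)) • toR (1, 0) = x + (1 / (N:ℝ)) • toR (-1, 0) := by
    intro x; ext <;> simp [toR]; ring
  have n2 : ∀ x : ℝ × ℝ, x - (1 / (N:ℝ)) • toR (0, 1) = x + (1 / (N:ℝ)) • toR (0, -1) := by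
    intro x; ext <;> simp [toR]; ring
  rw [e1, e2, n1, n2]
  simp only [flr_add N hN]
  refine ⟨?_, ?_, ?_, ?_⟩ <;> ext <;> simp <;> ring

/-- discrete Green identity -/
theorem green {H : ℕ → V → ℤ} {A : ℝ} (N : ℕ) (hN : 1 ≤ N) (hA : ∀ x, |gN H N x| ≤ A)
    {ψ : ℝ × ℝ → ℝ} (hψ : Continuous ψ) (hs : HasCompactSupport ψ) :
    ∫ x, (N:ℝ) * lapZ (H N) (flr N x) * ψ x = ∫ x, gN H N x * ((N:ℝ) ^ 2 *
      ((ψ (x + (1 / (N:ℝ)) • (1, 0)) + ψ (x - (1 / (N:ℝ)) • (1, 0)) - 2 * ψ x) +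
       (ψ (x + (1 / (N:ℝ)) • (0, 1)) + ψ (x - (1 / (N:ℝ)) • (0, 1)) - 2 * ψ x))) := by
  have hNR : (N:ℝ) ≠ 0 := by positivity
  have h1 := ibp (gN_meas H N) hA hψ hs ((1 / (N:ℝ)) • (1, 0)) ((1 / (N:ℝ)) • (0, 1))
  have h2 := congrArg (fun t => (N:ℝ) ^ 2 * t) h1
  simp only [← integral_const_mul] at h2
  refine Eq.trans ?_ (h2.trans ?_)
  · congr 1; ext x
    obtain ⟨a1, a2, a3, a4⟩ := flr_add' N hN x
    unfold gN lapZ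
    rw [a1, a2, a3, a4]
    push_cast
    field_simp
  · congr 1; ext x; ring

/-- rescaled second differences -/
noncomputable def QN (ψ : ℝ × ℝ → ℝ) (N : ℕ) (x : ℝ × ℝ) : ℝ :=
  (N:ℝ) ^ 2 *
      ((ψ (x + (1 / (N:ℝ)) • (1, 0)) + ψ (x - (1 / (N:ℝ)) • (1, 0)) - 2 * ψ x) +
       (ψ (x + (1 / (N:ℝ)) • (0, 1)) + ψ (x - (1 / (N:ℝ)) • (0, 1)) - 2 * ψ x))

theorem QN_eq {ψ : ℝ × ℝ → ℝ} (hψ : Sm ψ) (N : ℕ) (hN : 1 ≤ N) (x : ℝ × ℝ) :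
    ∃ ξ ξ' : ℝ, |ξ| ≤ 1 / N ∧ |ξ'| ≤ 1 / N ∧ QN ψ N x =
      pd (1, 0) (pd (1, 0) ψ) (x + ξ • (1, 0)) + pd (0, 1) (pd (0, 1) ψ) (x + ξ' • (0, 1)) := by
  have hNR : (0:ℝ) < N := by exact_mod_cast hN
  obtain ⟨ξ, h1, h2⟩ := second_diff hψ x (1, 0) (s := 1 / N) (by positivity)
  obtain ⟨ξ', h3, h4⟩ := second_diff hψ x (0, 1) (s := 1 / N) (by positivity)
  refine ⟨ξ, ξ', abs_le.2 ⟨h1.1.le, h1.2.le⟩, abs_le.2 ⟨h3.1.le, h3.2.le⟩, ?_⟩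
  unfold QN
  rw [h2, h4]; field_simp

theorem QN_tendsto {ψ : ℝ × ℝ → ℝ} (hψ : Sm ψ) (x : ℝ × ℝ) :
    Tendsto (fun N => QN ψ N x) atTop (𝓝 (lap ψ x)) := by
  have : ∀ N : ℕ, ∃ ξ ξ' : ℝ, 1 ≤ N → |ξ| ≤ 1 / N ∧ |ξ'| ≤ 1 / N ∧ QN ψ N x =
      pd (1, 0) (pd (1, 0) ψ) (x + ξ • (1, 0)) + pd (0, 1) (pd (0, 1) ψ) (x + ξ' • (0, 1)) := by
    intro N
    by_cases hN : 1 ≤ N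
    · obtain ⟨a, b, h⟩ := QN_eq hψ N hN x
      exact ⟨a, b, fun _ => h⟩
    · exact ⟨0, 0, fun h => absurd h hN⟩
  choose ξ ξ' hξ using this
  have t1 : Tendsto ξ atTop (𝓝 0) := by
    refine squeeze_zero_norm' ?_ tendsto_one_div_atTop_nhds_zero_nat
    filter_upwards [eventually_ge_atTop 1] with N hN using (hξ N hN).1
  have t2 : Tendsto ξ' atTop (𝓝 0) := by
    refine squeeze_zero_norm' ?_ tendsto_one_div_atTop_nhds_zero_nat
    filter_upwards [eventually_ge_atTop 1] with N hN using (hξ N hN).2.1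
  have c1 : Continuous fun t : ℝ => pd (1, 0) (pd (1, 0) ψ) (x + t • ((1:ℝ), (0:ℝ))) :=
    ((hψ.pd _).pd _).continuous.comp (by fun_prop)
  have c2 : Continuous fun t : ℝ => pd (0, 1) (pd (0, 1) ψ) (x + t • ((0:ℝ), (1:ℝ))) :=
    ((hψ.pd _).pd _).continuous.comp (by fun_prop)
  have l1 := (c1.tendsto 0).comp t1
  have l2 := (c2.tendsto 0).comp t2
  have := l1.add l2
  simp only [zero_smul, add_zero] at this
  refine this.congr' ?_
  filter_upwards [eventually_ge_atTop 1] with N hN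
  rw [(hξ N hN).2.2]; rfl

theorem bdd_of_cpt {χ : ℝ × ℝ → ℝ} (h : Continuous χ) (hs : HasCompactSupport χ) :
    ∃ M, 0 ≤ M ∧ ∀ x, |χ x| ≤ M := by
  obtain ⟨M, hM⟩ := hs.exists_bound_of_continuous h
  exact ⟨M, (norm_nonneg _).trans (hM 0), hM⟩

theorem QN_bound {ψ : ℝ × ℝ → ℝ} (hψ : Sm ψ) (hs : HasCompactSupport ψ) :
    ∃ M, 0 ≤ M ∧ ∀ N : ℕ, 1 ≤ N → ∀ x, |QN ψ N x| ≤
      (Metric.cthickening 1 (tsupport ψ)).indicator (fun _ => M) x := by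
  have hs1 : HasCompactSupport (pd (1, 0) (pd (1, 0) ψ)) :=
    IsCompact.of_isClosed_subset hs (isClosed_tsupport _) ((tsupport_pd _ _).trans (tsupport_pd _ _))
  have hs2 : HasCompactSupport (pd (0, 1) (pd (0, 1) ψ)) :=
    IsCompact.of_isClosed_subset hs (isClosed_tsupport _) ((tsupport_pd _ _).trans (tsupport_pd _ _))
  obtain ⟨M1, h10, h1⟩ := bdd_of_cpt ((hψ.pd _).pd _).continuous hs1
  obtain ⟨M2, h20, h2⟩ := bdd_of_cpt ((hψ.pd _).pd _).continuous hs2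
  refine ⟨M1 + M2, by positivity, fun N hN x => ?_⟩
  obtain ⟨ξ, ξ', a1, a2, e⟩ := QN_eq hψ N hN x
  have hNR : (1:ℝ) ≤ N := by exact_mod_cast hN
  have h1N : 1 / (N:ℝ) ≤ 1 := by rw [div_le_one (by linarith)]; exact hNR
  by_cases hx : x ∈ Metric.cthickening 1 (tsupport ψ)
  · rw [Set.indicator_of_mem hx, e]
    exact (abs_add_le _ _).trans (add_le_add (h1 _) (h2 _))
  · rw [Set.indicator_of_notMem hx, e]
    have k1 : x + ξ • ((1:ℝ), (0:ℝ)) ∉ tsupport ψ := fun h => hx (by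
      refine Metric.mem_cthickening_of_dist_le _ _ _ _ h ?_
      rw [dist_eq_norm]; simp [Prod.norm_def]; linarith)
    have k2 : x + ξ' • ((0:ℝ), (1:ℝ)) ∉ tsupport ψ := fun h => hx (by
      refine Metric.mem_cthickening_of_dist_le _ _ _ _ h ?_
      rw [dist_eq_norm]; simp [Prod.norm_def]; linarith)
    rw [image_eq_zero_of_notMem_tsupport fun h => k1 ((tsupport_pd _ _).trans (tsupport_pd _ _) h),
      image_eq_zero_of_notMem_tsupport fun h => k2 ((tsupport_pd _ _).trans (tsupport_pd _ _) h)]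
    simp

theorem QN_cont {ψ : ℝ × ℝ → ℝ} (hψ : Continuous ψ) (N : ℕ) : Continuous (QN ψ N) := by
  unfold QN; fun_prop

theorem lap_limit {Ω : Set (ℝ × ℝ)} {P : Finset (ℝ × ℝ)} {E : Finset Seg} {H : ℕ → V → ℤ} {A : ℝ}
    (hA : ∀ N x, |gN H N x| ≤ A) {θ : ℕ → ℕ} (hθ : StrictMono θ) {h : ℝ × ℝ → ℝ}
    (hl : ∀ x ∈ dom Ω P E, Tendsto (fun k => gN H (θ k) x) atTop (𝓝 (h x)))
    {ψ : ℝ × ℝ → ℝ} (hψ : Sm ψ) (hs : HasCompactSupport ψ) (hsub : tsupport ψ ⊆ interior Ω) :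
    Tendsto (fun k => ∫ x, ((θ k : ℕ) : ℝ) * lapZ (H (θ k)) (flr (θ k) x) * ψ x) atTop
      (𝓝 (∫ x, h x * lap ψ x)) := by
  obtain ⟨M, hM0, hM⟩ := QN_bound hψ hs
  have hth := hθ.tendsto_atTop
  have hA0 : 0 ≤ A := (abs_nonneg _).trans (hA 0 0)
  have hge : ∀ᶠ k in atTop, 1 ≤ θ k := hth.eventually (eventually_ge_atTop 1)
  have key : Tendsto (fun k => ∫ x, gN H (θ k) x * QN ψ (θ k) x) atTop
      (𝓝 (∫ x, h x * lap ψ x)) := by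
    refine tendsto_integral_filter_of_dominated_convergence
      (fun x => (Metric.cthickening 1 (tsupport ψ)).indicator (fun _ => A * M) x) ?_ ?_ ?_ ?_
    · exact Eventually.of_forall fun k => ((gN_meas H _).mul
        (QN_cont hψ.continuous _).measurable).aestronglyMeasurable
    · filter_upwards [hge] with k hk
      refine Eventually.of_forall fun x => ?_
      rw [norm_mul]
      have h1 := hM _ hk x
      by_cases hx : x ∈ Metric.cthickening 1 (tsupport ψ)
      · rw [Set.indicator_of_mem hx] at h1 ⊢
        exact mul_le_mul (hA _ _) h1 (abs_nonneg _) hA0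
      · rw [Set.indicator_of_notMem hx] at h1 ⊢
        rw [Real.norm_eq_abs, Real.norm_eq_abs, le_antisymm h1 (abs_nonneg _), mul_zero]
    · have hc : IsCompact (Metric.cthickening 1 (tsupport ψ)) := IsCompact.cthickening hs
      exact (integrable_indicator_iff hc.measurableSet).2
        (integrableOn_const hc.measure_lt_top.ne)
    · filter_upwards [ae_dom Ω P E] with x hx
      have hq := (QN_tendsto hψ x).comp hth
      by_cases hi : x ∈ interior Ω
      · exact (hl x (hx hi)).mul hq
      · have h0 : lap ψ x = 0 := lap_zero_of_notMem fun h => hi (hsub h)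
        rw [h0] at hq ⊢
        rw [mul_zero]
        refine squeeze_zero_norm (a := fun k => A * |QN ψ (θ k) x|) (fun k => ?_) ?_
        · rw [norm_mul]
          exact mul_le_mul_of_nonneg_right (hA _ _) (abs_nonneg _)
        · have := (hq.abs).const_mul A
          simpa using this
  refine key.congr' ?_
  filter_upwards [hge] with k hk
  exact (green (θ k) hk (hA _) hψ.continuous hs).symm

theorem cell_bound (N : ℕ) (hN : 1 ≤ N) (v : V) :
    volume {x : ℝ × ℝ | flr N x = v} ≤ ENNReal.ofReal (1 / N * (1 / N)) := by
  have hNR : (0:ℝ) < N := by exact_mod_cast hN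
  have hsub : {x : ℝ × ℝ | flr N x = v} ⊆
      Set.Icc ((v.1:ℝ) / N) ((v.1 + 1) / N) ×ˢ Set.Icc ((v.2:ℝ) / N) ((v.2 + 1) / N) := by
    rintro x rfl
    obtain ⟨f1, f2, f3, f4⟩ := flr_le N x
    refine ⟨⟨?_, ?_⟩, ?_, ?_⟩
    · rw [div_le_iff₀ hNR]; linarith
    · rw [le_div_iff₀ hNR]; linarith
    · rw [div_le_iff₀ hNR]; linarith
    · rw [le_div_iff₀ hNR]; linarith
  refine (measure_mono hsub).trans ?_
  rw [Measure.volume_eq_prod, Measure.prod_prod, Real.volume_Icc, Real.volume_Icc,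
    ← ENNReal.ofReal_mul (by rw [← sub_div]; simp)]
  apply ENNReal.ofReal_le_ofReal
  rw [← sub_div, ← sub_div]; simp

open Classical in
theorem cell_int (N : ℕ) (hN : 1 ≤ N) (v : V) {ψ : ℝ × ℝ → ℝ} {M : ℝ} (hM0 : 0 ≤ M)
    (hM : ∀ x, |ψ x| ≤ M) :
    |∫ x, (N:ℝ) * (if flr N x = v then 1 else 0) * ψ x| ≤ M * (1 / N) := by
  have hNR : (0:ℝ) < N := by exact_mod_cast hN
  have hms : MeasurableSet {x : ℝ × ℝ | flr N x = v} := flr_meas N (measurableSet_singleton v)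
  have e : (fun x => (N:ℝ) * (if flr N x = v then 1 else 0) * ψ x) =
      {x : ℝ × ℝ | flr N x = v}.indicator (fun x => N * ψ x) := by
    ext x
    by_cases hx : flr N x = v
    · rw [Set.indicator_of_mem (by exact hx), if_pos hx, mul_one]
    · rw [Set.indicator_of_notMem (by exact hx), if_neg hx]; ring
  rw [e, integral_indicator hms]
  have hfin : volume {x : ℝ × ℝ | flr N x = v} < ⊤ :=
    (cell_bound N hN v).trans_lt ENNReal.ofReal_lt_top
  have := norm_setIntegral_le_of_norm_le_const (f := fun x => N * ψ x) (C := N * M) hfin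
    (fun x _ => by
      rw [norm_mul, Real.norm_eq_abs, abs_of_pos hNR]
      exact mul_le_mul_of_nonneg_left (hM x) hNR.le)
  refine this.trans ?_
  have h2 : volume.real {x : ℝ × ℝ | flr N x = v} ≤ 1 / N * (1 / N) :=
    ENNReal.toReal_le_of_le_ofReal (by positivity) (cell_bound N hN v)
  calc N * M * volume.real {x : ℝ × ℝ | flr N x = v} ≤ N * M * (1 / N * (1 / N)) := by gcongr
    _ = M * (1 / N) := by field_simp

theorem weak_lap {Ω : Set (ℝ × ℝ)} {P : Finset (ℝ × ℝ)} {φ : ℕ → V → ℤ} {C : Set (ℝ × ℝ)}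
    {E : Finset Seg} {H : ℕ → V → ℤ} (c : Ctx Ω P φ C E H) {m : Seg → ℕ}
    (hW : WeakLimit Ω φ E m) {A : ℝ}
    (hA : ∀ N x, |gN H N x| ≤ A) {θ : ℕ → ℕ} (hθ : StrictMono θ) {h : ℝ × ℝ → ℝ}
    (hl : ∀ x ∈ dom Ω P E, Tendsto (fun k => gN H (θ k) x) atTop (𝓝 (h x)))
    {ψ : ℝ × ℝ → ℝ} (hψ : TestFun Ω ψ) : ∫ x, h x * lap ψ x = - tropPairing E m ψ := by
  classical
  have hbody := poly_body c.poly
  have hs : HasCompactSupport ψ := IsCompact.of_isClosed_subset hbody.cpt (isClosed_tsupport _)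
    (hψ.2.trans interior_subset)
  obtain ⟨M, hM0, hM⟩ := bdd_of_cpt hψ.1.continuous hs
  have hth := hθ.tendsto_atTop
  obtain ⟨δ, hδ, hthick⟩ := IsCompact.exists_thickening_subset_open hs isOpen_interior hψ.2
  have e1 : ∀ᶠ N : ℕ in atTop, 1 / δ < N := tendsto_natCast_atTop_atTop.eventually_gt_atTop _
  -- exact formula
  have hform : ∀ᶠ N : ℕ in atTop, ∫ x, devDens Ω N (φ N) x * ψ x =
      - (∫ x, (N:ℝ) * lapZ (H N) (flr N x) * ψ x) -
        ∑ p ∈ P, ∫ x, (N:ℝ) * (if flr N x = flr N p then 1 else 0) * ψ x := by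
    filter_upwards [e1, eventually_ge_atTop 1] with N h1 hN
    have hNR : (0:ℝ) < N := by exact_mod_cast hN
    have hint1 : Integrable (fun x => (N:ℝ) * lapZ (H N) (flr N x) * ψ x) := by
      refine bdd_mul_int (f := fun x => (N:ℝ) * lapZ (H N) (flr N x)) (M := N ^ 2 * (8 * A)) ?_ ?_
        hψ.1.continuous hs
      · exact ((measurable_of_countable (fun v : V => ((lapZ (H N) v : ℤ) : ℝ))).comp
          (flr_meas N)).const_mul _
      · intro x
        obtain ⟨a1, a2, a3, a4⟩ := flr_add' N hN x
        have b0 := abs_le.1 (hA N x)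
        have b1 := abs_le.1 (hA N (x + (1 / (N:ℝ)) • (1, 0)))
        have b2 := abs_le.1 (hA N (x - (1 / (N:ℝ)) • (1, 0)))
        have b3 := abs_le.1 (hA N (x + (1 / (N:ℝ)) • (0, 1)))
        have b4 := abs_le.1 (hA N (x - (1 / (N:ℝ)) • (0, 1)))
        have : (N:ℝ) * lapZ (H N) (flr N x) = N ^ 2 * (gN H N (x + (1 / (N:ℝ)) • (1, 0)) +
          gN H N (x - (1 / (N:ℝ)) • (1, 0)) + gN H N (x + (1 / (N:ℝ)) • (0, 1)) +
          gN H N (x - (1 / (N:ℝ)) • (0, 1)) - 4 * gN H N x) := by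
          unfold gN lapZ
          rw [a1, a2, a3, a4]
          push_cast
          field_simp
        rw [this, abs_mul, abs_of_pos (by positivity : (0:ℝ) < (N:ℝ) ^ 2)]
        gcongr
        rw [abs_le]; constructor <;> linarith [b0.1, b0.2, b1.1, b1.2, b2.1, b2.2, b3.1, b3.2, b4.1, b4.2]
    have hint2 : ∀ p ∈ P, Integrable
        (fun x => (N:ℝ) * (if flr N x = flr N p then 1 else 0) * ψ x) := by
      intro p _
      refine bdd_mul_int (f := fun x => (N:ℝ) * (if flr N x = flr N p then 1 else 0)) (M := N) ?_ ?_
        hψ.1.continuous hs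
      · exact ((measurable_of_countable (fun v : V => if v = flr N p then (1:ℝ) else 0)).comp
          (flr_meas N)).const_mul _
      · intro x; split_ifs <;> simp
    have hint1' : Integrable (fun x => -((N:ℝ) * lapZ (H N) (flr N x) * ψ x)) := hint1.neg
    rw [← integral_finsetSum _ hint2, ← integral_neg, ← integral_sub hint1'
      (integrable_finsetSum _ hint2)]
    congr 1; ext x
    by_cases hx : x ∈ tsupport ψ
    · have hin : flr N x ∈ latGrid Ω N := by
        rw [mem_latGrid hN]
        apply interior_subset
        apply hthick
        rw [Metric.mem_thickening_iff]
        refine ⟨x, hx, ?_⟩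
        obtain ⟨q1, q2⟩ := flr_div N hN x
        have : 1 / (N:ℝ) < δ := by
          rw [div_lt_iff₀ hNR]; rw [div_lt_iff₀ hδ] at h1; linarith
        rw [dist_eq_norm, Prod.norm_def]
        exact max_lt (q1.trans_lt this) (q2.trans_lt this)
      unfold devDens
      rw [if_pos hin, (c.odo N).eq _ hin]
      unfold stateN
      rw [if_pos hin, ← Finset.sum_mul, ← Finset.mul_sum]
      push_cast
      ring
    · rw [image_eq_zero_of_notMem_tsupport hx]; simp
  have hsum : Tendsto (fun N : ℕ =>
      ∑ p ∈ P, ∫ x, (N:ℝ) * (if flr N x = flr N p then 1 else 0) * ψ x) atTop (𝓝 0) := by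
    have h0 : (0:ℝ) = ∑ p ∈ P, (0:ℝ) := Finset.sum_const_zero.symm
    have : Tendsto (fun N : ℕ =>
      ∑ p ∈ P, ∫ x, (N:ℝ) * (if flr N x = flr N p then 1 else 0) * ψ x) atTop
      (𝓝 (∑ p ∈ P, (0:ℝ))) := ?_
    · rwa [← h0] at this
    refine tendsto_finsetSum _ fun p _ => ?_
    refine squeeze_zero_norm' (a := fun N : ℕ => M * (1 / (N:ℝ))) ?_ ?_
    · filter_upwards [eventually_ge_atTop 1] with N hN using cell_int N hN _ hM0 hM
    · simpa using tendsto_one_div_atTop_nhds_zero_nat.const_mul M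
  have t1 := (hW ψ hψ).comp hth
  have t2 := ((lap_limit hA hθ hl hψ.1 hs hψ.2).neg).sub (hsum.comp hth)
  have t3 := t1.congr' (f₂ := fun k => - (∫ x, ((θ k : ℕ):ℝ) * lapZ (H (θ k)) (flr (θ k) x) * ψ x) -
        ∑ p ∈ P, ∫ x, ((θ k : ℕ):ℝ) * (if flr (θ k) x = flr (θ k) p then 1 else 0) * ψ x)
    (hth.eventually hform)
  have := tendsto_nhds_unique t3 t2
  linarith

theorem first_parts {f ψ : ℝ × ℝ → ℝ} (hf : Measurable f) {M : ℝ} (hM : ∀ x, |f x| ≤ M)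
    (hψ : Continuous ψ) (hs : HasCompactSupport ψ) (u : ℝ × ℝ) :
    Integrable (fun x => (f (x + u) + f (x - u) - 2 * f x) * ψ x) ∧
    ∫ x, (f (x + u) + f (x - u) - 2 * f x) * ψ x =
    ∫ x, (f (x + u) - f x) * (ψ x - ψ (x + u)) := by
  set d : ℝ × ℝ → ℝ := fun x => f (x + u) - f x with hd
  have hdm : Measurable d := (hf.comp (measurable_id.add_const u)).sub hf
  have hdM : ∀ x, |d x| ≤ M + M := fun x => (abs_sub _ _).trans (add_le_add (hM _) (hM _))
  have I := comp_add_int hdm hdM hψ hs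
  have i0 := bdd_mul_int hdm hdM hψ hs
  have e1 : (fun x => (f (x + u) + f (x - u) - 2 * f x) * ψ x) =
      fun x => d x * ψ x - d (x + -u) * ψ x := by
    ext x; simp only [hd, neg_add_cancel_right, ← sub_eq_add_neg]; ring_nf
  have e2 : (fun x => (f (x + u) - f x) * (ψ x - ψ (x + u))) =
      fun x => d x * ψ x - d x * ψ (x + u) := by
    ext x; simp only [hd]; ring
  rw [e1, e2]
  refine ⟨i0.sub (I (-u)).1, ?_⟩
  rw [integral_sub i0 (I (-u)).1, integral_sub i0 (I u).2, shift_int]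
  simp only [sub_neg_eq_add]

theorem cell_pos (N : ℕ) (hN : 1 ≤ N) (v : V) : volume {x : ℝ × ℝ | flr N x = v} ≠ 0 := by
  have hNR : (0:ℝ) < N := by exact_mod_cast hN
  set O : Set (ℝ × ℝ) := {x | (v.1:ℝ) < N * x.1 ∧ N * x.1 < v.1 + 1 ∧ (v.2:ℝ) < N * x.2 ∧
    N * x.2 < v.2 + 1} with hO
  have hop : IsOpen O := by
    have c1 : Continuous fun x : ℝ × ℝ => (N:ℝ) * x.1 := by fun_prop
    have c2 : Continuous fun x : ℝ × ℝ => (N:ℝ) * x.2 := by fun_prop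
    exact (isOpen_lt continuous_const c1).inter ((isOpen_lt c1 continuous_const).inter
      ((isOpen_lt continuous_const c2).inter (isOpen_lt c2 continuous_const)))
  have hne : O.Nonempty := by
    refine ⟨((v.1 + 1 / 2) / N, (v.2 + 1 / 2) / N), ?_, ?_, ?_, ?_⟩ <;> field_simp <;> linarith
  have hsub : O ⊆ {x : ℝ × ℝ | flr N x = v} := by
    rintro x ⟨h1, h2, h3, h4⟩
    unfold flr
    refine Prod.ext ?_ ?_
    · exact Int.floor_eq_iff.2 ⟨h1.le, h2⟩
    · exact Int.floor_eq_iff.2 ⟨h3.le, h4⟩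
  intro h0
  exact (hop.measure_pos volume hne).ne' (measure_mono_null hsub h0)

theorem trop_pos {Ω : Set (ℝ × ℝ)} {C : Set (ℝ × ℝ)} {E : Finset Seg} {m : Seg → ℕ}
    (hΩ : Body Ω) (hE : EdgeSet E) (hPl : Planar E) (hS : gsupp E = closure (C ∩ interior Ω))
    (hR : ∀ e ∈ E, RatDir (e.2 - e.1)) (hm : ∀ e ∈ E, 0 < m e)
    (h0 : ∀ ψ, TestFun Ω ψ → tropPairing E m ψ = 0) : E = ∅ := by
  by_contra hne
  obtain ⟨e, he⟩ := Finset.nonempty_iff_ne_empty.2 hne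
  set z := e.1 + (1 / 2 : ℝ) • (e.2 - e.1) with hz
  have hzo : z ∈ openSegment ℝ e.1 e.2 :=
    ⟨1 / 2, 1 / 2, by norm_num, by norm_num, by norm_num, by rw [hz]; module⟩
  have hzi := edge_int hΩ hE hPl hS he hzo
  obtain ⟨r, hr, hball⟩ := Metric.isOpen_iff.1 isOpen_interior z hzi
  set b : ContDiffBump z := ⟨r / 4, r / 2, by linarith, by linarith⟩ with hb
  have hT : TestFun Ω b := by
    refine ⟨b.contDiff, ?_⟩
    rw [b.tsupport_eq]
    exact (Metric.closedBall_subset_ball (by simp [hb, hr])).trans hball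
  have := h0 _ hT
  have hseg0 : ∀ e : Seg, 0 ≤ segInt e b := fun e =>
    mul_nonneg (Real.sqrt_nonneg _) (intervalIntegral.integral_nonneg (by norm_num)
      fun t _ => b.nonneg)
  unfold tropPairing at this
  have h1 := (Finset.sum_eq_zero_iff_of_nonneg (fun e _ => mul_nonneg (mul_nonneg
    (show 0 ≤ enorm2 (toR (prim (e.2 - e.1))) from Real.sqrt_nonneg _)
    (Nat.cast_nonneg _)) (hseg0 e))).1 this e he
  have posn : ∀ w : ℝ × ℝ, w ≠ 0 → 0 < enorm2 w := fun w hw => Real.sqrt_pos.2 (rho_pos hw)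
  have h2 : 0 < segInt e b := by
    refine mul_pos (posn _ (sub_ne_zero.2 (hE e he).1.symm)) ?_
    refine intervalIntegral.integral_pos (by norm_num) ?_ (fun t _ => b.nonneg)
      ⟨1 / 2, by norm_num, ?_⟩
    · exact (b.continuous.comp (by fun_prop)).continuousOn
    · exact b.pos_of_mem_ball (Metric.mem_ball_self (by simp [hb, hr]))
  have h3 : 0 < enorm2 (toR (prim (e.2 - e.1))) := posn _ (prim_spec (hR e he)).ne
  have h4 : (0:ℝ) < m e := by exact_mod_cast hm e he
  have : 0 < enorm2 (toR (prim (e.2 - e.1))) * (m e : ℝ) * segInt e b := by positivity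
  exact this.ne' h1

theorem limit_ne {Ω : Set (ℝ × ℝ)} {P : Finset (ℝ × ℝ)} {φ : ℕ → V → ℤ} {C : Set (ℝ × ℝ)}
    {E : Finset Seg} {H : ℕ → V → ℤ} (c : Ctx Ω P φ C E H) {A : ℤ} (hA0 : 0 ≤ A)
    (hA : ∀ N : ℕ, 1 ≤ N → ∀ v, H N v ≤ A * N) {θ : ℕ → ℕ} (hθ : StrictMono θ) {h : ℝ × ℝ → ℝ}
    (hl : ∀ x ∈ dom Ω P E, Tendsto (fun k => gN H (θ k) x) atTop (𝓝 (h x)))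
    (hE0 : E = ∅) (h0 : ∀ x, h x = 0) : False := by
  obtain ⟨p, hp⟩ := c.hPn
  have hgs : gsupp E = ∅ := by subst hE0; simp [gsupp]
  have hop : IsOpen (interior Ω \ (↑(P.erase p) : Set (ℝ × ℝ))) :=
    isOpen_interior.sdiff (P.erase p).finite_toSet.isClosed
  obtain ⟨r0, hr0, hball0⟩ := Metric.isOpen_iff.1 hop p ⟨c.hP hp, by simp⟩
  obtain ⟨r, hr, rfl⟩ : ∃ r > 0, r0 = 3 * r := ⟨r0 / 3, by linarith, by ring⟩
  set K := Metric.closedBall p (5 / 2 * r) \ Metric.ball p (r / 2) with hK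
  have hKc : IsCompact K := (isCompact_closedBall _ _).diff Metric.isOpen_ball
  have hKd : ∀ x ∈ K, x ∈ dom Ω P E := by
    rintro x ⟨hx1, hx2⟩
    have := hball0 (Metric.closedBall_subset_ball (by linarith) hx1)
    refine ⟨this.1, ?_⟩
    rintro (h | h)
    · rw [hgs] at h; exact h
    · apply this.2
      rw [Finset.mem_coe, Finset.mem_erase]
      refine ⟨?_, h⟩
      rintro rfl
      exact hx2 (Metric.mem_ball_self (by linarith))
  -- local constancy
  have hloc : ∀ x ∈ K, ∃ ε > 0, ∀ᶠ k in atTop, ∀ y ∈ Metric.ball x ε,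
      H (θ k) (flr (θ k) y) = H (θ k) (flr (θ k) x) := by
    intro x hx
    obtain ⟨ε, hε, hsub, a, b, hev, haff⟩ := limit_affine c hA hθ hl (hKd x hx)
    refine ⟨ε, hε, ?_⟩
    have m1 : (x.1 + ε / 2, x.2) ∈ Metric.ball x ε := by
      apply sup_lt <;> simp [abs_of_pos (half_pos hε), hε]
    have m2 : (x.1, x.2 + ε / 2) ∈ Metric.ball x ε := by
      apply sup_lt <;> simp [abs_of_pos (half_pos hε), hε]
    have t1 := haff _ m1
    have t2 := haff _ m2
    simp only [h0, add_sub_cancel_left, sub_self, mul_zero, add_zero, zero_add] at t1 t2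
    have ha : a = 0 := by
      rcases mul_eq_zero.1 t1.symm with h | h
      · exact_mod_cast h
      · linarith
    have hb : b = 0 := by
      rcases mul_eq_zero.1 t2.symm with h | h
      · exact_mod_cast h
      · linarith
    filter_upwards [hev] with k hk y hy
    have := hk y hy
    rw [ha, hb] at this
    linarith
  choose! ε hε hεk using hloc
  obtain ⟨t, htK, htcov⟩ := hKc.elim_nhds_subcover (fun x => Metric.ball x (ε x / 2))
    (fun x hx => Metric.ball_mem_nhds _ (by linarith [hε x hx]))
  have ev1 : ∀ᶠ k in atTop, ∀ x ∈ t, ∀ y ∈ Metric.ball x (ε x),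
      H (θ k) (flr (θ k) y) = H (θ k) (flr (θ k) x) :=
    (eventually_all_finset t).2 fun x hx => hεk x (htK x hx)
  have hth := hθ.tendsto_atTop
  have big : ∀ c : ℝ, ∀ᶠ k in atTop, c < (θ k : ℕ) := fun c =>
    (tendsto_natCast_atTop_atTop.comp hth).eventually_gt_atTop c
  have ev2 : ∀ᶠ k in atTop, ∀ x ∈ t, 1 / (ε x / 2) < (θ k : ℕ) :=
    (eventually_all_finset t).2 fun x hx => big _
  set b : ContDiffBump p := ⟨r, 2 * r, hr, by linarith⟩ with hb
  have hbs : tsupport b = Metric.closedBall p (2 * r) := b.tsupport_eq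
  obtain ⟨k, hk1, hk2, hk3, hk4⟩ :=
    (ev1.and (ev2.and ((big (1 / (r / 2))).and (hth.eventually (eventually_ge_atTop 1))))).exists
  set N := θ k with hNdef
  have hNR : (0:ℝ) < N := by exact_mod_cast hk4
  have hs : 1 / (N:ℝ) < r / 2 := by
    rw [div_lt_iff₀ hNR]; rw [div_lt_iff₀ (by linarith)] at hk3; linarith
  have bd : ∀ x, |gN H N x| ≤ A := fun x => by
    rw [abs_of_nonneg (gN_nonneg c N x)]; exact gN_le hA0 hA N x
  have hbc : HasCompactSupport b := b.hasCompactSupport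
  have zero : ∀ u : ℝ × ℝ, ‖u‖ ≤ 1 / N →
      ∫ x, (gN H N (x + u) + gN H N (x - u) - 2 * gN H N x) * b x = 0 := by
    intro u hu
    rw [(first_parts (gN_meas H N) bd b.continuous hbc u).2]
    rw [← integral_zero (ℝ × ℝ) ℝ]
    congr 1; ext x
    by_cases hx : x ∈ K
    · obtain ⟨y, hy, hxy⟩ := Set.mem_iUnion₂.1 (htcov hx)
      have hεy := hε y (htK y hy)
      have h1 : 1 / (N:ℝ) < ε y / 2 := by
        have := hk2 y hy
        rw [div_lt_iff₀ hNR]; rw [div_lt_iff₀ (by linarith)] at this; linarith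
      have a1 := hk1 y hy x (Metric.ball_subset_ball (by linarith) hxy)
      have a2 := hk1 y hy (x + u) (by
        rw [Metric.mem_ball] at hxy ⊢
        calc dist (x + u) y ≤ dist (x + u) x + dist x y := dist_triangle _ _ _
          _ < ε y := by rw [dist_self_add_left]; linarith)
      unfold gN
      rw [a1, a2]; simp
    · have hd1 : dist (x + u) p ≤ dist x p + 1 / N := by
        calc dist (x + u) p ≤ dist (x + u) x + dist x p := dist_triangle _ _ _
          _ ≤ _ := by rw [dist_self_add_left]; linarith
      have hd2 : dist x p ≤ dist (x + u) p + 1 / N := by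
        calc dist x p ≤ dist x (x + u) + dist (x + u) p := dist_triangle _ _ _
          _ ≤ _ := by rw [dist_self_add_right]; linarith
      by_cases hx2 : x ∈ Metric.ball p (r / 2)
      · rw [Metric.mem_ball] at hx2
        rw [b.one_of_mem_closedBall (x := x) (by
            rw [Metric.mem_closedBall]; show _ ≤ r; linarith),
          b.one_of_mem_closedBall (x := x + u) (by
            rw [Metric.mem_closedBall]; show _ ≤ r; linarith)]
        simp
      · have hx3 : 5 / 2 * r < dist x p := by
          by_contra hcon
          exact hx ⟨Metric.mem_closedBall.2 (not_lt.1 hcon), hx2⟩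
        rw [b.zero_of_le_dist (x := x) (by show 2 * r ≤ _; linarith),
          b.zero_of_le_dist (x := x + u) (by show 2 * r ≤ _; linarith)]
        simp
  have z1 := zero ((1 / (N:ℝ)) • (1, 0)) (by simp [norm_smul, Prod.norm_def])
  have z2 := zero ((1 / (N:ℝ)) • (0, 1)) (by simp [norm_smul, Prod.norm_def])
  have i1 := (first_parts (gN_meas H N) bd b.continuous hbc ((1 / (N:ℝ)) • (1, 0))).1
  have i2 := (first_parts (gN_meas H N) bd b.continuous hbc ((1 / (N:ℝ)) • (0, 1))).1
  have key : ∀ x, (gN H N (x + (1 / (N:ℝ)) • (1, 0)) + gN H N (x - (1 / (N:ℝ)) • (1, 0)) - 2 * gN H N x) * b x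
     + (gN H N (x + (1 / (N:ℝ)) • (0, 1)) + gN H N (x - (1 / (N:ℝ)) • (0, 1)) - 2 * gN H N x) * b x =
     - (-(lapZ (H N) (flr N x) / N * b x)) := by
    intro x
    obtain ⟨a1, a2, a3, a4⟩ := flr_add' N hk4 x
    unfold gN lapZ
    rw [a1, a2, a3, a4]
    push_cast
    field_simp
    ring
  have tot := integral_add i1 i2
  have itot := i1.add i2
  rw [z1, z2, add_zero] at tot
  have itot' : Integrable (fun x => -(-(lapZ (H N) (flr N x) / N * b x : ℝ))) :=
    itot.congr (Eventually.of_forall key)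
  simp only [key] at tot
  rw [integral_neg, neg_eq_zero] at tot
  have inn : ∀ x ∈ tsupport b, flr N x ∈ latGrid Ω N := by
    intro x hx
    rw [hbs, Metric.mem_closedBall] at hx
    rw [mem_latGrid hk4]
    apply interior_subset
    refine (hball0 ?_).1
    obtain ⟨q1, q2⟩ := flr_div N hk4 x
    rw [Metric.mem_ball]
    refine (dist_triangle _ x p).trans_lt ?_
    have : dist (((flr N x).1 : ℝ) / N, ((flr N x).2 : ℝ) / N) x ≤ 1 / N := by
      rw [dist_eq_norm, Prod.norm_def]; exact max_le q1 q2
    linarith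
  have lapneg : ∀ v ∈ latGrid Ω N, lapZ (H N) v ≤ 0 := by
    intro v hv
    have e1 := (c.odo N).eq v hv
    have e2 := (c.odo N).le v hv
    have e3 : 3 ≤ stateN Ω P N v := by
      unfold stateN; rw [if_pos hv]
      have : 0 ≤ ∑ p ∈ P, (if v = flr N p then (1:ℤ) else 0) :=
        Finset.sum_nonneg fun p _ => by split_ifs <;> norm_num
      linarith
    omega
  have lapp : lapZ (H N) (flr N p) ≤ -1 := by
    have hv := inn p (by rw [hbs]; exact Metric.mem_closedBall_self (by linarith))
    have e1 := (c.odo N).eq _ hv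
    have e2 := (c.odo N).le _ hv
    have e3 : 4 ≤ stateN Ω P N (flr N p) := by
      unfold stateN; rw [if_pos hv]
      have : (if flr N p = flr N p then (1:ℤ) else 0) ≤
          ∑ q ∈ P, (if flr N p = flr N q then (1:ℤ) else 0) :=
        Finset.single_le_sum (f := fun q => if flr N p = flr N q then (1:ℤ) else 0)
          (fun q _ => by split_ifs <;> norm_num) hp
      rw [if_pos rfl] at this
      linarith
    omega
  have nonneg : 0 ≤ fun x => (-(lapZ (H N) (flr N x) / N * b x) : ℝ) := by
    intro x
    show (0:ℝ) ≤ -(lapZ (H N) (flr N x) / N * b x)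
    by_cases hx : x ∈ tsupport b
    · have h1 : ((lapZ (H N) (flr N x) : ℤ) : ℝ) ≤ 0 := by exact_mod_cast lapneg _ (inn x hx)
      have h2 : 0 ≤ b x := b.nonneg
      have h3 : ((lapZ (H N) (flr N x) : ℤ) : ℝ) / N ≤ 0 := div_nonpos_of_nonpos_of_nonneg h1 hNR.le
      nlinarith
    · rw [image_eq_zero_of_notMem_tsupport hx]; simp
  have int2 : Integrable (fun x => (-(lapZ (H N) (flr N x) / N * b x) : ℝ)) := by
    simpa using itot'.neg
  have ae0 := (integral_eq_zero_iff_of_nonneg nonneg int2).1 tot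
  refine cell_pos N hk4 (flr N p) (measure_mono_null ?_ ae0)
  intro x hx
  have hx' : flr N x = flr N p := hx
  show ¬ ((-(lapZ (H N) (flr N x) / N * b x) : ℝ) = 0)
  rw [hx']
  have hb1 : b x = 1 := by
    apply b.one_of_mem_closedBall
    show dist x p ≤ r
    obtain ⟨q1, q2⟩ := flr_div N hk4 x
    obtain ⟨q3, q4⟩ := flr_div N hk4 p
    rw [hx'] at q1 q2
    rw [dist_eq_norm, Prod.norm_def]
    rw [abs_le] at q1 q2 q3 q4
    refine max_le ?_ ?_ <;> rw [Real.norm_eq_abs, abs_le] <;> constructor <;> simp <;>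
      linarith [q1.1, q1.2, q2.1, q2.2, q3.1, q3.2, q4.1, q4.2]
  rw [hb1, mul_one, neg_eq_zero, div_eq_zero_iff, not_or]
  refine ⟨?_, hNR.ne'⟩
  intro h
  have : lapZ (H N) (flr N p) = 0 := by exact_mod_cast h
  omega

/-- the properties of a scaling limit of the odometer -/
structure Lim (Ω : Set (ℝ × ℝ)) (P : Finset (ℝ × ℝ)) (E : Finset Seg) (m : Seg → ℕ)
    (h : ℝ × ℝ → ℝ) : Prop where
  meas : Measurable h
  nonneg : ∀ x, 0 ≤ h x
  bdd : ∃ C, ∀ x, h x ≤ C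
  off : ∀ x ∉ dom Ω P E, h x = 0
  aff : ∀ x ∈ dom Ω P E, ∃ ε > 0, Metric.ball x ε ⊆ dom Ω P E ∧ ∃ a b : ℤ, ∀ y ∈ Metric.ball x ε,
      h y = h x + a * (y.1 - x.1) + b * (y.2 - x.2)
  weak : ∀ ψ, TestFun Ω ψ → ∫ x, h x * lap ψ x = - tropPairing E m ψ
  bar : ∀ n : ℤ × ℤ, n ≠ 0 → ∀ c : ℤ, (∀ x ∈ Ω, (c:ℝ) ≤ dot (toR n) x) →
    ∃ K : ℝ, 0 ≤ K ∧ ∀ x ∈ Ω, h x ≤ K * (dot (toR n) x - c)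
  ne : ∃ x, h x ≠ 0

theorem exists_lim {Ω : Set (ℝ × ℝ)} {P : Finset (ℝ × ℝ)} {φ : ℕ → V → ℤ} {C : Set (ℝ × ℝ)}
    {E : Finset Seg} {H : ℕ → V → ℤ} (c : Ctx Ω P φ C E H) {m : Seg → ℕ}
    (hE : EdgeSet E) (hPl : Planar E) (hR : ∀ e ∈ E, RatDir (e.2 - e.1)) (hm : ∀ e ∈ E, 0 < m e)
    (hW : WeakLimit Ω φ E m) : ∃ h, Lim Ω P E m h := by
  have hΩ := poly_body c.poly
  obtain ⟨R, hR0⟩ := hΩ.cpt.isBounded.exists_norm_le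
  have hex : ∃ A : ℤ, 0 ≤ A ∧ ∀ N : ℕ, 1 ≤ N → ∀ v, H N v ≤ A * N := by
    obtain ⟨A, K, hA, -, hb⟩ := barrier hΩ c.hP (n := (1, 0)) (by simp) (c := -⌈R⌉) (by
      intro x hx
      have h1 := hR0 x hx
      have h2 : |x.1| ≤ ‖x‖ := norm_fst_le x
      have h3 := Int.le_ceil R
      simp only [dot, toR]
      push_cast
      linarith [neg_abs_le x.1])
    refine ⟨A, hA, fun N hN v => ?_⟩
    by_cases hv : v ∈ latGrid Ω N
    · exact (hb N hN _ _ (c.odo N) v hv).1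
    · rw [(c.odo N).off v hv]; positivity
  obtain ⟨A, hA0, hA⟩ := hex
  obtain ⟨θ, hθ, h, hmeas, hoff, hl⟩ := sub_limit c hA0 hA
  have hbd : ∀ N x, |gN H N x| ≤ (A:ℝ) := fun N x => by
    rw [abs_of_nonneg (gN_nonneg c N x)]; exact gN_le hA0 hA N x
  have hw : ∀ ψ, TestFun Ω ψ → ∫ x, h x * lap ψ x = - tropPairing E m ψ :=
    fun ψ hψ => weak_lap c hW hbd hθ hl hψ
  refine ⟨h, hmeas, ?_, ⟨A, ?_⟩, hoff, ?_, hw, ?_, ?_⟩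
  · intro x
    by_cases hx : x ∈ dom Ω P E
    · exact ge_of_tendsto' (hl x hx) fun k => gN_nonneg c _ _
    · rw [hoff x hx]
  · intro x
    by_cases hx : x ∈ dom Ω P E
    · exact le_of_tendsto' (hl x hx) fun k => gN_le hA0 hA _ _
    · rw [hoff x hx]; exact_mod_cast hA0
  · intro x hx
    obtain ⟨ε, hε, hsub, a, b, -, haff⟩ := limit_affine c hA hθ hl hx
    exact ⟨ε, hε, hsub, a, b, haff⟩
  · intro n hn c' hc
    obtain ⟨A', K, -, hK, hb⟩ := barrier hΩ c.hP hn hc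
    refine ⟨K, by exact_mod_cast hK, fun x hx => ?_⟩
    have hKR : (0:ℝ) ≤ K := by exact_mod_cast hK
    by_cases hd : x ∈ dom Ω P E
    · obtain ⟨t1, t2⟩ := flr_tendsto x
      have u1 := t1.comp hθ.tendsto_atTop
      have u2 := t2.comp hθ.tendsto_atTop
      have u3 := (tendsto_one_div_atTop_nhds_zero_nat (𝕜 := ℝ)).comp hθ.tendsto_atTop
      have lim : Tendsto (fun k => (K:ℝ) * (n.1 * (((flr (θ k) x).1 : ℝ) / (θ k : ℕ)) +
          n.2 * (((flr (θ k) x).2 : ℝ) / (θ k : ℕ)) - c' +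
          (|n.1| + |n.2| : ℤ) * (1 / ((θ k : ℕ) : ℝ)))) atTop
          (𝓝 (K * (n.1 * x.1 + n.2 * x.2 - c' + (|n.1| + |n.2| : ℤ) * 0))) :=
        ((((u1.const_mul (n.1:ℝ)).add (u2.const_mul (n.2:ℝ))).sub_const _).add
          (u3.const_mul _)).const_mul _
      rw [mul_zero, add_zero] at lim
      refine le_of_tendsto_of_tendsto (hl x hd) lim ?_
      obtain ⟨δ, hδ, hball⟩ := Metric.isOpen_iff.1 isOpen_interior x hd.1
      have e1 : ∀ᶠ k in atTop, 1 / δ < (θ k : ℕ) :=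
        (tendsto_natCast_atTop_atTop.comp hθ.tendsto_atTop).eventually_gt_atTop _
      filter_upwards [hθ.tendsto_atTop.eventually (eventually_ge_atTop 1), e1] with k hk h1
      have hNR : (0:ℝ) < (θ k : ℕ) := by exact_mod_cast hk
      have hin : flr (θ k) x ∈ latGrid Ω (θ k) := by
        rw [mem_latGrid hk]
        apply interior_subset
        apply hball
        obtain ⟨q1, q2⟩ := flr_div (θ k) hk x
        have : 1 / ((θ k : ℕ):ℝ) < δ := by
          rw [div_lt_iff₀ hNR]; rw [div_lt_iff₀ hδ] at h1; linarith
        exact sup_lt (q1.trans_lt this) (q2.trans_lt this)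
      have := (hb (θ k) hk _ _ (c.odo _) _ hin).2
      have this' : (H (θ k) (flr (θ k) x) : ℝ) ≤ K * (n.1 * (flr (θ k) x).1 + n.2 * (flr (θ k) x).2 -
        (θ k : ℕ) * c' + (|n.1| + |n.2| : ℤ)) := by exact_mod_cast this
      unfold gN
      rw [div_le_iff₀ hNR]
      refine this'.trans (le_of_eq ?_)
      field_simp
    · rw [hoff x hd]
      exact mul_nonneg hKR (sub_nonneg.2 (hc x hx))
  · by_contra hcon
    push Not at hcon
    refine limit_ne c hA0 hA hθ hl (trop_pos hΩ hE hPl c.hS hR hm fun ψ hψ => ?_) hcon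
    have := hw ψ hψ
    simp only [hcon, zero_mul, integral_zero] at this
    linarith

theorem aff_unique {a b c a' b' c' : ℝ} {x : ℝ × ℝ}
    (h : ∀ᶠ y : ℝ × ℝ in 𝓝 x, a * y.1 + b * y.2 + c = a' * y.1 + b' * y.2 + c') :
    a = a' ∧ b = b' ∧ c = c' := by
  obtain ⟨ε, hε, hb⟩ := Metric.eventually_nhds_iff_ball.1 h
  have m1 : (x.1 + ε / 2, x.2) ∈ Metric.ball x ε := by
    apply sup_lt <;> simp [abs_of_pos (half_pos hε), hε]
  have m2 : (x.1, x.2 + ε / 2) ∈ Metric.ball x ε := by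
    apply sup_lt <;> simp [abs_of_pos (half_pos hε), hε]
  have t0 := hb x (Metric.mem_ball_self hε)
  have t1 := hb _ m1
  have t2 := hb _ m2
  simp only at t1 t2
  have r1 : a = a' := by
    have : (a - a' : ℝ) * (ε / 2) = 0 := by linarith
    rcases mul_eq_zero.1 this with h | h <;> linarith
  have r2 : b = b' := by
    have : (b - b' : ℝ) * (ε / 2) = 0 := by linarith
    rcases mul_eq_zero.1 this with h | h <;> linarith
  subst r1 r2
  exact ⟨rfl, rfl, by linarith⟩

theorem aff_conn {Ω : Set (ℝ × ℝ)} {P : Finset (ℝ × ℝ)} {E : Finset Seg} {m : Seg → ℕ}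
    {h : ℝ × ℝ → ℝ} (L : Lim Ω P E m h) {S : Set (ℝ × ℝ)} (hS : IsPreconnected S)
    (hSd : S ⊆ dom Ω P E) : ∃ (a b : ℤ) (c : ℝ), ∀ x ∈ S, ∀ᶠ y in 𝓝 x, h y = a * y.1 + b * y.2 + c := by
  have loc : ∀ x ∈ dom Ω P E, ∃ (a b : ℤ) (c : ℝ), ∀ᶠ y in 𝓝 x, h y = a * y.1 + b * y.2 + c := by
    intro x hx
    obtain ⟨ε, hε, -, a, b, hab⟩ := L.aff x hx
    refine ⟨a, b, h x - a * x.1 - b * x.2, ?_⟩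
    filter_upwards [Metric.ball_mem_nhds x hε] with y hy
    rw [hab y hy]; ring
  rcases S.eq_empty_or_nonempty with rfl | ⟨x0, hx0⟩
  · exact ⟨0, 0, 0, fun x hx => absurd hx (Set.notMem_empty x)⟩
  obtain ⟨a, b, c, h0⟩ := loc x0 (hSd hx0)
  refine ⟨a, b, c, ?_⟩
  set T : Set (ℝ × ℝ) := {x | ∀ᶠ y in 𝓝 x, h y = a * y.1 + b * y.2 + c}
  set W : Set (ℝ × ℝ) := ⋃ q ∈ {q : ℤ × ℤ × ℝ | q ≠ (a, b, c)},
    {x | ∀ᶠ y in 𝓝 x, h y = q.1 * y.1 + q.2.1 * y.2 + q.2.2}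
  have hT : IsOpen T := isOpen_setOfPred_eventually_nhds
  have hW : IsOpen W := isOpen_biUnion fun q _ => isOpen_setOfPred_eventually_nhds
  have hdisj : Disjoint T W := by
    rw [Set.disjoint_left]
    intro x hx hx'
    obtain ⟨q, hq, hx'⟩ := Set.mem_iUnion₂.1 hx'
    have e : ∀ᶠ y : ℝ × ℝ in 𝓝 x, (q.1:ℝ) * y.1 + q.2.1 * y.2 + q.2.2 = a * y.1 + b * y.2 + c := by
      filter_upwards [hx, hx'] with y h1 h2
      rw [← h1, ← h2]
    obtain ⟨e1, e2, e3⟩ := aff_unique e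
    exact hq (Prod.ext (by exact_mod_cast e1) (Prod.ext (by exact_mod_cast e2) e3))
  have hcov : S ⊆ T ∪ W := by
    intro x hx
    obtain ⟨a', b', c', h'⟩ := loc x (hSd hx)
    by_cases hq : (a', b', c') = (a, b, c)
    · left
      simp only [Prod.mk.injEq] at hq
      obtain ⟨rfl, rfl, rfl⟩ := hq
      exact h'
    · right
      exact Set.mem_iUnion₂.2 ⟨(a', b', c'), hq, h'⟩
  exact fun x hx => (hS.subset_left_of_subset_union (u := T) (v := W) hT hW hdisj hcov
    ⟨x0, hx0, h0⟩ hx)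

theorem conic {E : Finset Seg} {v : ℝ × ℝ} (hv : ∀ e ∈ E, v ∈ seg e → e.1 = v ∨ e.2 = v)
    (hE : EdgeSet E) :
    ∃ r > 0, ∀ z : ℝ × ℝ, ‖z‖ < r → ∀ t ∈ Set.Ioc (0:ℝ) 1,
      (v + t • z ∈ gsupp E ↔ v + z ∈ gsupp E) := by
  have one : ∀ w : ℝ × ℝ, w ≠ v → ∀ z : ℝ × ℝ, ‖z‖ < ‖w - v‖ → ∀ t ∈ Set.Ioc (0:ℝ) 1,
      (v + t • z ∈ segment ℝ v w ↔ v + z ∈ segment ℝ v w) := by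
    intro w hw z hz t ht
    have hwn : 0 < ‖w - v‖ := norm_pos_iff.2 (sub_ne_zero.2 hw)
    simp only [segment_eq_image', Set.mem_image, add_right_inj]
    constructor
    · rintro ⟨s, hs, he⟩
      have hz' : z = (s / t) • (w - v) := by
        rw [div_eq_inv_mul, mul_smul, he, smul_smul, inv_mul_cancel₀ ht.1.ne', one_smul]
      have h0 : 0 ≤ s / t := div_nonneg hs.1 ht.1.le
      refine ⟨s / t, ⟨h0, ?_⟩, hz'.symm⟩
      rw [hz', norm_smul, Real.norm_eq_abs, abs_of_nonneg h0] at hz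
      by_contra hcon
      push Not at hcon
      nlinarith
    · rintro ⟨s, hs, he⟩
      refine ⟨t * s, ⟨mul_nonneg ht.1.le hs.1, ?_⟩, by rw [mul_smul, he]⟩
      have := hs.2; have := hs.1; have := ht.2; have := ht.1
      nlinarith
  have hev : ∀ e ∈ E, ∀ᶠ r in 𝓝[>] (0:ℝ), ∀ z : ℝ × ℝ, ‖z‖ < r → ∀ t ∈ Set.Ioc (0:ℝ) 1,
      (v + t • z ∈ seg e ↔ v + z ∈ seg e) := by
    intro e he
    by_cases hve : v ∈ seg e
    · rcases hv e he hve with h | h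
      · have hne : e.2 ≠ v := fun h' => (hE e he).1 (h.trans h'.symm)
        filter_upwards [Ioo_mem_nhdsGT (norm_pos_iff.2 (sub_ne_zero.2 hne))] with r hr z hz t ht
        have := one e.2 hne z (hz.trans hr.2) t ht
        unfold seg; rw [h]; exact this
      · have hne : e.1 ≠ v := fun h' => (hE e he).1 (h'.trans h.symm)
        filter_upwards [Ioo_mem_nhdsGT (norm_pos_iff.2 (sub_ne_zero.2 hne))] with r hr z hz t ht
        have := one e.1 hne z (hz.trans hr.2) t ht
        unfold seg; rw [h, segment_symm]; exact this
    · have hop : IsOpen (seg e)ᶜ := (seg_closed e.1 e.2).isOpen_compl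
      obtain ⟨δ, hδ, hb⟩ := Metric.isOpen_iff.1 hop v hve
      filter_upwards [Ioo_mem_nhdsGT hδ] with r hr z hz t ht
      have h1 : v + z ∉ seg e := hb (by simp [Metric.mem_ball]; linarith [hr.2])
      have h2 : v + t • z ∉ seg e := hb (by
        rw [Metric.mem_ball, dist_self_add_left, norm_smul, Real.norm_eq_abs, abs_of_pos ht.1]
        have := ht.2; have := norm_nonneg z; have := hr.2
        nlinarith)
      exact iff_of_false h2 h1
  have hall := (eventually_all_finset E).2 hev
  obtain ⟨r, hr, hr0⟩ := (hall.and self_mem_nhdsWithin).exists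
  refine ⟨r, hr0, fun z hz t ht => ?_⟩
  simp only [mem_gsupp]
  exact exists_congr fun e => and_congr_right fun he => hr e he z hz t ht

theorem Lim.exists_bd {Ω : Set (ℝ × ℝ)} {P : Finset (ℝ × ℝ)} {E : Finset Seg} {m : Seg → ℕ}
    {h : ℝ × ℝ → ℝ} (L : Lim Ω P E m h) : ∃ C : ℝ, 0 ≤ C ∧ ∀ x, |h x| ≤ C := by
  obtain ⟨C, hC⟩ := L.bdd
  exact ⟨C, (L.nonneg 0).trans (hC 0), fun x => by rw [abs_of_nonneg (L.nonneg x)]; exact hC x⟩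

theorem tsupport_shift {ψ : ℝ × ℝ → ℝ} {v : ℝ × ℝ} {r : ℝ} (h : tsupport ψ ⊆ Metric.ball 0 r) :
    tsupport (fun x => ψ (-v + x)) ⊆ Metric.ball v r := by
  intro x hx
  have := h (tsupport_comp_subset_preimage ψ (f := fun x : ℝ × ℝ => -v + x) (by fun_prop) hx)
  rw [mem_ball_zero_iff] at this
  rw [Metric.mem_ball, dist_eq_norm, sub_eq_neg_add]; exact this

open Classical in
theorem weak_at {Ω : Set (ℝ × ℝ)} {P : Finset (ℝ × ℝ)} {E : Finset Seg} {m : Seg → ℕ}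
    {h : ℝ × ℝ → ℝ} (L : Lim Ω P E m h) (hR : ∀ e ∈ E, RatDir (e.2 - e.1)) {v : ℝ × ℝ}
    (hvi : v ∈ interior Ω) (hv : ∀ e ∈ E, v ∈ seg e → e.1 = v ∨ e.2 = v) :
    ∃ r > 0, ∀ ψ, Sm ψ → HasCompactSupport ψ → tsupport ψ ⊆ Metric.ball 0 r →
      ∫ z, h (v + z) * lap ψ z = -∑ e ∈ E.filter (fun e => e.1 = v ∨ e.2 = v),
        (m e : ℝ) * rho (toR (outDir v e)) * ∫ s in Set.Ioi (0:ℝ), ψ (s • toR (outDir v e)) := by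
  obtain ⟨r1, hr1, H1⟩ := local_pairing m hR hv
  obtain ⟨r2, hr2, H2⟩ := Metric.isOpen_iff.1 isOpen_interior v hvi
  refine ⟨min r1 r2, lt_min hr1 hr2, fun ψ hψ hs ht => ?_⟩
  have e1 : ∫ z, h (v + z) * lap ψ z = ∫ x, h x * lap (fun x => ψ (-v + x)) x := by
    rw [← integral_add_left_eq_self (fun x => h x * lap (fun x => ψ (-v + x)) x) v]
    congr 1; ext z
    rw [lap_comp_add, neg_add_cancel_left]
  have t := tsupport_shift (v := v) ht
  have h2 := L.weak (fun x => ψ (-v + x))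
    ⟨hψ.comp_add (-v), t.trans ((Metric.ball_subset_ball (min_le_right _ _)).trans H2)⟩
  have h1 := H1 (fun x => ψ (-v + x)) (t.trans (Metric.ball_subset_ball (min_le_left _ _)))
  rw [e1, h2, h1]
  simp

theorem int_bal {Ω : Set (ℝ × ℝ)} {P : Finset (ℝ × ℝ)} {E : Finset Seg} {m : Seg → ℕ}
    {h : ℝ × ℝ → ℝ} (L : Lim Ω P E m h) (hE : EdgeSet E) (hR : ∀ e ∈ E, RatDir (e.2 - e.1))
    {v : ℝ × ℝ}
    (hvi : v ∈ interior Ω) (hv : ∀ e ∈ E, v ∈ seg e → e.1 = v ∨ e.2 = v) :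
    balSum E m v = 0 := by
  classical
  obtain ⟨r1, hr1, H1⟩ := weak_at L hR hvi hv
  obtain ⟨r2, hr2, H2⟩ := conic hv hE
  obtain ⟨r3, hr3, H3⟩ := Metric.isOpen_iff.1 isOpen_interior v hvi
  obtain ⟨r4, hr4, H4⟩ : ∃ r > 0, ∀ p ∈ P, ‖p - v‖ < r → p = v := by
    have hf : ((↑P : Set (ℝ × ℝ)) \ {v}).Finite := P.finite_toSet.sdiff
    obtain ⟨r, hr, hb⟩ := Metric.isOpen_iff.1 hf.isClosed.isOpen_compl v (by simp)
    refine ⟨r, hr, fun p hp hpr => ?_⟩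
    by_contra hne
    exact hb (show p ∈ Metric.ball v r by rw [Metric.mem_ball, dist_eq_norm]; exact hpr)
      ⟨hp, hne⟩
  obtain ⟨C, hC0, hC⟩ := L.exists_bd
  set r := min (min r1 r2) (min r3 r4) with hrdef
  have hr : 0 < r := lt_min (lt_min hr1 hr2) (lt_min hr3 hr4)
  have hle1 : r ≤ r1 := (min_le_left _ _).trans (min_le_left _ _)
  have hle2 : r ≤ r2 := (min_le_left _ _).trans (min_le_right _ _)
  have hle3 : r ≤ r3 := (min_le_right _ _).trans (min_le_left _ _)
  have hle4 : r ≤ r4 := (min_le_right _ _).trans (min_le_right _ _)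
  set b : ℝ × ℝ → ℝ := fun z => 2 * (h (v + z) - h (v + (1/2:ℝ) • z)) with hb
  have hbm : Measurable b :=
    ((L.meas.comp (measurable_const_add v)).sub
      (L.meas.comp ((measurable_const_add v).comp (measurable_const_smul (1/2:ℝ))))).const_mul 2
  have hbb : ∀ z, ‖z‖ < r / 2 → |b z| ≤ (2 * C * 2 / (r / 2)) * ‖z‖ := by
    intro z hz
    by_cases hz0 : z = 0
    · simp [hb, hz0]
    have hzn : 0 < ‖z‖ := norm_pos_iff.2 hz0
    set t := ‖z‖ / (r / 2) with ht
    have ht0 : 0 < t := by positivity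
    have ht1 : t ≤ 1 := by rw [ht, div_le_one (by positivity)]; exact hz.le
    set z' := t⁻¹ • z with hz'
    have hzz : z = t • z' := by rw [hz', smul_smul, mul_inv_cancel₀ ht0.ne', one_smul]
    have hz'n : ‖z'‖ = r / 2 := by
      rw [hz', norm_smul, Real.norm_eq_abs, abs_of_pos (inv_pos.2 ht0), ht]
      field_simp
    have hz'r : ‖z'‖ < r := by rw [hz'n]; linarith
    have hc : ∀ s ∈ Set.Ioc (0:ℝ) 1, (v + s • z' ∈ gsupp E ↔ v + z' ∈ gsupp E) :=
      fun s hs => H2 z' (hz'r.trans_le hle2) s hs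
    have hmt : t ∈ Set.Ioc (0:ℝ) 1 := ⟨ht0, ht1⟩
    have hmt2 : t / 2 ∈ Set.Ioc (0:ℝ) 1 := ⟨by linarith, by linarith⟩
    have ez2 : v + (1/2:ℝ) • z = v + (t/2) • z' := by rw [hzz, smul_smul]; ring_nf
    by_cases hG : v + z' ∈ gsupp E
    · have h1 : h (v + z) = 0 := L.off _ fun hd => hd.2 (Or.inl (by rw [hzz]; exact (hc t hmt).2 hG))
      have h2 : h (v + (1/2:ℝ) • z) = 0 :=
        L.off _ fun hd => hd.2 (Or.inl (by rw [ez2]; exact (hc _ hmt2).2 hG))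
      simp only [hb, h1, h2]; simp; positivity
    · have hSd : (fun s : ℝ => v + s • z') '' Set.Ioc (0:ℝ) 1 ⊆ dom Ω P E := by
        rintro _ ⟨s, hs, rfl⟩
        have hsn : ‖s • z'‖ < r := by
          rw [norm_smul, Real.norm_eq_abs, abs_of_pos hs.1]
          have := hs.2; have := norm_nonneg z'
          nlinarith
        refine ⟨H3 (by rw [Metric.mem_ball, dist_self_add_left]; linarith), ?_⟩
        rintro (hg | hp)
        · exact hG ((hc s hs).1 hg)
        · have := H4 _ hp (by rw [add_sub_cancel_left]; linarith)
          have h0 : s • z' = 0 := by simpa using this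
          rcases smul_eq_zero.1 h0 with h0 | h0
          · exact hs.1.ne' h0
          · rw [h0, norm_zero] at hz'n; linarith
      obtain ⟨a, b', c, hab⟩ := aff_conn L
        (isPreconnected_Ioc.image _ (by fun_prop)) hSd
      have hval : ∀ s ∈ Set.Ioc (0:ℝ) 1, h (v + s • z') =
          a * (v.1 + s * z'.1) + b' * (v.2 + s * z'.2) + c := fun s hs =>
        (hab _ ⟨s, hs, rfl⟩).self_of_nhds
      have v1 := hval 1 ⟨by norm_num, le_rfl⟩
      have v2 := hval (1/2) ⟨by norm_num, by norm_num⟩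
      have v3 := hval t hmt
      have v4 := hval (t/2) hmt2
      have eb : b z = t * (2 * (h (v + (1:ℝ) • z') - h (v + (1/2:ℝ) • z'))) := by
        simp only [hb]
        rw [ez2, v1, v2, v4]
        conv_lhs => rw [hzz]
        rw [v3]; ring
      rw [eb, abs_mul, abs_of_pos ht0]
      have h1 := hC (v + (1:ℝ) • z')
      have h2 := hC (v + (1/2:ℝ) • z')
      have h3 : |2 * (h (v + (1:ℝ) • z') - h (v + (1/2:ℝ) • z'))| ≤ 2 * C * 2 := by
        rw [abs_mul, abs_two]
        have := abs_sub (h (v + (1:ℝ) • z')) (h (v + (1/2:ℝ) • z'))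
        linarith
      calc t * _ ≤ t * (2 * C * 2) := by gcongr
        _ = _ := by rw [ht]; ring
  have hbal := balance (E.filter (fun e => e.1 = v ∨ e.2 = v)) (fun e => (m e : ℝ))
    (fun e => toR (outDir v e))
    (fun e he => by
      obtain ⟨he, h'⟩ := Finset.mem_filter.1 he
      obtain ⟨b, hb, -⟩ := outDir_prim hR he h'
      exact hb.ne) b hbm.aestronglyMeasurable (half_pos hr) hbb (by
    intro ψ hψ hs ht h0
    have hsc := H1 ψ hψ hs (ht.trans (Metric.ball_subset_ball (by linarith)))
    set χ : ℝ × ℝ → ℝ := fun x => ψ ((2:ℝ) • x) with hχ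
    have hχs : tsupport χ ⊆ Metric.ball 0 r1 := by
      intro x hx
      have := ht (tsupport_comp_subset_preimage ψ (f := fun x : ℝ × ℝ => (2:ℝ) • x) (by fun_prop) hx)
      simp only [mem_ball_zero_iff, norm_smul] at this ⊢
      simp at this
      have := norm_nonneg x
      linarith
    have hχc : HasCompactSupport χ :=
      hs.comp_homeomorph (Homeomorph.smulOfNeZero (2:ℝ) two_ne_zero)
    have hsc2 := H1 χ (hψ.comp_smul 2) hχc hχs
    have i1 : Integrable (fun z => h (v + z) * lap ψ z) :=
      bdd_mul_int (L.meas.comp (measurable_const_add v)) (fun x => hC _) hψ.lap.continuous hs.lap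
    have i2 : Integrable (fun z => h (v + (1/2:ℝ) • z) * lap ψ z) :=
      bdd_mul_int (L.meas.comp ((measurable_const_add v).comp (measurable_const_smul (1/2:ℝ))))
        (fun x => hC _) hψ.lap.continuous hs.lap
    have e2 : ∫ z, h (v + z) * lap χ z = ∫ z, h (v + (1/2:ℝ) • z) * lap ψ z := by
      have := Measure.integral_comp_smul (volume : Measure (ℝ × ℝ))
        (fun z => h (v + (1/2:ℝ) • z) * lap ψ z) (2:ℝ)
      simp only [hχ, lap_comp_smul hψ]
      have hfr : Module.finrank ℝ (ℝ × ℝ) = 2 := by simp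
      rw [hfr] at this
      have e3 : ∀ z : ℝ × ℝ, h (v + z) * (2^2 * lap ψ ((2:ℝ) • z)) =
          4 * (h (v + (1/2:ℝ) • (2:ℝ) • z) * lap ψ ((2:ℝ) • z)) := by
        intro z; rw [smul_smul]; norm_num; ring
      simp_rw [e3]
      rw [integral_const_mul, this, smul_eq_mul, abs_of_pos (by positivity)]
      ring
    have e4 : ∀ l : ℝ × ℝ, ∫ s in Set.Ioi (0:ℝ), χ (s • l) =
        (1/2) * ∫ s in Set.Ioi (0:ℝ), ψ (s • l) := by
      intro l
      have := integral_comp_mul_left_Ioi (fun s => ψ (s • l)) 0 (b := 2) two_pos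
      simp only [hχ, smul_smul]
      rw [this]; simp
    have e5 : ∀ z, b z * lap ψ z =
        2 * (h (v + z) * lap ψ z - h (v + (1/2:ℝ) • z) * lap ψ z) := by
      intro z; simp only [hb]; ring
    simp_rw [e5]
    rw [integral_const_mul, integral_sub i1 i2, ← e2, hsc, hsc2]
    simp_rw [e4]
    rw [← Finset.sum_neg_distrib, ← Finset.sum_neg_distrib, ← Finset.sum_sub_distrib,
      Finset.mul_sum]
    refine Finset.sum_congr rfl fun e _ => ?_
    ring)
  have g1 := congrArg Prod.fst hbal
  have g2 := congrArg Prod.snd hbal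
  unfold balSum
  simp only [Prod.fst_sum, Prod.snd_sum, toR, Prod.smul_mk, smul_eq_mul, Prod.fst_zero,
    Prod.snd_zero] at g1 g2
  refine Prod.ext ?_ ?_
  · simp only [Prod.fst_sum, Prod.smul_fst, smul_eq_mul, Prod.fst_zero]
    exact_mod_cast g1
  · simp only [Prod.snd_sum, Prod.smul_snd, smul_eq_mul, Prod.snd_zero]
    exact_mod_cast g2

theorem trop_add (E : Finset Seg) (m : Seg → ℕ) {ψ χ : ℝ × ℝ → ℝ} (hψ : Continuous ψ)
    (hχ : Continuous χ) :
    tropPairing E m (fun x => ψ x + χ x) = tropPairing E m ψ + tropPairing E m χ := by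
  unfold tropPairing
  rw [← Finset.sum_add_distrib]
  refine Finset.sum_congr rfl fun e _ => ?_
  unfold segInt
  rw [intervalIntegral.integral_add]
  · ring
  · exact (by fun_prop : Continuous fun t : ℝ => ψ (e.1 + t • (e.2 - e.1))).intervalIntegrable _ _
  · exact (by fun_prop : Continuous fun t : ℝ => χ (e.1 + t • (e.2 - e.1))).intervalIntegrable _ _

theorem trop_zero (E : Finset Seg) (m : Seg → ℕ) {ψ : ℝ × ℝ → ℝ} (h : ∀ x ∈ gsupp E, ψ x = 0) :
    tropPairing E m ψ = 0 := by
  unfold tropPairing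
  refine Finset.sum_eq_zero fun e he => ?_
  rw [segInt_zero fun x hx => h x (mem_gsupp.2 ⟨e, he, hx⟩), mul_zero]

theorem ray_closed (v l : ℝ × ℝ) {S : Set ℝ} (hS : IsClosed S) :
    IsClosed ((fun s : ℝ => v + s • l) '' S) := by
  have h1 : IsClosed ((fun s : ℝ => s • l) '' S) := isClosedMap_smul_left l S hS
  have : (fun s : ℝ => v + s • l) '' S = (Homeomorph.addLeft v) '' ((fun s : ℝ => s • l) '' S) := by
    rw [Set.image_image]; rfl
  rw [this]
  exact (Homeomorph.addLeft v).isClosedMap _ h1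

theorem line_integrable {ψ : ℝ × ℝ → ℝ} (hψ : Continuous ψ) (hs : HasCompactSupport ψ)
    (v : ℝ × ℝ) {l : ℝ × ℝ} (hl : l ≠ 0) : Integrable (fun s : ℝ => ψ (v + s • l)) := by
  have hc : HasCompactSupport (fun s : ℝ => ψ (v + s • l)) := by
    refine hs.comp_isClosedEmbedding (f := ψ) (g := fun s : ℝ => v + s • l) ?_
    exact (Homeomorph.addLeft v).isClosedEmbedding.comp (isClosedEmbedding_smul_left hl)
  exact (by fun_prop : Continuous fun s : ℝ => ψ (v + s • l)).integrable_of_hasCompactSupport hc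

theorem bool_other {i j : Bool} (h : j ≠ i) : j = !i := by
  revert i j; decide

set_option maxHeartbeats 1000000 in
open Classical in
theorem bdy_bal {Ω : Set (ℝ × ℝ)} {P : Finset (ℝ × ℝ)} {E : Finset Seg} {m : Seg → ℕ}
    {h : ℝ × ℝ → ℝ} (L : Lim Ω P E m h) (hΩ : IsClosed Ω) (hEΩ : gsupp E ⊆ Ω)
    (hR : ∀ e ∈ E, RatDir (e.2 - e.1)) {v : ℝ × ℝ}
    (hv : ∀ e ∈ E, v ∈ seg e → e.1 = v ∨ e.2 = v)
    {r C : ℝ} (hr : 0 < r) (l : Bool → ℝ × ℝ) (d σ : Bool → ℝ)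
    (hl : ∀ i, l i ≠ 0) (hσ : ∀ i, σ i = 1 ∨ σ i = -1)
    (hray : ∀ i, ∀ s : ℝ, 0 < s → v + s • l i ∈ Metric.ball v r → v + s • l i ∈ frontier Ω ∧
      ∀ᶠ y in 𝓝 (v + s • l i), h y = d i * max 0 (σ i * crs (l i) (y - v)))
    (hfr : ∀ x ∈ Metric.ball v r, x ∈ frontier Ω → x ≠ v → ∃ i, ∃ s : ℝ, 0 < s ∧ x = v + s • l i)
    (hdis : ∀ i j, i ≠ j → ∀ s t : ℝ, 0 < s → 0 < t → s • l i ≠ t • l j)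
    (hG : ∀ x ∈ Metric.ball v r, x ∈ frontier Ω → x ≠ v → x ∉ gsupp E)
    (hbd : ∀ z, ‖z‖ < r → |h (v + z)| ≤ C * ‖z‖) :
    ∑ e ∈ E.filter (fun e => e.1 = v ∨ e.2 = v), (m e : ℝ) • toR (outDir v e) =
      ∑ i, d i • l i := by
  obtain ⟨r1, hr1, H1⟩ := local_pairing m hR hv
  obtain ⟨M, hM0, hM⟩ := L.exists_bd
  set T : (ℝ × ℝ → ℝ) → ℝ := fun χ => (∫ x, h x * lap χ x) + tropPairing E m χ -
    ∑ i, d i * rho (l i) * ∫ s in Set.Ioi (0:ℝ), χ (v + s • l i) with hT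
  have hadd : ∀ ψ χ, Sm ψ → HasCompactSupport ψ → Sm χ → HasCompactSupport χ →
      T (fun x => ψ x + χ x) = T ψ + T χ := by
    intro ψ χ h1 h2 h3 h4
    simp only [hT]
    rw [trop_add E m h1.continuous h3.continuous]
    have i1 : Integrable (fun x => h x * lap ψ x) := bdd_mul_int L.meas hM h1.lap.continuous h2.lap
    have i2 : Integrable (fun x => h x * lap χ x) := bdd_mul_int L.meas hM h3.lap.continuous h4.lap
    have e1 : ∫ x, h x * lap (fun x => ψ x + χ x) x =
        (∫ x, h x * lap ψ x) + ∫ x, h x * lap χ x := by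
      rw [← integral_add i1 i2]
      congr 1; ext x
      rw [lap_add h1 h3]; ring
    have e2 : ∀ i, ∫ s in Set.Ioi (0:ℝ), (ψ (v + s • l i) + χ (v + s • l i)) =
        (∫ s in Set.Ioi (0:ℝ), ψ (v + s • l i)) + ∫ s in Set.Ioi (0:ℝ), χ (v + s • l i) :=
      fun i => integral_add (line_integrable h1.continuous h2 v (hl i)).integrableOn
        (line_integrable h3.continuous h4 v (hl i)).integrableOn
    rw [e1]
    simp_rw [e2, mul_add, Finset.sum_add_distrib]
    ring
  have hzero : ∀ i, ∀ χ : ℝ × ℝ → ℝ, (∀ s : ℝ, 0 < s → v + s • l i ∉ tsupport χ) →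
      ∫ s in Set.Ioi (0:ℝ), χ (v + s • l i) = 0 := by
    intro i χ hχ
    refine setIntegral_eq_zero_of_forall_eq_zero fun s hs => image_eq_zero_of_notMem_tsupport (hχ s hs)
  have hloc : ∀ ψ, Sm ψ → HasCompactSupport ψ → tsupport ψ ⊆ Metric.ball v r → v ∉ tsupport ψ →
      T ψ = 0 := by
    intro ψ hψ hs hsr hvs
    refine localize T hadd ψ hψ hs fun x hx => ?_
    have hxr := hsr hx
    have hxv : x ≠ v := fun e => hvs (e ▸ hx)
    by_cases hxΩ : x ∈ Ω
    swap
    · obtain ⟨ε, hε, hb⟩ := Metric.isOpen_iff.1 hΩ.isOpen_compl x hxΩ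
      refine ⟨ε, hε, fun χ hχ hχs hχt hχψ => ?_⟩
      have t1 : ∫ x, h x * lap χ x = 0 := by
        refine integral_eq_zero_of_ae (Eventually.of_forall fun y => ?_)
        by_cases hy : y ∈ tsupport χ
        · have : h y = 0 := L.off y fun hd => hb (hχt hy) (interior_subset hd.1)
          simp [this]
        · simp [lap_zero_of_notMem hy]
      have t2 : tropPairing E m χ = 0 := trop_zero E m fun y hy =>
        image_eq_zero_of_notMem_tsupport fun hy' => hb (hχt hy') (hEΩ hy)
      have t3 : ∀ i, ∫ s in Set.Ioi (0:ℝ), χ (v + s • l i) = 0 := fun i =>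
        hzero i χ fun s hs0 hm => hb (hχt hm)
          (hΩ.frontier_subset (hray i s hs0 (hsr (hχψ hm))).1)
      simp [hT, t1, t2, t3]
    by_cases hxi : x ∈ interior Ω
    · obtain ⟨ε, hε, hb⟩ := Metric.isOpen_iff.1 isOpen_interior x hxi
      refine ⟨ε, hε, fun χ hχ hχs hχt hχψ => ?_⟩
      have t1 := L.weak χ ⟨hχ, hχt.trans hb⟩
      have t3 : ∀ i, ∫ s in Set.Ioi (0:ℝ), χ (v + s • l i) = 0 := fun i =>
        hzero i χ fun s hs0 hm => (hray i s hs0 (hsr (hχψ hm))).1.2 (hb (hχt hm))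
      simp only [hT, t1, t3]; simp
    have hxf : x ∈ frontier Ω := ⟨subset_closure hxΩ, hxi⟩
    obtain ⟨i, s0, hs0, hxs⟩ := hfr x hxr hxf hxv
    obtain ⟨ε1, hε1, hb1⟩ := Metric.isOpen_iff.1 (gsupp_closed E).isOpen_compl x (hG x hxr hxf hxv)
    obtain ⟨ε2, hε2, hb2⟩ := Metric.eventually_nhds_iff_ball.1
      (hxs ▸ (hray i s0 hs0 (hxs ▸ hxr)).2)
    have inj : ∀ s : ℝ, v + s0 • l i = v + s • l i → s = s0 := by
      intro s e
      have : (s - s0) • l i = 0 := by rw [sub_smul, sub_eq_zero]; exact (add_left_cancel e).symm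
      rcases smul_eq_zero.1 this with h | h
      · linarith
      · exact absurd h (hl i)
    have hc1 : x ∉ (fun s : ℝ => v + s • l i) '' Set.Iic 0 := by
      rintro ⟨s, hs', he⟩
      have := inj s (by rw [← hxs]; exact he.symm)
      exact absurd hs0 (not_lt.2 (this ▸ hs'))
    obtain ⟨ε3, hε3, hb3⟩ := Metric.isOpen_iff.1 (ray_closed v (l i) isClosed_Iic).isOpen_compl x hc1
    have hc2 : x ∉ (fun s : ℝ => v + s • l (!i)) '' Set.Ici 0 := by
      rintro ⟨s, hs', he⟩
      rcases (show (0:ℝ) ≤ s from hs').eq_or_lt with h | h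
      · apply hxv; rw [← he, ← h]; simp
      · refine hdis i (!i) (by cases i <;> decide) s0 s hs0 h ?_
        exact add_left_cancel (hxs.symm.trans he.symm)
    obtain ⟨ε4, hε4, hb4⟩ := Metric.isOpen_iff.1 (ray_closed v (l (!i)) isClosed_Ici).isOpen_compl x hc2
    refine ⟨min (min ε1 ε2) (min ε3 ε4), lt_min (lt_min hε1 hε2) (lt_min hε3 hε4),
      fun χ hχ hχs hχt hχψ => ?_⟩
    have k1 : tsupport χ ⊆ Metric.ball x ε1 :=
      hχt.trans (Metric.ball_subset_ball ((min_le_left _ _).trans (min_le_left _ _)))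
    have k2 : tsupport χ ⊆ Metric.ball x ε2 :=
      hχt.trans (Metric.ball_subset_ball ((min_le_left _ _).trans (min_le_right _ _)))
    have k3 : tsupport χ ⊆ Metric.ball x ε3 :=
      hχt.trans (Metric.ball_subset_ball ((min_le_right _ _).trans (min_le_left _ _)))
    have k4 : tsupport χ ⊆ Metric.ball x ε4 :=
      hχt.trans (Metric.ball_subset_ball ((min_le_right _ _).trans (min_le_right _ _)))
    have t2 : tropPairing E m χ = 0 := trop_zero E m fun y hy =>
        image_eq_zero_of_notMem_tsupport fun hy' => hb1 (k1 hy') hy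
    have t4 : ∫ s in Set.Ioi (0:ℝ), χ (v + s • l (!i)) = 0 :=
      hzero (!i) χ fun s hs hm => hb4 (k4 hm) ⟨s, hs.le, rfl⟩
    have t5 : ∫ s in Set.Ioi (0:ℝ), χ (v + s • l i) = ∫ s : ℝ, χ (v + s • l i) := by
      refine setIntegral_eq_integral_of_forall_compl_eq_zero fun s hs => ?_
      refine image_eq_zero_of_notMem_tsupport fun hm => hb3 (k3 hm) ⟨s, ?_, rfl⟩
      simpa using hs
    have t1 : ∫ y, h y * lap χ y = d i * (rho (l i) * ∫ s : ℝ, χ (v + s • l i)) := by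
      have q1 := half_plane hχ hχs (σ i • l i) v
      have q2 : rho (σ i • l i) * ∫ s : ℝ, χ (v + s • σ i • l i) =
          rho (l i) * ∫ s : ℝ, χ (v + s • l i) := by
        rcases hσ i with e | e
        · rw [e]; simp
        · rw [e, rho_smul]
          have := integral_neg_eq_self (fun s : ℝ => χ (v + s • l i)) volume
          simp only [neg_smul, one_smul, smul_neg] at this ⊢
          rw [this]; ring
      rw [← q2, ← q1, ← integral_const_mul]
      congr 1; ext y
      rw [crs_smul_left]
      by_cases hy : y ∈ tsupport χ
      · rw [hb2 y (k2 hy)]; ring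
      · simp [lap_zero_of_notMem hy]
    have t6 : ∑ j, d j * rho (l j) * ∫ s in Set.Ioi (0:ℝ), χ (v + s • l j) =
        d i * rho (l i) * ∫ s : ℝ, χ (v + s • l i) := by
      rw [← t5]
      refine Fintype.sum_eq_single i fun j hj => ?_
      have : j = !i := bool_other hj
      rw [this, t4, mul_zero]
    simp only [hT]
    rw [t1, t2, t6]; ring
  set s : Finset (Seg ⊕ Bool) := (E.filter (fun e => e.1 = v ∨ e.2 = v)).disjSum Finset.univ
  have hbal := balance s (Sum.elim (fun e => (m e : ℝ)) (fun i => - d i))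
    (Sum.elim (fun e => toR (outDir v e)) l) (by
      rintro (e | i) hi
      · rw [Finset.inl_mem_disjSum] at hi
        obtain ⟨he, h'⟩ := Finset.mem_filter.1 hi
        obtain ⟨b, hb, -⟩ := outDir_prim hR he h'
        exact hb.ne
      · exact hl i) (fun z => h (v + z)) (L.meas.comp (measurable_const_add v)).aestronglyMeasurable
    (R := min r r1) (lt_min hr hr1) (fun z hz => hbd z (hz.trans_le (min_le_left _ _))) (by
    intro ψ hψ hs ht h0
    have t := tsupport_shift (v := v) ht
    have hv' : v ∉ tsupport (fun x => ψ (-v + x)) := by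
      intro hx
      have := tsupport_comp_subset_preimage ψ (f := fun x : ℝ × ℝ => -v + x) (by fun_prop) hx
      exact h0 (by simpa using this)
    have e0 := hloc (fun x => ψ (-v + x)) (hψ.comp_add (-v)) (hs.comp_add (-v))
      (t.trans (Metric.ball_subset_ball (min_le_left _ _))) hv'
    have e1 : ∫ z, h (v + z) * lap ψ z = ∫ x, h x * lap (fun x => ψ (-v + x)) x := by
      rw [← integral_add_left_eq_self (fun x => h x * lap (fun x => ψ (-v + x)) x) v]
      congr 1; ext z
      rw [lap_comp_add, neg_add_cancel_left]
    have h1 := H1 (fun x => ψ (-v + x)) (t.trans (Metric.ball_subset_ball (min_le_right _ _)))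
    simp only [hT] at e0
    rw [h1] at e0
    simp only [neg_add_cancel_left] at e0
    rw [e1, Finset.sum_disjSum]
    simp only [Sum.elim_inl, Sum.elim_inr, neg_mul, Finset.sum_neg_distrib]
    linarith)
  rw [Finset.sum_disjSum] at hbal
  simp only [Sum.elim_inl, Sum.elim_inr, neg_smul, Finset.sum_neg_distrib] at hbal
  exact eq_of_sub_eq_zero (by rw [sub_eq_add_neg]; exact hbal)

theorem squeeze0 {A B M : ℝ} (h : ∀ᶠ τ in 𝓝[>] (0:ℝ), 0 ≤ A + τ * B ∧ A + τ * B ≤ τ * M) :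
    A = 0 := by
  have t1 : Tendsto (fun τ : ℝ => A + τ * B) (𝓝[>] 0) (𝓝 A) := by
    have : Tendsto (fun τ : ℝ => A + τ * B) (𝓝 0) (𝓝 (A + 0 * B)) :=
      (by fun_prop : Continuous fun τ : ℝ => A + τ * B).tendsto 0
    simp only [zero_mul, add_zero] at this
    exact this.mono_left nhdsWithin_le_nhds
  have t2 : Tendsto (fun τ : ℝ => τ * M) (𝓝[>] 0) (𝓝 0) := by
    have : Tendsto (fun τ : ℝ => τ * M) (𝓝 0) (𝓝 (0 * M)) :=
      (by fun_prop : Continuous fun τ : ℝ => τ * M).tendsto 0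
    simp only [zero_mul] at this
    exact this.mono_left nhdsWithin_le_nhds
  exact le_antisymm (le_of_tendsto_of_tendsto t1 t2 (h.mono fun _ h => h.2))
    (ge_of_tendsto t1 (h.mono fun _ h => h.1))

theorem line_ev {Q : ℝ × ℝ → Prop} {x u : ℝ × ℝ} (h : ∀ᶠ y in 𝓝 x, Q y) :
    ∀ᶠ τ in 𝓝[>] (0:ℝ), Q (x + τ • u) := by
  have : Tendsto (fun τ : ℝ => x + τ • u) (𝓝[>] 0) (𝓝 x) := by
    have : Tendsto (fun τ : ℝ => x + τ • u) (𝓝 0) (𝓝 (x + (0:ℝ) • u)) :=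
      (by fun_prop : Continuous fun τ : ℝ => x + τ • u).tendsto 0
    simp only [zero_smul, add_zero] at this
    exact this.mono_left nhdsWithin_le_nhds
  exact this.eventually h

theorem crs_add' (l x y : ℝ × ℝ) : crs l (x + y) = crs l x + crs l y := by simp [crs]; ring

theorem crs_rot (l : ℝ × ℝ) (σ : ℝ) (hσ : σ = 1 ∨ σ = -1) :
    σ * crs l (σ • (-l.2, l.1)) = rho l := by
  rcases hσ with rfl | rfl <;> simp [crs, rho] <;> ring

theorem delta_unique {l a q : ℝ × ℝ} {σ : ℝ} (hσ : σ = 1 ∨ σ = -1) (hl : l ≠ 0)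
    (hq : crs l (q - a) = 0) {δ δ' : ℝ}
    (h : ∀ᶠ y in 𝓝 q, δ * max 0 (σ * crs l (y - a)) = δ' * max 0 (σ * crs l (y - a))) : δ = δ' := by
  obtain ⟨τ, hτ, hτ0⟩ := ((line_ev (u := σ • (-l.2, l.1)) h).and self_mem_nhdsWithin).exists
  have hτ0 : 0 < τ := hτ0
  have e : σ * crs l (q + τ • σ • (-l.2, l.1) - a) = τ * rho l := by
    rw [add_sub_right_comm, crs_add', hq, crs_smul, ← crs_rot l σ hσ]; ring
  have hp : 0 < τ * rho l := mul_pos hτ0 (rho_pos hl)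
  rw [e, max_eq_right hp.le] at hτ
  exact mul_right_cancel₀ hp.ne' hτ

theorem loc_const {ι X : Type*} [TopologicalSpace X] {S : Set X} (hS : IsPreconnected S)
    (hne : S.Nonempty) (U : ι → Set X) (hU : ∀ i, IsOpen (U i))
    (hdis : ∀ i j, ∀ x ∈ S, x ∈ U i → x ∈ U j → i = j) (hcov : ∀ x ∈ S, ∃ i, x ∈ U i) :
    ∃ i, S ⊆ U i := by
  obtain ⟨x0, hx0⟩ := hne
  obtain ⟨i, hi⟩ := hcov x0 hx0
  refine ⟨i, ?_⟩
  have hW : IsOpen (⋃ j ∈ {j | j ≠ i}, U j) := isOpen_biUnion fun j _ => hU j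
  intro x hx
  by_contra hxi
  obtain ⟨y, hy, hy1, hy2⟩ := hS (U i) (⋃ j ∈ {j | j ≠ i}, U j) (hU i) hW (by
    intro z hz
    obtain ⟨j, hj⟩ := hcov z hz
    by_cases hji : j = i
    · left; exact hji ▸ hj
    · right; exact Set.mem_iUnion₂.2 ⟨j, hji, hj⟩) ⟨x0, hx0, hi⟩ (by
    obtain ⟨j, hj⟩ := hcov x hx
    have hji : j ≠ i := fun e => hxi (e ▸ hj)
    exact ⟨x, hx, Set.mem_iUnion₂.2 ⟨j, hji, hj⟩⟩)
  obtain ⟨j, hji, hj⟩ := Set.mem_iUnion₂.1 hy2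
  exact hji (hdis j i y hy hj hy1)

theorem open_crs {a b q : ℝ × ℝ} (hq : q ∈ openSegment ℝ a b) : crs (b - a) (q - a) = 0 := by
  rw [openSegment_eq_image'] at hq
  obtain ⟨t, -, rfl⟩ := hq
  simp only [add_sub_cancel_left]
  rw [crs_smul, crs_self, mul_zero]

theorem side_loc {Ω : Set (ℝ × ℝ)} {P : Finset (ℝ × ℝ)} {E : Finset Seg} {m : Seg → ℕ}
    {h : ℝ × ℝ → ℝ} (L : Lim Ω P E m h) (hΩ : IsLatticePolygon Ω) (hP : ↑P ⊆ interior Ω)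
    {a b : ℝ × ℝ} (hs : IsSide Ω a b) {l : ℤ × ℤ} (hl : PrimOut (b - a) l) :
    ∃ σ : ℝ, (σ = 1 ∨ σ = -1) ∧ (∀ x ∈ Ω, 0 ≤ σ * crs (toR l) (x - a)) ∧
      (∀ x ∈ interior Ω, 0 < σ * crs (toR l) (x - a)) ∧
      (∃ K : ℝ, 0 ≤ K ∧ ∀ x ∈ Ω, h x ≤ K * (σ * crs (toR l) (x - a))) ∧
      ∀ q ∈ openSegment ℝ a b, q ∉ gsupp E → ∃ δ : ℤ, 0 ≤ δ ∧
        ∀ᶠ y in 𝓝 q, h y = δ * max 0 (σ * crs (toR l) (y - a)) := by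
  obtain ⟨σ, hσ, f1, f2, f3⟩ := flat' (poly_body hΩ) hs
  obtain ⟨hg, t, ht, hbt⟩ := id hl
  have hl0 := hl.ne
  have ec : ∀ x, σ * crs (b - a) (x - a) = t * (σ * crs (toR l) (x - a)) := by
    intro x; rw [hbt, crs_smul_left]; ring
  have g1 : ∀ x ∈ Ω, 0 ≤ σ * crs (toR l) (x - a) := fun x hx => by
    have := f1 x hx; rw [ec] at this; exact (mul_nonneg_iff_of_pos_left ht).1 this
  have g2 : ∀ x ∈ interior Ω, 0 < σ * crs (toR l) (x - a) := fun x hx => by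
    have := f2 x hx; rw [ec] at this; exact (mul_pos_iff_of_pos_left ht).1 this
  obtain ⟨k, hk⟩ : ∃ k : ℤ, σ = (k : ℝ) := by
    rcases hσ with e | e
    · exact ⟨1, by simp [e]⟩
    · exact ⟨-1, by simp [e]⟩
  obtain ⟨w, hw⟩ := poly_ext hΩ hs.2.1
  have en : ∀ x : ℝ × ℝ, dot (toR (-(k * l.2), k * l.1)) x - ((k * (l.1 * w.2 - l.2 * w.1) : ℤ) : ℝ)
      = σ * crs (toR l) (x - a) := by
    intro x
    rw [hk, hw]; simp [dot, crs, toR]; ring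
  obtain ⟨K, hK0, hK⟩ := L.bar (-(k * l.2), k * l.1) (by
    intro h0
    have k0 : k ≠ 0 := by rintro rfl; rcases hσ with e | e <;> rw [hk] at e <;> norm_num at e
    have a1 := congrArg Prod.fst h0
    have a2 := congrArg Prod.snd h0
    simp [k0] at a1 a2
    exact hl0 (by ext <;> simp [toR, a1, a2])) (k * (l.1 * w.2 - l.2 * w.1)) (by
    intro x hx
    have := en x
    have := g1 x hx
    linarith)
  have hK' : ∀ x ∈ Ω, h x ≤ K * (σ * crs (toR l) (x - a)) := fun x hx => by
    rw [← en x]; exact hK x hx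
  refine ⟨σ, hσ, g1, g2, ⟨K, hK0, hK'⟩, ?_⟩
  intro q hq hqG
  obtain ⟨ε1, hε1, hb1⟩ := f3 q hq
  have hqf : q ∈ frontier Ω := hs.2.2.2 (openSegment_subset_segment _ _ _ hq)
  obtain ⟨ε2, hε2, hb2⟩ := Metric.isOpen_iff.1
    ((gsupp_closed E).union P.finite_toSet.isClosed).isOpen_compl q (by
      rintro (h' | h')
      · exact hqG h'
      · exact hqf.2 (hP h'))
  set ε := min ε1 ε2
  have hε : 0 < ε := lt_min hε1 hε2
  have hqc : crs (toR l) (q - a) = 0 := by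
    have := open_crs hq
    rw [hbt, crs_smul_left] at this
    rcases mul_eq_zero.1 this with h | h
    · exact absurd h ht.ne'
    · exact h
  set S : Set (ℝ × ℝ) := Metric.ball q ε ∩ {x | 0 < σ * crs (toR l) (x - a)} with hSdef
  have hSi : S ⊆ interior Ω := by
    rintro x ⟨hx, hx'⟩
    refine (hb1 x (Metric.ball_subset_ball (min_le_left _ _) hx)).1 ?_
    rw [ec]; exact mul_pos ht hx'
  have hSd : S ⊆ dom Ω P E := fun x hx =>
    ⟨hSi hx, hb2 (Metric.ball_subset_ball (min_le_right _ _) hx.1)⟩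
  have hSc : Convex ℝ S := by
    refine (convex_ball q ε).inter ?_
    intro x hx y hy α β hα hβ hαβ
    have hx : 0 < σ * crs (toR l) (x - a) := hx
    have hy : 0 < σ * crs (toR l) (y - a) := hy
    show 0 < σ * crs (toR l) (α • x + β • y - a)
    have : σ * crs (toR l) (α • x + β • y - a) =
        α * (σ * crs (toR l) (x - a)) + β * (σ * crs (toR l) (y - a)) := by
      rw [crs_sub, crs_sub, crs_sub, crs_combo]
      have : β = 1 - α := by linarith
      rw [this]; ring
    rw [this]
    rcases hα.eq_or_lt with e | e
    · rw [← e] at hαβ ⊢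
      have : β = 1 := by linarith
      rw [this]; linarith
    · have := mul_pos e hx
      have := mul_nonneg hβ hy.le
      linarith
  obtain ⟨A, B, c, hAB⟩ := aff_conn L hSc.isPreconnected hSd
  have hval : ∀ y ∈ S, h y = A * y.1 + B * y.2 + c := fun y hy => (hAB y hy).self_of_nhds
  set u : ℝ × ℝ := σ • (-(toR l).2, (toR l).1) with hu
  have key : ∀ x ∈ Metric.ball q ε, crs (toR l) (x - a) = 0 → A * x.1 + B * x.2 + c = 0 := by
    intro x hx hx0
    refine squeeze0 (B := A * u.1 + B * u.2) (M := K * rho (toR l)) ?_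
    filter_upwards [line_ev (u := u) (Metric.isOpen_ball.mem_nhds hx), self_mem_nhdsWithin] with τ h1 h2
    have h2 : 0 < τ := h2
    have e : σ * crs (toR l) (x + τ • u - a) = τ * rho (toR l) := by
      rw [add_sub_right_comm, crs_add', hx0, crs_smul, ← crs_rot (toR l) σ hσ]; ring
    have hm : x + τ • u ∈ S := ⟨h1, by
      show 0 < σ * crs (toR l) (x + τ • u - a)
      rw [e]; exact mul_pos h2 (rho_pos hl0)⟩
    have hv := hval _ hm
    have hn := L.nonneg (x + τ • u)
    have hu' := hK' _ (interior_subset (hSi hm))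
    rw [e] at hu'
    simp only [Prod.fst_add, Prod.snd_add, Prod.smul_fst, Prod.smul_snd, smul_eq_mul] at hv
    constructor
    · rw [hv] at hn; linarith
    · rw [hv] at hu'; linarith
  have kq := key q (Metric.mem_ball_self hε) hqc
  obtain ⟨s, hs1, hs0⟩ := ((line_ev (u := toR l) (Metric.ball_mem_nhds q hε)).and
    self_mem_nhdsWithin).exists
  have hs0 : 0 < s := hs0
  have kq2 := key (q + s • toR l) hs1 (by
    rw [add_sub_right_comm, crs_add', hqc, crs_smul, crs_self]; simp)
  have hann : A * l.1 + B * l.2 = 0 := by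
    have : s * ((A:ℝ) * l.1 + B * l.2) = 0 := by
      simp [toR] at kq2; linarith
    rcases mul_eq_zero.1 this with h | h
    · exact absurd h hs0.ne'
    · exact_mod_cast h
  obtain ⟨δ, hδ⟩ := prim_annih (a := (A, B)) hg hann
  have hA : A = -(δ * l.2) := congrArg Prod.fst hδ
  have hB : B = δ * l.1 := congrArg Prod.snd hδ
  have hσσ : σ * σ = 1 := by rcases hσ with e | e <;> rw [e] <;> norm_num
  have hval2 : ∀ y ∈ S, h y = (k * δ : ℤ) * (σ * crs (toR l) (y - a)) := by
    intro y hy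
    rw [hval y hy]
    have e1 : ((k * δ : ℤ) : ℝ) * (σ * crs (toR l) (y - a)) = δ * crs (toR l) (y - a) := by
      push_cast; rw [← hk]; linear_combination (δ * crs (toR l) (y - a)) * hσσ
    rw [e1]
    have hA' : (A : ℝ) = -(δ * l.2) := by exact_mod_cast hA
    have hB' : (B : ℝ) = δ * l.1 := by exact_mod_cast hB
    rw [hA', hB'] at kq ⊢
    simp only [crs, toR, Prod.fst_sub, Prod.snd_sub] at hqc ⊢
    linear_combination kq - δ * hqc
  refine ⟨k * δ, ?_, ?_⟩
  · obtain ⟨τ, h1, h2⟩ := ((line_ev (u := u) (Metric.ball_mem_nhds q hε)).and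
      self_mem_nhdsWithin).exists
    have h2 : 0 < τ := h2
    have e : σ * crs (toR l) (q + τ • u - a) = τ * rho (toR l) := by
      rw [add_sub_right_comm, crs_add', hqc, crs_smul, ← crs_rot (toR l) σ hσ]; ring
    have hp := mul_pos h2 (rho_pos hl0)
    have hm : q + τ • u ∈ S := ⟨h1, by
      show 0 < σ * crs (toR l) (q + τ • u - a)
      rw [e]; exact hp⟩
    have := L.nonneg (q + τ • u)
    rw [hval2 _ hm, e] at this
    have := nonneg_of_mul_nonneg_left this hp
    exact_mod_cast this
  · filter_upwards [Metric.ball_mem_nhds q hε] with y hy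
    rcases lt_trichotomy (σ * crs (toR l) (y - a)) 0 with hlt | heq | hgt
    · rw [max_eq_left hlt.le, mul_zero]
      exact L.off y fun hd => absurd (g1 y (interior_subset hd.1)) (not_le.2 hlt)
    · rw [heq, max_self, mul_zero]
      exact L.off y fun hd => absurd (g2 y hd.1) (by rw [heq]; exact lt_irrefl _)
    · rw [max_eq_right hgt.le]
      exact hval2 y ⟨hy, hgt⟩

theorem delta_piece {E : Finset Seg} {h : ℝ × ℝ → ℝ} {a b l : ℝ × ℝ} {σ : ℝ}
    (hσ : σ = 1 ∨ σ = -1) (hl : l ≠ 0) {t : ℝ} (ht : 0 < t) (hbt : b - a = t • l)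
    (H : ∀ q ∈ openSegment ℝ a b, q ∉ gsupp E → ∃ δ : ℤ, 0 ≤ δ ∧
        ∀ᶠ y in 𝓝 q, h y = δ * max 0 (σ * crs l (y - a)))
    {T : Set (ℝ × ℝ)} (hT : IsPreconnected T) (hTs : T ⊆ openSegment ℝ a b)
    (hTG : ∀ q ∈ T, q ∉ gsupp E) :
    ∃ δ : ℤ, 0 ≤ δ ∧ ∀ q ∈ T, ∀ᶠ y in 𝓝 q, h y = δ * max 0 (σ * crs l (y - a)) := by
  rcases T.eq_empty_or_nonempty with rfl | hne
  · exact ⟨0, le_rfl, fun x hx => absurd hx (Set.notMem_empty x)⟩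
  obtain ⟨δ, hδ⟩ := loc_const hT hne
    (fun δ : ℤ => {q : ℝ × ℝ | ∀ᶠ y in 𝓝 q, h y = δ * max 0 (σ * crs l (y - a))})
    (fun δ => isOpen_setOfPred_eventually_nhds) (by
      intro i j x hx h1 h2
      have hc : crs l (x - a) = 0 := by
        have := open_crs (hTs hx)
        rw [hbt, crs_smul_left] at this
        exact (mul_eq_zero.1 this).resolve_left ht.ne'
      have h1 : ∀ᶠ y in 𝓝 x, h y = i * max 0 (σ * crs l (y - a)) := h1
      have h2 : ∀ᶠ y in 𝓝 x, h y = j * max 0 (σ * crs l (y - a)) := h2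
      have : (i : ℝ) = j := delta_unique (q := x) hσ hl hc (by
        filter_upwards [h1, h2] with y e1 e2
        rw [← e1, ← e2])
      exact_mod_cast this) (by
      intro x hx
      obtain ⟨δ, -, hδ⟩ := H x (hTs hx) (hTG x hx)
      exact ⟨δ, hδ⟩)
  refine ⟨δ, ?_, fun q hq => hδ hq⟩
  obtain ⟨x, hx⟩ := hne
  obtain ⟨δ', h0, hδ'⟩ := H x (hTs hx) (hTG x hx)
  have hc : crs l (x - a) = 0 := by
    have := open_crs (hTs hx)
    rw [hbt, crs_smul_left] at this
    exact (mul_eq_zero.1 this).resolve_left ht.ne'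
  have h1 : ∀ᶠ y in 𝓝 x, h y = δ * max 0 (σ * crs l (y - a)) := hδ hx
  have : (δ' : ℝ) = δ := delta_unique (q := x) hσ hl hc (by
        filter_upwards [h1, hδ'] with y e1 e2
        rw [← e1, ← e2])
  have : δ' = δ := by exact_mod_cast this
  omega

theorem crs_bound (l z : ℝ × ℝ) : |crs l z| ≤ (|l.1| + |l.2|) * ‖z‖ := by
  have h1 : |z.1| ≤ ‖z‖ := norm_fst_le z
  have h2 : |z.2| ≤ ‖z‖ := norm_snd_le z
  unfold crs
  calc |l.1 * z.2 - l.2 * z.1| ≤ |l.1 * z.2| + |l.2 * z.1| := abs_sub _ _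
    _ = |l.1| * |z.2| + |l.2| * |z.1| := by rw [abs_mul, abs_mul]
    _ ≤ _ := by nlinarith [abs_nonneg l.1, abs_nonneg l.2]

theorem bar_bound {Ω : Set (ℝ × ℝ)} {P : Finset (ℝ × ℝ)} {E : Finset Seg} {m : Seg → ℕ}
    {h : ℝ × ℝ → ℝ} (L : Lim Ω P E m h) {a v l : ℝ × ℝ} {σ : ℝ} (hσ : σ = 1 ∨ σ = -1)
    (hv : crs l (v - a) = 0)
    (hK : ∃ K : ℝ, 0 ≤ K ∧ ∀ x ∈ Ω, h x ≤ K * (σ * crs l (x - a))) :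
    ∃ C : ℝ, ∀ z, |h (v + z)| ≤ C * ‖z‖ := by
  obtain ⟨K, hK0, hK⟩ := hK
  refine ⟨K * (|l.1| + |l.2|), fun z => ?_⟩
  rw [abs_of_nonneg (L.nonneg _)]
  by_cases hz : v + z ∈ Ω
  · refine (hK _ hz).trans ?_
    rw [add_sub_right_comm, crs_add', hv, zero_add, mul_assoc]
    have h1 : σ * crs l z ≤ |crs l z| := by
      rcases hσ with e | e <;> rw [e]
      · rw [one_mul]; exact le_abs_self _
      · rw [neg_one_mul]; exact neg_le_abs _
    exact mul_le_mul_of_nonneg_left (h1.trans (crs_bound l z)) hK0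
  · rw [L.off _ fun hd => hz (interior_subset hd.1)]
    positivity

theorem edge_dir_pos {Ω C : Set (ℝ × ℝ)} (hΩ : Body Ω) {E : Finset Seg} (hE : EdgeSet E)
    (hPl : Planar E) (hS : gsupp E = closure (C ∩ interior Ω))
    (hR : ∀ e ∈ E, RatDir (e.2 - e.1)) {a v l : ℝ × ℝ} {σ : ℝ}
    (hv : crs l (v - a) = 0) (hpos : ∀ x ∈ interior Ω, 0 < σ * crs l (x - a))
    {e : Seg} (he : e ∈ E) (h : e.1 = v ∨ e.2 = v) :
    0 < σ * crs l (toR (outDir v e)) := by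
  have hm : ∀ w, (1/2:ℝ) • v + (1/2:ℝ) • w ∈ interior Ω → ∀ k : ℤ × ℤ, PrimOut (w - v) k →
      0 < σ * crs l (toR k) := by
    rintro w hw k ⟨-, t, ht, hk⟩
    have h1 := hpos _ hw
    have e1 : (1/2:ℝ) • v + (1/2:ℝ) • w - a = (v - a) + (1/2 * t) • toR k := by
      rw [mul_smul, ← hk]; module
    rw [e1, crs_add', hv, zero_add, crs_smul] at h1
    have h2 : 0 < (1/2 * t) * (σ * crs l (toR k)) := by linarith
    exact (mul_pos_iff_of_pos_left (by positivity)).1 h2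
  have mid : (1/2:ℝ) • e.1 + (1/2:ℝ) • e.2 ∈ interior Ω :=
    edge_int hΩ hE hPl hS he ⟨1/2, 1/2, by norm_num, by norm_num, by norm_num, rfl⟩
  by_cases h1 : e.1 = v
  · refine hm e.2 (by rw [← h1]; exact mid) _ ?_
    rw [outDir, if_pos h1, ← h1]; exact prim_spec (hR e he)
  · have h2 := h.resolve_left h1
    refine hm e.1 (by rw [← h2, add_comm]; exact mid) _ ?_
    rw [outDir, if_neg h1, ← h2]
    refine prim_spec ?_
    have := hR e he
    exact ⟨_, by have := (prim_spec this).neg; rwa [neg_sub] at this⟩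

theorem ball_avoid {F : Set (ℝ × ℝ)} (hF : F.Finite) (v : ℝ × ℝ) :
    ∃ r > 0, ∀ x ∈ Metric.ball v r, x ≠ v → x ∉ F := by
  obtain ⟨r, hr, hb⟩ := Metric.isOpen_iff.1 (hF.sdiff (t := {v})).isClosed.isOpen_compl v (by simp)
  exact ⟨r, hr, fun x hx hne hF => hb hx ⟨hF, hne⟩⟩

theorem ray_ball {v l : ℝ × ℝ} (hl : l ≠ 0) (r : ℝ) :
    {x | ∃ s : ℝ, 0 < s ∧ v + s • l ∈ Metric.ball v r ∧ x = v + s • l} =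
      (fun s : ℝ => v + s • l) '' Set.Ioo 0 (r / ‖l‖) := by
  have hn : 0 < ‖l‖ := norm_pos_iff.2 hl
  ext x
  constructor
  · rintro ⟨s, hs, hb, rfl⟩
    rw [Metric.mem_ball, dist_self_add_left, norm_smul, Real.norm_eq_abs, abs_of_pos hs] at hb
    exact ⟨s, ⟨hs, (lt_div_iff₀ hn).2 hb⟩, rfl⟩
  · rintro ⟨s, ⟨hs, hb⟩, rfl⟩
    refine ⟨s, hs, ?_, rfl⟩
    rw [Metric.mem_ball, dist_self_add_left, norm_smul, Real.norm_eq_abs, abs_of_pos hs]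
    exact (lt_div_iff₀ hn).1 hb

theorem ray_pre {v l : ℝ × ℝ} (hl : l ≠ 0) (r : ℝ) :
    IsPreconnected {x | ∃ s : ℝ, 0 < s ∧ v + s • l ∈ Metric.ball v r ∧ x = v + s • l} := by
  rw [ray_ball hl]
  exact isPreconnected_Ioo.image _ (by fun_prop)

theorem no_flat {Ω C : Set (ℝ × ℝ)} {P : Finset (ℝ × ℝ)} {E : Finset Seg} {m : Seg → ℕ}
    {h : ℝ × ℝ → ℝ} (L : Lim Ω P E m h) (hΩ : IsLatticePolygon Ω) (hP : ↑P ⊆ interior Ω)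
    (hE : EdgeSet E) (hPl : Planar E) (hS : gsupp E = closure (C ∩ interior Ω))
    (hR : ∀ e ∈ E, RatDir (e.2 - e.1)) (hm : ∀ e ∈ E, 0 < m e)
    {a b : ℝ × ℝ} (hs : IsSide Ω a b) {v : ℝ × ℝ} (hv : v ∈ openSegment ℝ a b) :
    v ∉ gsupp E := by
  classical
  intro hvG
  have hB := poly_body hΩ
  have hpr := prim_spec (side_ratDir hΩ hs)
  set l := toR (prim (b - a)) with hldef
  have hl0 : l ≠ 0 := hpr.ne
  obtain ⟨hg, t, ht, hbt⟩ := id hpr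
  obtain ⟨σ, hσ, g1, g2, g3, g4⟩ := side_loc L hΩ hP hs hpr
  obtain ⟨σ', hσ', f1, f2, f3⟩ := flat' hB hs
  have hvf : v ∈ frontier Ω := hs.2.2.2 (openSegment_subset_segment _ _ _ hv)
  have hend := endpoint_of hB hE hPl hS (v := v) (Or.inl hvf.2)
  have hvc : crs l (v - a) = 0 := by
    have := open_crs hv
    rw [hbt, crs_smul_left] at this
    exact (mul_eq_zero.1 this).resolve_left ht.ne'
  obtain ⟨r1, hr1, H1⟩ := f3 v hv
  obtain ⟨r2, hr2, H2⟩ := ball_avoid (contact_finite hB hE hPl hS) v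
  set r := min r1 r2
  have hr : 0 < r := lt_min hr1 hr2
  have onl : ∀ s : ℝ, v + s • l ∈ Metric.ball v r → v + s • l ∈ openSegment ℝ a b := by
    intro s hs'
    refine (H1 _ (Metric.ball_subset_ball (min_le_left _ _) hs')).2 ?_
    rw [hbt, crs_smul_left, add_sub_right_comm, crs_add', hvc, crs_smul, crs_self]; simp
  set ll : Bool → ℝ × ℝ := fun i => if i then l else -l with hll
  set σσ : Bool → ℝ := fun i => if i then σ else -σ with hσσ
  have hll0 : ∀ i, ll i ≠ 0 := by intro i; cases i <;> simp [hll, hl0]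
  have onl' : ∀ i, ∀ s : ℝ, v + s • ll i ∈ Metric.ball v r → v + s • ll i ∈ openSegment ℝ a b := by
    intro i s hs'
    cases i
    · have e : v + s • ll false = v + (-s) • l := by simp [hll]
      rw [e] at hs' ⊢; exact onl _ hs'
    · exact onl s hs'
  have nev : ∀ i, ∀ s : ℝ, 0 < s → v + s • ll i ≠ v := by
    intro i s hs' e
    have : s • ll i = 0 := by simpa using e
    rcases smul_eq_zero.1 this with h | h
    · exact hs'.ne' h
    · exact hll0 i h
  have hfrG : ∀ x ∈ Metric.ball v r, x ∈ frontier Ω → x ≠ v → x ∉ gsupp E := by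
    intro x hx hxf hxv hxG
    exact H2 x (Metric.ball_subset_ball (min_le_right _ _) hx) hxv ⟨hxG, hxf⟩
  have pieces : ∀ i, ∃ δ : ℤ, 0 ≤ δ ∧ ∀ q ∈ {x | ∃ s : ℝ, 0 < s ∧ v + s • ll i ∈ Metric.ball v r ∧
      x = v + s • ll i}, ∀ᶠ y in 𝓝 q, h y = δ * max 0 (σ * crs l (y - a)) := by
    intro i
    refine delta_piece hσ hl0 ht hbt g4 (ray_pre (hll0 i) r) ?_ ?_
    · rintro _ ⟨s, hs', hb, rfl⟩
      exact onl' i s hb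
    · rintro _ ⟨s, hs', hb, rfl⟩
      exact hfrG _ hb (hs.2.2.2 (openSegment_subset_segment _ _ _ (onl' i s hb))) (nev i s hs')
  choose δ hδ0 hδ using pieces
  obtain ⟨Cb, hCb⟩ := bar_bound L hσ hvc g3
  have ecr : ∀ i y, σσ i * crs (ll i) (y - v) = σ * crs l (y - a) := by
    intro i y
    have e1 : crs l (y - v) = crs l (y - a) := by
      rw [crs_sub] at hvc; rw [crs_sub, crs_sub]; linarith
    cases i
    · have : ll false = (-1:ℝ) • l := by simp [hll]
      rw [this, crs_smul_left, e1]; simp [hσσ]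
    · simp [hll, hσσ, e1]
  have hbal := bdy_bal (m := m) L hB.closed (gsupp_sub hB hS) hR hend hr (C := Cb) ll
    (fun i => (δ i : ℝ)) σσ hll0
    (by intro i; cases i <;> rcases hσ with e | e <;> simp [hσσ, e])
    (by
      intro i s hs' hb
      refine ⟨hs.2.2.2 (openSegment_subset_segment _ _ _ (onl' i s hb)), ?_⟩
      simp only [ecr]
      exact hδ i _ ⟨s, hs', hb, rfl⟩)
    (by
      intro x hx hxf hxv
      have hxb := H1 x (Metric.ball_subset_ball (min_le_left _ _) hx)
      have hxo : x ∈ openSegment ℝ a b := by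
        refine hxb.2 (le_antisymm ?_ (f1 x (hB.closed.frontier_subset hxf)))
        by_contra hcon
        exact hxf.2 (hxb.1 (not_le.1 hcon))
      rw [openSegment_eq_image'] at hxo hv
      obtain ⟨t1, -, e1⟩ := hxo
      obtain ⟨t2, -, e2⟩ := hv
      have ex : x = v + ((t1 - t2) * t) • l := by
        rw [mul_smul, ← hbt, ← e1, ← e2]
        simp only [sub_smul]; abel
      rcases lt_trichotomy ((t1 - t2) * t) 0 with hlt | heq | hgt
      · refine ⟨false, -((t1 - t2) * t), by linarith, ?_⟩
        rw [ex]; simp [hll]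
      · exact absurd (by rw [ex, heq]; simp) hxv
      · exact ⟨true, _, hgt, ex⟩)
    (by
      intro i j hij s u hs' hu e
      have key : ∀ s u : ℝ, 0 < s → 0 < u → s • l ≠ u • (-l) := by
        intro s u hs' hu e
        have : (s + u) • l = 0 := by rw [add_smul, e]; simp
        rcases smul_eq_zero.1 this with h | h
        · linarith
        · exact hl0 h
      cases i <;> cases j
      · exact hij rfl
      · exact key u s hu hs' (by simpa [hll] using e.symm)
      · exact key s u hs' hu (by simpa [hll] using e)
      · exact hij rfl)
    hfrG (fun z _ => hCb z)
  have happ : σ * crs l (∑ e ∈ E.filter (fun e => e.1 = v ∨ e.2 = v), (m e : ℝ) • toR (outDir v e))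
      = 0 := by
    rw [hbal]
    simp [hll, crs]
    right; ring
  have hcs : ∀ (s : Finset Seg) (f : Seg → ℝ × ℝ), crs l (∑ e ∈ s, f e) = ∑ e ∈ s, crs l (f e) := by
    intro s f
    simp only [crs, Prod.fst_sum, Prod.snd_sum, Finset.mul_sum, Finset.sum_sub_distrib]
  rw [hcs, Finset.mul_sum] at happ
  obtain ⟨e, he, hve⟩ := mem_gsupp.1 hvG
  have hpos : 0 < ∑ e ∈ E.filter (fun e => e.1 = v ∨ e.2 = v),
      σ * crs l ((m e : ℝ) • toR (outDir v e)) := by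
    refine Finset.sum_pos (fun e he => ?_) ⟨e, Finset.mem_filter.2 ⟨he, hend e he hve⟩⟩
    obtain ⟨he, h'⟩ := Finset.mem_filter.1 he
    have h1 := edge_dir_pos hB hE hPl hS hR hvc g2 he h'
    have h2 : (0:ℝ) < m e := by exact_mod_cast hm e he
    rw [crs_smul, mul_left_comm]
    exact mul_pos h2 h1
  exact hpos.ne' happ

theorem trop_nonneg (E : Finset Seg) (m : Seg → ℕ) {ψ : ℝ × ℝ → ℝ} (h : ∀ x, 0 ≤ ψ x) :
    0 ≤ tropPairing E m ψ := by
  unfold tropPairing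
  refine Finset.sum_nonneg fun e _ => ?_
  have h1 : 0 ≤ segInt e ψ := by
    unfold segInt
    exact mul_nonneg (Real.sqrt_nonneg _)
      (intervalIntegral.integral_nonneg zero_le_one fun t _ => h _)
  have h2 : 0 ≤ enorm2 (toR (prim (e.2 - e.1))) := Real.sqrt_nonneg _
  positivity

theorem ae_zero {Ω : Set (ℝ × ℝ)} {P : Finset (ℝ × ℝ)} {E : Finset Seg} {m : Seg → ℕ}
    {h : ℝ × ℝ → ℝ} (L : Lim Ω P E m h) {U : Set (ℝ × ℝ)} (hU : IsOpen U)
    (hae : ∀ᵐ x : ℝ × ℝ, x ∈ U → h x = 0) : ∀ x ∈ U, h x = 0 := by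
  intro x hx
  by_contra hne
  have hxd : x ∈ dom Ω P E := by
    by_contra hd; exact hne (L.off x hd)
  obtain ⟨ε, hε, -, a, b, hab⟩ := L.aff x hxd
  have hc : ContinuousAt h x := by
    have hc1 : ContinuousAt (fun y : ℝ × ℝ => h x + a * (y.1 - x.1) + b * (y.2 - x.2)) x := by
      fun_prop
    refine hc1.congr ?_
    filter_upwards [Metric.ball_mem_nhds x hε] with y hy
    rw [hab y hy]
  have hn : {y | h y ≠ 0} ∩ U ∈ 𝓝 x := Filter.inter_mem (hc.eventually_ne hne) (hU.mem_nhds hx)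
  have hd : Dense {y : ℝ × ℝ | y ∈ U → h y = 0} := Measure.dense_of_ae hae
  obtain ⟨y, hy1, hy2⟩ := hd.inter_nhds_nonempty hn
  exact hy2.1 (hy1 hy2.2)

theorem vanish {Ω : Set (ℝ × ℝ)} {P : Finset (ℝ × ℝ)} {E : Finset Seg} {m : Seg → ℕ}
    {h : ℝ × ℝ → ℝ} (L : Lim Ω P E m h) (hΩ : Body Ω) {z : ℝ × ℝ} (hz : z ∈ interior Ω)
    (h0 : ∀ᶠ y in 𝓝 z, h y = 0) : False := by
  obtain ⟨M, hM0, hM⟩ := L.exists_bd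
  set A : Set (ℝ × ℝ) := {x | ∀ᶠ y in 𝓝 x, h y = 0} with hA
  have hAo : IsOpen A := isOpen_setOfPred_eventually_nhds
  have hsub : interior Ω ⊆ A := by
    refine (hΩ.conv.interior.isPreconnected).subset_of_closure_inter_subset hAo ⟨z, hz, h0⟩ ?_
    rintro x ⟨hxc, hxi⟩
    obtain ⟨R2, hR2, hb⟩ := Metric.isOpen_iff.1 isOpen_interior x hxi
    set R := R2 / 2 with hR
    have hR0 : 0 < R := by positivity
    obtain ⟨w, hw, hwx⟩ := Metric.mem_closure_iff.1 hxc (R / 2) (by positivity)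
    have hw : ∀ᶠ y in 𝓝 w, h y = 0 := hw
    obtain ⟨ε, hε, hwε⟩ := Metric.eventually_nhds_iff_ball.1 hw
    rw [dist_eq_norm] at hwx
    have hae := strong_min L.meas.aestronglyMeasurable hM L.nonneg w (r := ε) (R := R) hε (by
      intro ψ hψ hψ0 hψs
      have ht : TestFun Ω ψ := by
        refine ⟨hψ, fun y hy => hb ?_⟩
        have hy : rho (y - w) ≤ R ^ 2 := hψs hy
        have h1 : ‖y - w‖ ≤ R := by
          have := norm_sq_le_rho (y - w)
          exact le_of_sq_le_sq (this.trans hy) hR0.le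
        rw [Metric.mem_ball, dist_eq_norm]
        have h2 : ‖y - x‖ ≤ ‖y - w‖ + ‖x - w‖ := by
          rw [norm_sub_rev x w]
          calc ‖y - x‖ = ‖(y - w) + (w - x)‖ := by congr 1; abel
            _ ≤ _ := norm_add_le _ _
        linarith
      rw [L.weak ψ ht]
      have := trop_nonneg E m hψ0
      linarith) (by
      intro y hy
      apply hwε
      rw [Metric.mem_ball, dist_eq_norm]
      have := norm_sq_le_rho (y - w)
      exact lt_of_pow_lt_pow_left₀ 2 hε.le (this.trans_lt hy))
    have hop : IsOpen {y : ℝ × ℝ | rho (y - w) < R ^ 2} :=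
      isOpen_lt (rho_smooth.continuous.comp (by fun_prop)) continuous_const
    have hall := ae_zero L hop hae
    have hx : x ∈ {y : ℝ × ℝ | rho (y - w) < R ^ 2} := by
      show rho (x - w) < R ^ 2
      have := rho_le_norm_sq (x - w)
      have := norm_nonneg (x - w)
      nlinarith
    exact Filter.mem_of_superset (hop.mem_nhds hx) hall
  obtain ⟨x, hx⟩ := L.ne
  by_cases hd : x ∈ dom Ω P E
  · have : ∀ᶠ y in 𝓝 x, h y = 0 := hsub hd.1
    exact hx this.self_of_nhds
  · exact hx (L.off x hd)

/-- `δ` is the slope of the limit function along the side `[a, b]`. -/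
def SideSlope (Ω : Set (ℝ × ℝ)) (h : ℝ × ℝ → ℝ) (a b : ℝ × ℝ) (δ : ℤ) : Prop :=
  ∃ σ : ℝ, (σ = 1 ∨ σ = -1) ∧
    (∀ x ∈ interior Ω, 0 < σ * crs (toR (prim (b - a))) (x - a)) ∧
    (∃ K : ℝ, 0 ≤ K ∧ ∀ x ∈ Ω, h x ≤ K * (σ * crs (toR (prim (b - a))) (x - a))) ∧
    ∀ q ∈ openSegment ℝ a b,
      ∀ᶠ y in 𝓝 q, h y = δ * max 0 (σ * crs (toR (prim (b - a))) (y - a))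

theorem open_crs' {a b q l : ℝ × ℝ} (hq : q ∈ openSegment ℝ a b) {t : ℝ} (ht : 0 < t)
    (hbt : b - a = t • l) : crs l (q - a) = 0 := by
  have := open_crs hq
  rw [hbt, crs_smul_left] at this
  exact (mul_eq_zero.1 this).resolve_left ht.ne'

theorem mid_open (a b : ℝ × ℝ) : (1/2:ℝ) • a + (1/2:ℝ) • b ∈ openSegment ℝ a b :=
  ⟨1/2, 1/2, by norm_num, by norm_num, by norm_num, rfl⟩

theorem slope_exists {Ω C : Set (ℝ × ℝ)} {P : Finset (ℝ × ℝ)} {E : Finset Seg} {m : Seg → ℕ}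
    {h : ℝ × ℝ → ℝ} (L : Lim Ω P E m h) (hΩ : IsLatticePolygon Ω) (hP : ↑P ⊆ interior Ω)
    (hE : EdgeSet E) (hPl : Planar E) (hS : gsupp E = closure (C ∩ interior Ω))
    (hR : ∀ e ∈ E, RatDir (e.2 - e.1)) (hm : ∀ e ∈ E, 0 < m e)
    {a b : ℝ × ℝ} (hs : IsSide Ω a b) : ∃ δ : ℤ, 0 < δ ∧ SideSlope Ω h a b δ := by
  have hpr := prim_spec (side_ratDir hΩ hs)
  obtain ⟨hg, t, ht, hbt⟩ := id hpr
  obtain ⟨σ, hσ, g1, g2, g3, g4⟩ := side_loc L hΩ hP hs hpr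
  obtain ⟨δ, h0, hδ⟩ := delta_piece hσ hpr.ne ht hbt g4 (convex_openSegment a b).isPreconnected
    subset_rfl (fun q hq => no_flat L hΩ hP hE hPl hS hR hm hs hq)
  refine ⟨δ, ?_, σ, hσ, g2, g3, hδ⟩
  rcases h0.eq_or_lt with e | e
  swap
  · exact e
  exfalso
  have hm := hδ _ (mid_open a b)
  have h1 : ∀ᶠ y in 𝓝 ((1/2:ℝ) • a + (1/2:ℝ) • b), h y = 0 := by
    filter_upwards [hm] with y hy
    rw [hy, ← e]; simp
  obtain ⟨ε, hε, hb⟩ := Metric.eventually_nhds_iff_ball.1 h1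
  have hB := poly_body hΩ
  have hcl : (1/2:ℝ) • a + (1/2:ℝ) • b ∈ closure (interior Ω) := by
    rw [hB.conv.closure_interior_eq_closure_of_nonempty_interior hΩ.2, hB.closed.closure_eq]
    exact hB.closed.frontier_subset
      (hs.2.2.2 (openSegment_subset_segment _ _ _ (mid_open a b)))
  obtain ⟨z, hz, hzd⟩ := Metric.mem_closure_iff.1 hcl ε hε
  refine vanish L hB hz ?_
  filter_upwards [Metric.isOpen_ball.mem_nhds (show z ∈ Metric.ball _ ε by
    rw [Metric.mem_ball, dist_comm]; exact hzd)] with y hy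
  exact hb y hy

theorem slope_unique {Ω : Set (ℝ × ℝ)} {h : ℝ × ℝ → ℝ} (hΩ : IsLatticePolygon Ω)
    {a b : ℝ × ℝ} (hs : IsSide Ω a b) {δ δ' : ℤ} (h1 : SideSlope Ω h a b δ)
    (h2 : SideSlope Ω h a b δ') : δ = δ' := by
  obtain ⟨σ, hσ, p1, -, q1⟩ := h1
  obtain ⟨σ', hσ', p2, -, q2⟩ := h2
  have hpr := prim_spec (side_ratDir hΩ hs)
  obtain ⟨hg, t, ht, hbt⟩ := id hpr
  obtain ⟨x, hx⟩ := hΩ.2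
  have e : σ = σ' := by
    have := p1 x hx; have := p2 x hx
    rcases hσ with e | e <;> rcases hσ' with e' | e' <;> subst e e' <;> first | rfl | (exfalso; linarith)
  subst e
  have : (δ : ℝ) = δ' := delta_unique hσ hpr.ne (open_crs' (mid_open a b) ht hbt) (by
    filter_upwards [q1 _ (mid_open a b), q2 _ (mid_open a b)] with y e1 e2
    rw [← e1, ← e2])
  exact_mod_cast this

theorem toR_neg (l : ℤ × ℤ) : toR (-l) = (-1:ℝ) • toR l := by ext <;> simp [toR]

theorem slope_symm {Ω : Set (ℝ × ℝ)} {h : ℝ × ℝ → ℝ} (hΩ : IsLatticePolygon Ω)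
    {a b : ℝ × ℝ} (hs : IsSide Ω a b) {δ : ℤ} (h1 : SideSlope Ω h a b δ) :
    SideSlope Ω h b a δ := by
  obtain ⟨σ, hσ, p1, p2, q1⟩ := h1
  have hpr := prim_spec (side_ratDir hΩ hs)
  obtain ⟨hg, t, ht, hbt⟩ := id hpr
  have e0 : prim (a - b) = -prim (b - a) := by rw [← prim_neg (side_ratDir hΩ hs), neg_sub]
  have key : ∀ y, -σ * crs (toR (prim (a - b))) (y - b) = σ * crs (toR (prim (b - a))) (y - a) := by
    intro y
    have e1 : y - a = (y - b) + (b - a) := by abel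
    have e2 : crs (toR (prim (b - a))) (b - a) = 0 :=
      calc crs (toR (prim (b - a))) (b - a)
          = crs (toR (prim (b - a))) (t • toR (prim (b - a))) := congrArg (crs _) hbt
        _ = 0 := by rw [crs_smul, crs_self, mul_zero]
    rw [e0, toR_neg, crs_smul_left, e1, crs_add', e2]
    ring
  refine ⟨-σ, ?_, ?_, ?_, ?_⟩
  · rcases hσ with e | e <;> simp [e]
  · simpa only [key] using p1
  · simpa only [key] using p2
  · rw [openSegment_symm]; simpa only [key] using q1

theorem corner_bal {Ω C : Set (ℝ × ℝ)} {P : Finset (ℝ × ℝ)} {E : Finset Seg} {m : Seg → ℕ}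
    {h : ℝ × ℝ → ℝ} (L : Lim Ω P E m h) (hΩ : IsLatticePolygon Ω) (hP : ↑P ⊆ interior Ω)
    (hE : EdgeSet E) (hPl : Planar E) (hS : gsupp E = closure (C ∩ interior Ω))
    (hR : ∀ e ∈ E, RatDir (e.2 - e.1)) (hm : ∀ e ∈ E, 0 < m e)
    {v a b : ℝ × ℝ} (hab : a ≠ b) (ha : IsSide Ω v a) (hb : IsSide Ω v b) {δ δ' : ℤ}
    (hd : SideSlope Ω h v a δ) (hd' : SideSlope Ω h v b δ') :
    balSum E m v = δ • prim (a - v) + δ' • prim (b - v) := by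
  classical
  have hB := poly_body hΩ
  have hvf : v ∈ frontier Ω := ha.2.2.2 (left_mem_segment _ _ _)
  have hend := endpoint_of hB hE hPl hS (v := v) (Or.inl hvf.2)
  obtain ⟨r0, hr0, H0⟩ := corner hΩ hab ha hb
  set w : Bool → ℝ × ℝ := fun i => if i then a else b with hw
  set dd : Bool → ℤ := fun i => if i then δ else δ' with hdd
  have hside : ∀ i, IsSide Ω v (w i) := by intro i; cases i <;> simpa [hw]
  have hslope : ∀ i, SideSlope Ω h v (w i) (dd i) := by intro i; cases i <;> simpa [hw, hdd]
  have hpr : ∀ i, PrimOut (w i - v) (prim (w i - v)) := fun i => prim_spec (side_ratDir hΩ (hside i))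
  set ll : Bool → ℝ × ℝ := fun i => toR (prim (w i - v)) with hll
  have hll0 : ∀ i, ll i ≠ 0 := fun i => (hpr i).ne
  choose hg t ht hbt using hpr
  choose σ hσ p1 p2 q1 using hslope
  have hwv : ∀ i, 0 < ‖w i - v‖ := fun i => norm_pos_iff.2 (sub_ne_zero.2 (hside i).1.symm)
  set r := min r0 (min ‖w true - v‖ ‖w false - v‖) with hr
  have hrpos : 0 < r := lt_min hr0 (lt_min (hwv _) (hwv _))
  have hrw : ∀ i, r ≤ ‖w i - v‖ := by
    intro i; cases i
    · exact (min_le_right _ _).trans (min_le_right _ _)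
    · exact (min_le_right _ _).trans (min_le_left _ _)
  have onl : ∀ i, ∀ s : ℝ, 0 < s → v + s • ll i ∈ Metric.ball v r →
      v + s • ll i ∈ openSegment ℝ v (w i) := by
    intro i s hs hb
    rw [Metric.mem_ball, dist_self_add_left, norm_smul, Real.norm_eq_abs, abs_of_pos hs] at hb
    have h1 := hb.trans_le (hrw i)
    rw [hbt i, norm_smul, Real.norm_eq_abs, abs_of_pos (ht i)] at h1
    have h2 : s < t i := lt_of_mul_lt_mul_right h1 (norm_nonneg _)
    rw [openSegment_eq_image']
    refine ⟨s / t i, ⟨div_pos hs (ht i), (div_lt_one (ht i)).2 h2⟩, ?_⟩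
    simp only
    rw [hbt i, smul_smul, div_mul_cancel₀ _ (ht i).ne']
  have hfr : ∀ x ∈ Metric.ball v r, x ∈ frontier Ω → x ≠ v → ∃ i, x ∈ openSegment ℝ v (w i) := by
    intro x hx hxf hxv
    rcases H0 x (Metric.ball_subset_ball (min_le_left _ _) hx) hxf hxv with h | h
    · exact ⟨true, h⟩
    · exact ⟨false, h⟩
  obtain ⟨Cb, hCb⟩ := bar_bound L (v := v) (hσ true) (by simp [crs]) (p2 true)
  have hbal := bdy_bal (m := m) L hB.closed (gsupp_sub hB hS) hR hend hrpos (C := Cb) ll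
    (fun i => (dd i : ℝ)) σ hll0 hσ
    (by
      intro i s hs' hb
      exact ⟨(hside i).2.2.2 (openSegment_subset_segment _ _ _ (onl i s hs' hb)),
        q1 i _ (onl i s hs' hb)⟩)
    (by
      intro x hx hxf hxv
      obtain ⟨i, hi⟩ := hfr x hx hxf hxv
      rw [openSegment_eq_image'] at hi
      obtain ⟨s, hs, e⟩ := hi
      refine ⟨i, s * t i, mul_pos hs.1 (ht i), ?_⟩
      rw [← e, mul_smul, ← hbt i])
    (by
      have hne := sides_crs_ne hab ha hb
      have e1 := hbt true
      have e2 := hbt false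
      simp only [hw, if_true, Bool.false_eq_true, if_false] at e1 e2
      have key : ∀ s u : ℝ, 0 < s → 0 < u → s • ll true ≠ u • ll false := by
        intro s u hs hu e
        apply hne
        have h0 : crs (ll true) (u • ll false) = 0 := by rw [← e, crs_smul, crs_self, mul_zero]
        rw [crs_smul] at h0
        have h1 := (mul_eq_zero.1 h0).resolve_left hu.ne'
        simp only [hll, hw, if_true, Bool.false_eq_true, if_false] at h1
        rw [e1, e2, crs_smul, crs_smul_left, h1]; simp
      intro i j hij s u hs' hu e
      cases i <;> cases j
      · exact hij rfl
      · exact key u s hu hs' e.symm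
      · exact key s u hs' hu e
      · exact hij rfl)
    (by
      intro x hx hxf hxv
      obtain ⟨i, hi⟩ := hfr x hx hxf hxv
      exact no_flat L hΩ hP hE hPl hS hR hm (hside i) hi)
    (fun z _ => hCb z)
  have g1 := congrArg Prod.fst hbal
  have g2 := congrArg Prod.snd hbal
  unfold balSum
  simp only [Prod.fst_sum, Prod.snd_sum, toR, Prod.smul_mk, smul_eq_mul, Fintype.sum_bool, hll, hdd,
    hw, if_true, Bool.false_eq_true, if_false, Prod.fst_add, Prod.snd_add] at g1 g2
  refine Prod.ext ?_ ?_
  · simp only [Prod.fst_sum, Prod.smul_fst, smul_eq_mul, Prod.fst_add]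
    exact_mod_cast g1
  · simp only [Prod.snd_sum, Prod.smul_snd, smul_eq_mul, Prod.snd_add]
    exact_mod_cast g2

theorem side_lin {Ω : Set (ℝ × ℝ)} (hΩ : IsLatticePolygon Ω) {v a b : ℝ × ℝ} (hab : a ≠ b)
    (ha : IsSide Ω v a) (hb : IsSide Ω v b) {x y : ℤ}
    (h : x • prim (a - v) + y • prim (b - v) = 0) : x = 0 := by
  obtain ⟨-, t, ht, e1⟩ := prim_spec (side_ratDir hΩ ha)
  obtain ⟨-, s, hs, e2⟩ := prim_spec (side_ratDir hΩ hb)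
  have hne := sides_crs_ne hab ha hb
  generalize prim (a - v) = l at *
  generalize prim (b - v) = k at *
  rw [e1, e2] at hne
  have h1 : x * l.1 + y * k.1 = 0 := by simpa using congrArg Prod.fst h
  have h2 : x * l.2 + y * k.2 = 0 := by simpa using congrArg Prod.snd h
  have h3 : x * (l.1 * k.2 - l.2 * k.1) = 0 := by linear_combination k.2 * h1 - k.1 * h2
  rcases mul_eq_zero.1 h3 with h4 | h4
  · exact h4
  · exfalso
    apply hne
    have h5 : (l.1 : ℝ) * k.2 - l.2 * k.1 = 0 := by exact_mod_cast h4
    simp only [crs, toR, Prod.smul_mk, smul_eq_mul]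
    linear_combination t * s * h5

theorem trop_main
    (Ω : Set (ℝ × ℝ)) (hΩ : IsLatticePolygon Ω)
    (P : Finset (ℝ × ℝ)) (hP : P.Nonempty) (hPΩ : ↑P ⊆ interior Ω)
    (φ : ℕ → V → ℤ) (hφ : ∀ N : ℕ, Relaxes (latGrid Ω N) (stateN Ω P N) (φ N))
    (Ctil : Set (ℝ × ℝ))
    (hC : Filter.Tendsto (fun N => EMetric.hausdorffEdist (devSet Ω N (φ N)) Ctil)
      Filter.atTop (nhds 0))
    (E : Finset Seg) (m : Seg → ℕ)
    (hEdge : EdgeSet E) (hPl : Planar E) (hRat : ∀ e ∈ E, RatDir (e.2 - e.1))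
    (hSupp : gsupp E = closure (Ctil ∩ interior Ω))
    (hmpos : ∀ e ∈ E, 0 < m e) (hW : WeakLimit Ω φ E m) :
    OmegaTropCurve Ω E m := by
  classical
  choose H hH using fun N => exists_odo (hφ N)
  obtain ⟨h, L⟩ := exists_lim (H := H) ⟨hΩ, hPΩ, hP, hH, hC, hSupp⟩ hEdge hPl hRat hmpos hW
  have hB := poly_body hΩ
  have hsl : ∀ a b, IsSide Ω a b → ∃ δ : ℤ, 0 < δ ∧ SideSlope Ω h a b δ := fun a b hs =>
    slope_exists L hΩ hPΩ hEdge hPl hSupp hRat hmpos hs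
  set d : Seg → ℤ := fun s =>
    if hs : ∃ δ : ℤ, 0 < δ ∧ SideSlope Ω h s.1 s.2 δ then hs.choose else 0 with hd
  have hdspec : ∀ a b, IsSide Ω a b → 0 < d (a, b) ∧ SideSlope Ω h a b (d (a, b)) := by
    intro a b hs
    have h1 : ∃ δ : ℤ, 0 < δ ∧ SideSlope Ω h (a, b).1 (a, b).2 δ := hsl a b hs
    have h2 : d (a, b) = h1.choose := by rw [hd]; exact dif_pos h1
    rw [h2]
    exact h1.choose_spec
  have hout : OuterBalEq Ω E m d := fun v hv a b hab ha hb =>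
    corner_bal L hΩ hPΩ hEdge hPl hSupp hRat hmpos hab ha hb (hdspec v a ha).2 (hdspec v b hb).2
  refine ⟨hEdge, hPl, hmpos, hRat, gsupp_sub hB hSupp, ?_, ?_, d, ?_, hout, ?_⟩
  · ext v
    constructor
    · rintro ⟨hg, hf⟩
      rcases side_or_extreme hB hf with h1 | ⟨A, B, hs, hv⟩
      · exact h1
      · exact absurd hg (no_flat L hΩ hPΩ hEdge hPl hSupp hRat hmpos hs hv)
    · intro hv
      obtain ⟨a, b, hab, ha, hb⟩ := two_sides hΩ hv
      refine ⟨?_, ha.2.2.2 (left_mem_segment _ _ _)⟩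
      by_contra hg
      have hz : balSum E m v = 0 := by
        unfold balSum
        rw [Finset.filter_eq_empty_iff.2, Finset.sum_empty]
        intro e he h1
        apply hg
        rw [mem_gsupp]
        refine ⟨e, he, ?_⟩
        rcases h1 with h1 | h1 <;> rw [← h1]
        · exact left_mem_segment _ _ _
        · exact right_mem_segment _ _ _
      have h2 := hout v hv a b hab ha hb
      rw [hz] at h2
      have := side_lin hΩ hab ha hb h2.symm
      have := (hdspec v a ha).1
      omega
  · intro v hv hvi
    exact int_bal L hEdge hRat hvi (endpoint_of hB hEdge hPl hSupp (Or.inr hv))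
  · intro a b hs
    exact ⟨(hdspec a b hs).1, slope_unique hΩ hs (hdspec a b hs).2
      (slope_symm hΩ hs.symm (hdspec b a hs.symm).2)⟩
  · intro d' _ hd' a b hs
    obtain ⟨x, y, hxy, hx, hy⟩ := two_sides hΩ hs.2.1
    have : ∃ c, b ≠ c ∧ IsSide Ω a c := by
      by_cases hbx : b = x
      · exact ⟨y, by rw [hbx]; exact hxy, hy⟩
      · exact ⟨x, hbx, hx⟩
    obtain ⟨c, hbc, hc⟩ := this
    have e1 := hd' a hs.2.1 b c hbc hs hc
    have e2 := hout a hs.2.1 b c hbc hs hc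
    have e3 : (d' (a, b) - d (a, b)) • prim (b - a) + (d' (a, c) - d (a, c)) • prim (c - a) = 0 := by
      rw [e2] at e1
      rw [sub_smul, sub_smul, sub_add_sub_comm, e1, sub_self]
    have := side_lin hΩ hbc hs hc e3
    omega

/-- The set `C_{Ω,P}` (the closure of `C̃_{Ω,P} ∩ Ω°`, where `C̃_{Ω,P}`
is the Hausdorff limit of the scaled deviation sets), equipped with its edge
decomposition `E` and the positive integer weights `m` arising from the weak-* limit of
the deviation densities, is an `Ω`-tropical curve. -/
theorem statement5
    (Ω : Set (ℝ × ℝ)) (hΩ : IsLatticePolygon Ω)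
    (P : Finset (ℝ × ℝ)) (hP : P.Nonempty) (hPΩ : ↑P ⊆ interior Ω)
    (φ : ℕ → V → ℤ) (hφ : ∀ N : ℕ, Relaxes (latGrid Ω N) (stateN Ω P N) (φ N))
    (Ctil : Set (ℝ × ℝ)) (hCcl : IsClosed Ctil)
    (hC : Filter.Tendsto (fun N => EMetric.hausdorffEdist (devSet Ω N (φ N)) Ctil)
      Filter.atTop (nhds 0))
    (E : Finset Seg) (m : Seg → ℕ)
    (hEdge : EdgeSet E) (hPl : Planar E) (hRat : ∀ e ∈ E, RatDir (e.2 - e.1))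
    (hSupp : gsupp E = closure (Ctil ∩ interior Ω))
    (hmpos : ∀ e ∈ E, 0 < m e) (hW : WeakLimit Ω φ E m)
    :
    OmegaTropCurve Ω E m := by
  exact trop_main Ω hΩ P hP hPΩ φ hφ Ctil hC E m hEdge hPl hRat hSupp hmpos hW
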